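/- There exist absolute constants η ∈ (0, 1/81), C > 0 and K > 0 such that for every integer q ≥ 3 and every set 𝓑 that is the union of B distinct reduced residue classes modulo q (1 ≤ B ≤ φ(q)), the analytic continuation of G_𝓑(s) satisfies |G_𝓑(s)| ≤ K·q^{1/2}(log q)²·(C·B̲)^{B̲}·(1 + |τ|)^{1/2} for all s = σ + iτ in the region {σ ≥ 1 − c₀/(1 + log⁺|τ|)} with c₀ = η/(q^{1/2}(log q)²), where B̲ = min{B, φ(q) − B} and (C·B̲)^{B̲} is interpreted as 1 when B̲ = 0. -/

import Mathlib

noncomputable section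

/-- `log⁺ y = max {0, log y}`. -/
def logPlus (y : ℝ) : ℝ := max 0 (Real.log y)

/-- The region `{s = σ + iτ : σ ≥ 1 - c₀ / (1 + log⁺ |τ|)}`. -/
def sdRegion (c₀ : ℝ) : Set ℂ := {s : ℂ | 1 - c₀ / (1 + logPlus |s.im|) ≤ s.re}

/-- `log ζ(s) = ∑_{n ≥ 2} Λ(n) / (n^s log n)`, for `Re s > 1`. -/
def logZeta (s : ℂ) : ℂ :=
  ∑' n : ℕ, (ArithmeticFunction.vonMangoldt n : ℂ) / ((n : ℂ) ^ s * (Real.log n : ℂ))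

/-- `G_𝓑(s) = ζ(s)^{-β} ∏_{p ∈ 𝓑} (1 - p^{-s})⁻¹`, for `Re s > 1`, where the set `𝓑`
is encoded by the finite set `A` of residue classes mod `q` and `β = |A|/φ(q)`. -/
def GB (q : ℕ) (A : Finset (ZMod q)) (s : ℂ) : ℂ :=
  Complex.exp (-((A.card : ℂ) / (q.totient : ℂ)) * logZeta s) *
    ∏' p : Nat.Primes, (if ((p : ℕ) : ZMod q) ∈ A then (1 - ((p : ℕ) : ℂ) ^ (-s))⁻¹ else 1)

section

open Complex Metric Set

/-- A zero-free holomorphic function on a disc, with `‖f‖ ≤ K`, has logarithmic derivative at the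
centre bounded by `4 log (K / ‖f 0‖) / r`. -/
theorem norm_deriv_div_le_of_ne_zero {f : ℂ → ℂ} {r K : ℝ} (hr : 0 < r)
    (hf : Differentiable ℂ f) (h0 : ∀ z ∈ ball (0 : ℂ) r, f z ≠ 0)
    (hK : ∀ z ∈ ball (0 : ℂ) r, ‖f z‖ ≤ K) :
    ‖deriv f 0 / f 0‖ ≤ 4 * Real.log (K / ‖f 0‖) / r := by
  have h00 : f 0 ≠ 0 := h0 0 (mem_ball_self hr)
  have hpos : 0 < ‖f 0‖ := norm_pos_iff.2 h00
  have hK0 : ‖f 0‖ ≤ K := hK 0 (mem_ball_self hr)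
  have hd : DifferentiableOn ℂ (fun z => deriv f z / f z) (ball 0 r) := by
    apply DifferentiableOn.div _ hf.differentiableOn h0
    exact (hf.differentiableOn (s := univ)).deriv isOpen_univ |>.mono (subset_univ _)
  obtain ⟨l, hl0, hl⟩ := hd.isExactOn_ball.with_val_at 0 0
  have hexp : ∀ z ∈ ball (0 : ℂ) r, f z = f 0 * exp (l z) := by
    have hconst : ∀ z ∈ ball (0 : ℂ) r, f z * exp (-l z) = f 0 * exp (-l 0) := by
      intro z hz
      apply (convex_ball (0 : ℂ) r).is_const_of_fderivWithin_eq_zero (𝕜 := ℂ)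
        (f := fun z => f z * exp (-l z)) _ _ hz (mem_ball_self hr)
      · exact hf.differentiableOn.mul
          (fun z hz => ((hl z hz).differentiableAt.neg.cexp).differentiableWithinAt)
      · intro x hx
        have h1 : HasDerivAt (fun z => f z * exp (-l z)) 0 x := by
          refine ((hf x).hasDerivAt.mul (hl x hx).neg.cexp).congr_deriv ?_
          rw [mul_neg, mul_neg, mul_left_comm, mul_div_cancel₀ _ (h0 x hx)]
          ring
        rw [fderivWithin_of_isOpen isOpen_ball hx, h1.hasFDerivAt.fderiv]
        ext; simp
    intro z hz
    have := hconst z hz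
    rw [hl0, neg_zero, exp_zero, mul_one] at this
    rw [← this, mul_assoc, ← exp_add]; simp
  have hld : deriv l 0 = deriv f 0 / f 0 := (hl 0 (mem_ball_self hr)).deriv
  have key : ∀ M : ℝ, 0 < M → Real.log (K / ‖f 0‖) ≤ M → ‖deriv f 0 / f 0‖ ≤ 4 * M / r := by
    intro M hM hle
    have hre : MapsTo l (ball 0 r) {z | z.re ≤ M} := by
      intro z hz
      refine le_trans ?_ hle
      rw [Real.le_log_iff_exp_le (div_pos (hpos.trans_le hK0) hpos)]
      rw [le_div_iff₀ hpos, ← norm_exp, mul_comm, ← norm_mul, ← hexp z hz]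
      exact hK z hz
    have hb : ∀ z ∈ sphere (0 : ℂ) (r / 2), ‖l z‖ ≤ 2 * M := by
      intro z hz
      have hzn : ‖z‖ = r / 2 := by simpa using hz
      have := borelCaratheodory_zero hM
        (fun z hz => (hl z hz).differentiableAt.differentiableWithinAt) hre hr
        (z := z) (by simp [hzn]; linarith) hl0
      rw [hzn] at this
      convert this using 1
      field_simp; ring
    have := norm_deriv_le_of_forall_mem_sphere_norm_le (f := l) (c := 0) (half_pos hr)
      (DifferentiableOn.diffContOnCl (fun z hz => by
        rw [closure_ball _ (half_pos hr).ne'] at hz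
        exact (hl z (closedBall_subset_ball (by linarith) hz)).differentiableAt.differentiableWithinAt))
      hb
    rw [hld] at this
    convert this using 1
    field_simp; ring
  have hlog : 0 ≤ Real.log (K / ‖f 0‖) := Real.log_nonneg (by rwa [le_div_iff₀ hpos, one_mul])
  apply le_of_forall_pos_le_add
  intro ε hε
  have := key (Real.log (K / ‖f 0‖) + ε * r / 4) (by positivity) (by simp; positivity)
  have h4 : 4 * (Real.log (K / ‖f 0‖) + ε * r / 4) / r = 4 * Real.log (K / ‖f 0‖) / r + ε := by
    rw [mul_add, add_div]; congr 1; field_simp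
  rwa [h4] at this

/-- Dividing out a zero `ρ` by a Blaschke factor for the disc of radius `R`. -/
theorem exists_blaschke_quotient {f : ℂ → ℂ} {R : ℝ} {ρ : ℂ} (hR : 0 < R)
    (hf : Differentiable ℂ f) (hρ : f ρ = 0) (hρR : ‖ρ‖ < R) (hf0 : f 0 ≠ 0) :
    ∃ g : ℂ → ℂ, Differentiable ℂ g ∧ (∀ z ∈ sphere (0 : ℂ) R, ‖g z‖ = ‖f z‖) ∧
      ‖g 0‖ * ‖ρ‖ = ‖f 0‖ * R ∧ (∀ z ∈ ball (0 : ℂ) R, g z = 0 → f z = 0) ∧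
      deriv f 0 / f 0 = deriv g 0 / g 0 - 1 / ρ + (starRingEnd ℂ) ρ / R ^ 2 := by
  have hρ0 : ρ ≠ 0 := by rintro rfl; exact hf0 hρ
  have hRc : (R : ℂ) ≠ 0 := by exact_mod_cast hR.ne'
  have hd : Differentiable ℂ (dslope f ρ) := by
    rw [← differentiableOn_univ] at hf ⊢
    exact (differentiableOn_dslope Filter.univ_mem).2 hf
  have hfe : ∀ z, f z = (z - ρ) * dslope f ρ z := by
    intro z
    have := sub_smul_dslope f ρ z
    rw [hρ, sub_zero, smul_eq_mul] at this
    exact this.symm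
  refine ⟨fun z => dslope f ρ z * ((R ^ 2 - (starRingEnd ℂ) ρ * z) / R), by fun_prop, ?_, ?_, ?_, ?_⟩
  · intro z hz
    have hzn : ‖z‖ = R := by simpa using hz
    have hz2 : (R : ℂ) ^ 2 = z * (starRingEnd ℂ) z := by
      rw [mul_conj, normSq_eq_norm_sq, hzn]; push_cast; rfl
    simp only [hfe z, norm_mul, norm_div]
    rw [hz2, show z * (starRingEnd ℂ) z - (starRingEnd ℂ) ρ * z = z * (starRingEnd ℂ) (z - ρ) by
      simp; ring, norm_mul, norm_conj, hzn]
    simp [abs_of_pos hR]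
    field_simp
  · simp only [mul_zero, sub_zero, norm_mul, norm_div, norm_pow, hfe 0, zero_sub, norm_neg]
    simp [abs_of_pos hR]
    field_simp
  · intro z hz h
    rcases mul_eq_zero.1 h with h | h
    · rw [hfe, h, mul_zero]
    · exfalso
      rw [div_eq_zero_iff, or_iff_left hRc, sub_eq_zero] at h
      have h2 : R ^ 2 = ‖ρ‖ * ‖z‖ := by
        have := congrArg norm h
        simpa [norm_mul, norm_conj] using this
      have hz' : ‖z‖ < R := by simpa using hz
      nlinarith [norm_nonneg ρ, norm_nonneg z]
  · have hs0 : dslope f ρ 0 ≠ 0 := fun h => hf0 (by rw [hfe, h, mul_zero])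
    have h1 : HasDerivAt f (1 * dslope f ρ 0 + (0 - ρ) * deriv (dslope f ρ) 0) 0 := by
      exact (((hasDerivAt_id (0 : ℂ)).sub_const ρ).mul (hd 0).hasDerivAt).congr_of_eventuallyEq
        (Filter.Eventually.of_forall hfe)
    have h2 : HasDerivAt (fun z => dslope f ρ z * ((R ^ 2 - (starRingEnd ℂ) ρ * z) / R))
        (deriv (dslope f ρ) 0 * ((R ^ 2 - (starRingEnd ℂ) ρ * 0) / R) +
          dslope f ρ 0 * (-((starRingEnd ℂ) ρ) / R)) 0 := by
      refine (hd 0).hasDerivAt.mul ?_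
      have := (((hasDerivAt_id (0 : ℂ)).const_mul ((starRingEnd ℂ) ρ)).const_sub
        ((R : ℂ) ^ 2)).div_const (R : ℂ)
      simpa using this
    rw [h1.deriv, h2.deriv, hfe 0]
    simp only [mul_zero, sub_zero, zero_sub]
    field_simp
    ring

/-- If `f` has no zeros with positive real part in the disc, its logarithmic derivative at the
centre has real part bounded below. -/
theorem re_deriv_div_ge {R K : ℝ} (hR : 0 < R) (n : ℕ) : ∀ f : ℂ → ℂ, Differentiable ℂ f →
    f 0 ≠ 0 → (∀ z ∈ sphere (0 : ℂ) R, ‖f z‖ ≤ K) →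
    (∀ z ∈ ball (0 : ℂ) R, f z = 0 → z.re ≤ 0) → K < 2 ^ n * ‖f 0‖ →
    -(8 * Real.log (K / ‖f 0‖) / R) ≤ (deriv f 0 / f 0).re := by
  have hmax : ∀ f : ℂ → ℂ, Differentiable ℂ f → (∀ z ∈ sphere (0 : ℂ) R, ‖f z‖ ≤ K) →
      ∀ z ∈ ball (0 : ℂ) R, ‖f z‖ ≤ K := by
    intro f hf hK z hz
    refine norm_le_of_forall_mem_frontier_norm_le isBounded_ball hf.diffContOnCl
      (fun z hz => hK z ?_) (subset_closure hz)
    rwa [frontier_ball _ hR.ne'] at hz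
  induction n with
  | zero =>
    intro f hf h0 hK _ hlt
    have := hmax f hf hK 0 (mem_ball_self hR)
    simp at hlt; linarith
  | succ n ih =>
    intro f hf h0 hK hz hlt
    have hpos : 0 < ‖f 0‖ := norm_pos_iff.2 h0
    have hK0 := hmax f hf hK 0 (mem_ball_self hR)
    by_cases hzero : ∃ ρ ∈ ball (0 : ℂ) (R / 2), f ρ = 0
    · obtain ⟨ρ, hρb, hρ⟩ := hzero
      have hρn : ‖ρ‖ < R / 2 := by simpa using hρb
      have hρ0 : ρ ≠ 0 := by rintro rfl; exact h0 hρ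
      have hρpos : 0 < ‖ρ‖ := norm_pos_iff.2 hρ0
      have hρre : ρ.re ≤ 0 := hz ρ (ball_subset_ball (by linarith) hρb) hρ
      obtain ⟨g, hg, hgs, hg0, hgz, hgd⟩ := exists_blaschke_quotient hR hf hρ (by linarith) h0
      have h2 : 2 * ‖f 0‖ ≤ ‖g 0‖ := by nlinarith [norm_nonneg (g 0)]
      have hgpos : 0 < ‖g 0‖ := by linarith
      have := ih g hg (norm_pos_iff.1 hgpos) (fun z hz => by rw [hgs z hz]; exact hK z hz)
        (fun z hz' h => hz z hz' (hgz z hz' h)) (by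
          rw [pow_succ] at hlt
          calc K < 2 ^ n * 2 * ‖f 0‖ := hlt
            _ = 2 ^ n * (2 * ‖f 0‖) := by ring
            _ ≤ _ := by gcongr)
      have hcmp : (deriv g 0 / g 0).re ≤ (deriv f 0 / f 0).re := by
        rw [hgd]
        have : (-(1 / ρ) + (starRingEnd ℂ) ρ / R ^ 2).re = -ρ.re * (1 / ‖ρ‖ ^ 2 - 1 / R ^ 2) := by
          rw [← ofReal_pow, add_re, neg_re, div_ofReal_re, conj_re, one_div, inv_re,
            normSq_eq_norm_sq]
          ring
        have h3 : 0 ≤ -ρ.re * (1 / ‖ρ‖ ^ 2 - 1 / R ^ 2) := by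
          apply mul_nonneg (by linarith)
          rw [sub_nonneg]
          apply one_div_le_one_div_of_le (by positivity)
          gcongr; linarith
        rw [sub_add, sub_re]
        rw [add_re, neg_re] at this
        rw [sub_re]
        linarith
      refine le_trans ?_ (this.trans hcmp)
      have : K / ‖g 0‖ ≤ K / ‖f 0‖ := by
        apply div_le_div_of_nonneg_left (by linarith) hpos (by linarith)
      have hKg : 0 < K / ‖g 0‖ := div_pos (by linarith) hgpos
      gcongr
    · push Not at hzero
      have := norm_deriv_div_le_of_ne_zero (half_pos hR) hf hzero
        (fun z hz' => hmax f hf hK z (ball_subset_ball (by linarith) hz'))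
      have h4 := (abs_le.1 (abs_re_le_norm (deriv f 0 / f 0))).1
      have h5 : 4 * Real.log (K / ‖f 0‖) / (R / 2) = 8 * Real.log (K / ‖f 0‖) / R := by
        field_simp; ring
      linarith

/-- One-sided Landau lemma at a point `s₀`. -/
theorem re_deriv_div_ge_at {f : ℂ → ℂ} {s₀ : ℂ} {R K : ℝ} (hR : 0 < R) (hf : Differentiable ℂ f)
    (h0 : f s₀ ≠ 0) (hK : ∀ z ∈ sphere s₀ R, ‖f z‖ ≤ K)
    (hz : ∀ z, f z = 0 → z.re ≤ s₀.re) :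
    -(8 * Real.log (K / ‖f s₀‖) / R) ≤ (deriv f s₀ / f s₀).re := by
  obtain ⟨n, hn⟩ := pow_unbounded_of_one_lt (K / ‖f s₀‖) one_lt_two
  have := re_deriv_div_ge (K := K) hR n (fun z => f (z + s₀)) (by fun_prop) (by simpa using h0)
    (fun z hz => hK _ (by simpa using hz)) (fun z _ h => by simpa using hz _ h)
    (by rw [div_lt_iff₀ (norm_pos_iff.2 h0)] at hn; simpa using hn)
  simpa [deriv_comp_add_const] using this

/-- One-sided Landau lemma at a point `s₀`, keeping a zero at horizontal distance `y`. -/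
theorem re_deriv_div_ge_at_of_zero {f : ℂ → ℂ} {s₀ : ℂ} {R K y : ℝ} (hR : 0 < R)
    (hf : Differentiable ℂ f)
    (h0 : f s₀ ≠ 0) (hK : ∀ z ∈ sphere s₀ R, ‖f z‖ ≤ K)
    (hz : ∀ z, f z = 0 → z.re ≤ s₀.re) (hy : 0 < y) (hyR : y < R) (hρ : f (s₀ - y) = 0) :
    1 / y - 1 / R - 8 * Real.log (K / ‖f s₀‖) / R ≤ (deriv f s₀ / f s₀).re := by
  have hpos : 0 < ‖f s₀‖ := norm_pos_iff.2 h0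
  have hf' : Differentiable ℂ (fun z => f (z + s₀)) := by fun_prop
  obtain ⟨g, hg, hgs, hg0, hgz, hgd⟩ := exists_blaschke_quotient (ρ := (-y : ℂ)) hR hf'
    (by rw [← hρ]; ring_nf) (by simpa [abs_of_pos hy] using hyR) (by simpa using h0)
  simp only [norm_neg, norm_real, Real.norm_eq_abs, abs_of_pos hy, zero_add] at hg0
  have hle : ‖f s₀‖ ≤ ‖g 0‖ := by
    by_contra! h
    nlinarith [norm_nonneg (g 0)]
  have hgpos : 0 < ‖g 0‖ := by linarith
  obtain ⟨n, hn⟩ := pow_unbounded_of_one_lt (K / ‖g 0‖) one_lt_two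
  rw [div_lt_iff₀ hgpos] at hn
  have hKg : ∀ z ∈ sphere (0 : ℂ) R, ‖g z‖ ≤ K := fun z hz => by
    rw [hgs z hz]; exact hK _ (by simpa using hz)
  have h1 := re_deriv_div_ge (K := K) hR n g hg (norm_pos_iff.1 hgpos) hKg
    (fun z hz' h => by simpa using hz _ (hgz z hz' h)) hn
  have hKpos : 0 < K := by
    refine lt_of_lt_of_le hgpos ?_
    refine norm_le_of_forall_mem_frontier_norm_le isBounded_ball hg.diffContOnCl
      (fun z hz => hKg z ?_) (subset_closure (mem_ball_self hR))
    rwa [frontier_ball _ hR.ne'] at hz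
  have h2 : 8 * Real.log (K / ‖g 0‖) / R ≤ 8 * Real.log (K / ‖f s₀‖) / R := by
    gcongr
  have h3 : (deriv f s₀ / f s₀).re = (deriv g 0 / g 0).re + 1 / y - y / R ^ 2 := by
    have : deriv (fun z => f (z + s₀)) 0 = deriv f s₀ := by simp [deriv_comp_add_const]
    rw [this] at hgd
    simp only [zero_add] at hgd
    rw [hgd, map_neg, conj_ofReal, ← ofReal_neg, ← ofReal_pow, ← ofReal_one, ← ofReal_div,
      ← ofReal_div, add_re, sub_re, ofReal_re, ofReal_re]
    field_simp
    ring
  have h4 : y / R ^ 2 ≤ 1 / R := by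
    rw [div_le_div_iff₀ (by positivity) hR]; nlinarith
  rw [h3]; linarith

end

section

open Complex Set Finset

/-- Mean value estimate for `x ↦ x ^ (-s)`. -/
theorem norm_cpow_neg_sub_le {s : ℂ} (hs : 0 ≤ s.re) {a b : ℝ} (ha : 0 < a) (hab : a ≤ b) :
    ‖(b : ℂ) ^ (-s) - (a : ℂ) ^ (-s)‖ ≤ ‖s‖ * a ^ (-s.re - 1) * (b - a) := by
  have key := norm_image_sub_le_of_norm_deriv_le_segment' (a := a) (b := b)
    (f := fun x : ℝ => (x : ℂ) ^ (-s)) (f' := fun x : ℝ => (-s) * (x : ℂ) ^ (-s - 1))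
    (C := ‖s‖ * a ^ (-s.re - 1)) (fun x hx => ?_) (fun x hx => ?_) b (right_mem_Icc.2 hab)
  · exact key
  · have hx0 : 0 < x := ha.trans_le hx.1
    have h1 := (hasDerivAt_id (x : ℂ)).cpow_const (c := -s) (by simp [slitPlane, hx0])
    simpa using (h1.comp_ofReal).hasDerivWithinAt
  · have hx0 : 0 < x := ha.trans_le hx.1
    rw [norm_mul, norm_neg, norm_cpow_eq_rpow_re_of_pos hx0]
    gcongr
    simp only [sub_re, neg_re, one_re]
    exact Real.rpow_le_rpow_of_nonpos ha hx.1 (by linarith)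

theorem norm_linear_add_cpow_le {s : ℂ} (hs : 0 ≤ s.re) {a : ℝ} (ha : 0 < a) :
    ‖(s - 1) * (a : ℂ) ^ (-s) + ((a + 1 : ℝ) : ℂ) ^ (1 - s) - (a : ℂ) ^ (1 - s)‖ ≤
      ‖s - 1‖ * ‖s‖ * a ^ (-s.re - 1) := by
  have key := norm_image_sub_le_of_norm_deriv_le_segment' (a := a) (b := a + 1)
    (f := fun x : ℝ => (s - 1) * (a : ℂ) ^ (-s) * (x : ℂ) + (x : ℂ) ^ (1 - s))
    (f' := fun x : ℝ => (s - 1) * (a : ℂ) ^ (-s) + (1 - s) * (x : ℂ) ^ (-s))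
    (C := ‖s - 1‖ * ‖s‖ * a ^ (-s.re - 1)) (fun x hx => ?_) (fun x hx => ?_) (a + 1)
      (right_mem_Icc.2 (by linarith))
  · rw [show (a + 1 : ℝ) - a = 1 by ring, mul_one] at key
    refine le_trans (le_of_eq (congrArg norm ?_)) key
    push_cast; ring
  · have hx0 : 0 < x := ha.trans_le hx.1
    have h1 := (hasDerivAt_id (x : ℂ)).cpow_const (c := 1 - s) (by simp [slitPlane, hx0])
    have h2 := ((hasDerivAt_id (x : ℂ)).const_mul ((s - 1) * (a : ℂ) ^ (-s))).add h1
    have h3 := h2.comp_ofReal.hasDerivWithinAt (s := Icc a (a + 1))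
    simpa using h3
  · have hx0 : 0 < x := ha.trans_le hx.1
    have := norm_cpow_neg_sub_le hs ha hx.1
    have e : (s - 1) * (a : ℂ) ^ (-s) + (1 - s) * (x : ℂ) ^ (-s) =
      -((s - 1) * ((x : ℂ) ^ (-s) - (a : ℂ) ^ (-s))) := by ring
    rw [e, norm_neg, norm_mul, mul_assoc]
    gcongr
    refine this.trans (mul_le_of_le_one_right (by positivity) ?_)
    linarith [hx.2]

/-- `(a+1)^{-σ-1} ≤ (a^{-σ} - (a+1)^{-σ}) / σ`. -/
theorem rpow_neg_sub_one_le_telescope {σ a : ℝ} (hσ : 0 < σ) (ha : 0 < a) :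
    (a + 1) ^ (-σ - 1) ≤ (a ^ (-σ) - (a + 1) ^ (-σ)) / σ := by
  obtain ⟨c, hc, hc'⟩ := exists_hasDerivAt_eq_slope (fun x : ℝ => x ^ (-σ))
    (fun x : ℝ => -σ * x ^ (-σ - 1)) (lt_add_one a)
    (fun x hx => (Real.continuousAt_rpow_const _ _ (Or.inl (ha.trans_le hx.1).ne')).continuousWithinAt)
    (fun x hx => Real.hasDerivAt_rpow_const (Or.inl (ha.trans hx.1).ne'))
  have h1 : (a + 1) ^ (-σ - 1) ≤ c ^ (-σ - 1) :=
    Real.rpow_le_rpow_of_nonpos (ha.trans hc.1) hc.2.le (by linarith)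
  simp only [add_sub_cancel_left, div_one] at hc'
  rw [le_div_iff₀ hσ]
  nlinarith

theorem summable_rpow_neg_sub_one {σ : ℝ} (hσ : 0 < σ) (N : ℕ) :
    Summable (fun k : ℕ => ((N + 1 + k : ℕ) : ℝ) ^ (-σ - 1)) := by
  have := (Real.summable_nat_rpow.2 (show -σ - 1 < -1 by linarith))
  have h2 := (summable_nat_add_iff (N + 1)).2 this
  refine h2.congr (fun k => ?_)
  rw [add_comm]

theorem tsum_rpow_neg_sub_one_le {σ : ℝ} (hσ : 0 < σ) {N : ℕ} (hN : 1 ≤ N) :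
    ∑' k : ℕ, ((N + 1 + k : ℕ) : ℝ) ^ (-σ - 1) ≤ (N : ℝ) ^ (-σ) / σ := by
  have hN0 : (0 : ℝ) < N := by exact_mod_cast hN
  apply Real.tsum_le_of_sum_range_le (fun k => by positivity)
  intro M
  have : ∑ k ∈ range M, ((N + 1 + k : ℕ) : ℝ) ^ (-σ - 1) ≤
      ((N : ℝ) ^ (-σ) - ((N + M : ℕ) : ℝ) ^ (-σ)) / σ := by
    induction M with
    | zero => simp
    | succ M ih =>
      rw [sum_range_succ]
      have h := rpow_neg_sub_one_le_telescope hσ (a := ((N + M : ℕ) : ℝ))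
        (by push_cast; positivity)
      have e : ((N + 1 + M : ℕ) : ℝ) = ((N + M : ℕ) : ℝ) + 1 := by push_cast; ring
      have e' : ((N + (M + 1) : ℕ) : ℝ) = ((N + M : ℕ) : ℝ) + 1 := by push_cast; ring
      rw [e, e']
      refine (add_le_add ih h).trans (le_of_eq ?_)
      ring
  refine this.trans ?_
  gcongr
  linarith [Real.rpow_nonneg (Nat.cast_nonneg (α := ℝ) (N + M)) (-σ)]

theorem sum_range_mul_by_parts (a g : ℕ → ℂ) (M : ℕ) :
    ∑ k ∈ range M, a k * g k = ∑ k ∈ range M, (∑ j ∈ range (k + 1), a j) * (g k - g (k + 1)) +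
      (∑ j ∈ range M, a j) * g M := by
  induction M with
  | zero => simp
  | succ M ih => rw [sum_range_succ, ih, sum_range_succ _ M, sum_range_succ a M]; ring

variable {q : ℕ} [NeZero q]

theorem DirichletCharacter.sum_range_add_eq_zero {χ : DirichletCharacter ℂ q} (hχ : χ ≠ 1) (N : ℕ) :
    ∑ j ∈ range q, χ ((N + j : ℕ) : ZMod q) = 0 := by
  rw [← MulChar.sum_eq_zero_of_ne_one hχ]
  refine sum_bij (fun j _ => ((N + j : ℕ) : ZMod q)) (fun _ _ => mem_univ _) ?_ ?_ (fun _ _ => rfl)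
  · intro i hi j hj h
    rw [ZMod.natCast_eq_natCast_iff] at h
    exact Nat.ModEq.eq_of_lt_of_lt (Nat.ModEq.add_left_cancel' N h) (mem_range.1 hi) (mem_range.1 hj)
  · intro b _
    refine ⟨(b - N).val, mem_range.2 (ZMod.val_lt _), by simp⟩

theorem DirichletCharacter.norm_sum_range_add_le {χ : DirichletCharacter ℂ q} (hχ : χ ≠ 1) (N M : ℕ) :
    ‖∑ j ∈ range M, χ ((N + j : ℕ) : ZMod q)‖ ≤ q := by
  induction M using Nat.strong_induction_on with
  | _ M ih =>
    rcases lt_or_ge M q with h | h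
    · calc _ ≤ ∑ j ∈ range M, (1 : ℝ) := norm_sum_le_of_le _ (fun j _ => χ.norm_le_one _)
        _ ≤ q := by simp; exact_mod_cast h.le
    · obtain ⟨m, rfl⟩ := Nat.exists_eq_add_of_le h
      rw [sum_range_add, DirichletCharacter.sum_range_add_eq_zero hχ, zero_add]
      convert ih m (by have := NeZero.pos q; omega) using 4
      push_cast; simp

/-- Tail of the Dirichlet series of `χ` after summation by parts. -/
noncomputable def DirichletCharacter.tailTerm (χ : DirichletCharacter ℂ q) (N : ℕ) (s : ℂ) (k : ℕ) : ℂ :=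
  (∑ j ∈ range (k + 1), χ ((N + 1 + j : ℕ) : ZMod q)) *
    (((N + 1 + k : ℕ) : ℂ) ^ (-s) - ((N + 1 + (k + 1) : ℕ) : ℂ) ^ (-s))

theorem DirichletCharacter.norm_tailTerm_le {χ : DirichletCharacter ℂ q} (hχ : χ ≠ 1) (N : ℕ) {s : ℂ}
    (hs : 0 < s.re) (k : ℕ) :
    ‖χ.tailTerm N s k‖ ≤ q * ‖s‖ * ((N + 1 + k : ℕ) : ℝ) ^ (-s.re - 1) := by
  rw [tailTerm, norm_mul, mul_assoc]
  gcongr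
  · exact norm_sum_range_add_le hχ _ _
  · have := norm_cpow_neg_sub_le hs.le (a := ((N + 1 + k : ℕ) : ℝ)) (b := ((N + 1 + (k + 1) : ℕ) : ℝ))
      (by positivity) (by push_cast; linarith)
    rw [norm_sub_rev]
    refine (le_trans (le_of_eq ?_) this).trans (le_of_eq ?_)
    · simp only [ofReal_natCast]
    · push_cast; ring

theorem DirichletCharacter.summable_tailTerm {χ : DirichletCharacter ℂ q} (hχ : χ ≠ 1) (N : ℕ) {s : ℂ}
    (hs : 0 < s.re) : Summable (χ.tailTerm N s) :=
  Summable.of_norm_bounded ((summable_rpow_neg_sub_one hs N).mul_left _) (norm_tailTerm_le hχ N hs)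

theorem DirichletCharacter.differentiableOn_tailTerm {χ : DirichletCharacter ℂ q} (hχ : χ ≠ 1) (N : ℕ) :
    DifferentiableOn ℂ (fun s => ∑' k, χ.tailTerm N s k) {s | 0 < s.re} := by
  intro s₀ hs₀
  have hs₀' : 0 < s₀.re := hs₀
  set U : Set ℂ := {s | s₀.re / 2 < s.re} ∩ Metric.ball 0 (‖s₀‖ + 1) with hU
  have hUo : IsOpen U := (isOpen_lt continuous_const continuous_re).inter Metric.isOpen_ball
  have hmem : s₀ ∈ U := ⟨show s₀.re / 2 < s₀.re by linarith, by simp⟩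
  have := differentiableOn_tsum_of_summable_norm (F := fun k s => χ.tailTerm N s k) (U := U)
    ((summable_rpow_neg_sub_one (half_pos hs₀') N).mul_left (q * (‖s₀‖ + 1))) (fun k => ?_) hUo ?_
  · exact (this.differentiableAt (hUo.mem_nhds hmem)).differentiableWithinAt
  · apply Differentiable.differentiableOn
    unfold tailTerm
    intro s
    refine DifferentiableAt.const_mul (DifferentiableAt.sub ?_ ?_) _
    all_goals
      refine DifferentiableAt.const_cpow (by fun_prop) (Or.inl ?_)
      exact Nat.cast_ne_zero.2 (by omega)
  · rintro k s ⟨hs1, hs2⟩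
    have hs1' : s₀.re / 2 < s.re := hs1
    refine (norm_tailTerm_le hχ N (by linarith) k).trans ?_
    have : ‖s‖ < ‖s₀‖ + 1 := by simpa using hs2
    gcongr
    exact_mod_cast (by omega : 1 ≤ N + 1 + k)

theorem DirichletCharacter.LFunction_eq_sum_add_tsum_of_one_lt {χ : DirichletCharacter ℂ q} (hχ : χ ≠ 1)
    (N : ℕ) {s : ℂ} (hs : 1 < s.re) :
    χ.LFunction s = ∑ n ∈ range N, χ ((n + 1 : ℕ) : ZMod q) * ((n + 1 : ℕ) : ℂ) ^ (-s) +
      ∑' k, χ.tailTerm N s k := by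
  have hsum := LSeriesSummable_of_one_lt_re χ hs
  have hterm : ∀ n : ℕ, LSeries.term (fun n => χ n) s (n + 1) =
      χ ((n + 1 : ℕ) : ZMod q) * ((n + 1 : ℕ) : ℂ) ^ (-s) := by
    intro n
    rw [LSeries.term_of_ne_zero (by omega), cpow_neg, div_eq_mul_inv]
  rw [LFunction_eq_LSeries χ hs, LSeries]
  have h1 := hsum.sum_add_tsum_nat_add (N + 1)
  rw [← h1, sum_range_succ', LSeries.term_zero, add_zero, sum_congr rfl (fun n _ => hterm n)]
  congr 1
  have hs2 : Summable (fun i => LSeries.term (fun n => χ n) s (i + (N + 1))) :=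
    (summable_nat_add_iff (N + 1)).2 hsum
  have e : ∀ i, LSeries.term (fun n => χ n) s (i + (N + 1)) =
      χ ((N + 1 + i : ℕ) : ZMod q) * ((N + 1 + i : ℕ) : ℂ) ^ (-s) := by
    intro i
    rw [show i + (N + 1) = (N + i) + 1 by ring, hterm, show N + i + 1 = N + 1 + i by ring]
  simp_rw [e] at hs2 ⊢
  have t1 := hs2.hasSum.tendsto_sum_nat
  have t2 := (summable_tailTerm hχ N (s := s) (by linarith)).hasSum.tendsto_sum_nat
  have t3 : Filter.Tendsto (fun M => (∑ j ∈ range M, χ ((N + 1 + j : ℕ) : ZMod q)) *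
      ((N + 1 + M : ℕ) : ℂ) ^ (-s)) Filter.atTop (nhds 0) := by
    have hb : Filter.Tendsto (fun M : ℕ => (q : ℝ) * ((N + 1 + M : ℕ) : ℝ) ^ (-s.re))
        Filter.atTop (nhds 0) := by
      have := (tendsto_rpow_neg_atTop (show 0 < s.re by linarith)).comp
        (tendsto_natCast_atTop_atTop.comp (Filter.tendsto_add_atTop_nat (N + 1)))
      simpa [Function.comp_def, add_comm] using this.const_mul (q : ℝ)
    refine squeeze_zero_norm (fun M => ?_) hb
    rw [norm_mul]
    gcongr
    · exact norm_sum_range_add_le hχ _ _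
    · rw [norm_natCast_cpow_of_pos (by omega), neg_re]
  have t4 := t2.add t3
  rw [add_zero] at t4
  refine tendsto_nhds_unique t1 (t4.congr (fun M => ?_))
  exact (sum_range_mul_by_parts (fun j => χ ((N + 1 + j : ℕ) : ZMod q))
    (fun k => ((N + 1 + k : ℕ) : ℂ) ^ (-s)) M).symm

theorem isPreconnected_re_pos : IsPreconnected {s : ℂ | 0 < s.re} :=
  (convex_halfSpace_re_gt 0).isPreconnected

theorem DirichletCharacter.LFunction_eq_sum_add_tsum {χ : DirichletCharacter ℂ q} (hχ : χ ≠ 1)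
    (N : ℕ) {s : ℂ} (hs : 0 < s.re) :
    χ.LFunction s = ∑ n ∈ range N, χ ((n + 1 : ℕ) : ZMod q) * ((n + 1 : ℕ) : ℂ) ^ (-s) +
      ∑' k, χ.tailTerm N s k := by
  have hUo : IsOpen {s : ℂ | 0 < s.re} := isOpen_lt continuous_const continuous_re
  refine AnalyticOnNhd.eqOn_of_preconnected_of_eventuallyEq (𝕜 := ℂ) (U := {s : ℂ | 0 < s.re}) (z₀ := 2)
    (f := χ.LFunction)
    (g := fun s => ∑ n ∈ range N, χ ((n + 1 : ℕ) : ZMod q) * ((n + 1 : ℕ) : ℂ) ^ (-s) +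
      ∑' k, χ.tailTerm N s k) ?_ ?_ isPreconnected_re_pos (by simp) ?_ hs
  · exact ((differentiable_LFunction hχ).differentiableOn).analyticOnNhd hUo
  · refine DifferentiableOn.analyticOnNhd ?_ hUo
    refine DifferentiableOn.add ?_ (differentiableOn_tailTerm hχ N)
    refine DifferentiableOn.fun_sum (fun n _ => Differentiable.differentiableOn (fun z => ?_))
    refine DifferentiableAt.const_mul (DifferentiableAt.const_cpow (by fun_prop) (Or.inl ?_)) _
    exact Nat.cast_ne_zero.2 (by omega)
  · have : {s : ℂ | 1 < s.re} ∈ nhds (2 : ℂ) :=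
      (isOpen_lt continuous_const continuous_re).mem_nhds (by simp)
    filter_upwards [this] with z hz
    exact LFunction_eq_sum_add_tsum_of_one_lt hχ N hz

/-- Approximation of `L(s, χ)` by a partial sum of its Dirichlet series. -/
theorem DirichletCharacter.norm_LFunction_sub_sum_le {χ : DirichletCharacter ℂ q} (hχ : χ ≠ 1)
    {N : ℕ} (hN : 1 ≤ N) {s : ℂ} (hs : 0 < s.re) :
    ‖χ.LFunction s - ∑ n ∈ range N, χ ((n + 1 : ℕ) : ZMod q) * ((n + 1 : ℕ) : ℂ) ^ (-s)‖ ≤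
      q * ‖s‖ * ((N : ℝ) ^ (-s.re) / s.re) := by
  rw [LFunction_eq_sum_add_tsum hχ N hs, add_sub_cancel_left]
  refine (tsum_of_norm_bounded ((summable_rpow_neg_sub_one hs N).mul_left (q * ‖s‖)).hasSum
    (norm_tailTerm_le hχ N hs)).trans ?_
  rw [tsum_mul_left]
  gcongr
  exact tsum_rpow_neg_sub_one_le hs hN

end

section

open Complex Set Finset

/-- The entire function `(s - 1) ζ(s)`. -/
noncomputable def zetaMulSub : ℂ → ℂ := Function.update (fun s => (s - 1) * riemannZeta s) 1 1

theorem zetaMulSub_of_ne {s : ℂ} (hs : s ≠ 1) : zetaMulSub s = (s - 1) * riemannZeta s :=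
  Function.update_of_ne hs ..

theorem differentiable_zetaMulSub : Differentiable ℂ zetaMulSub := by
  rw [← differentiableOn_univ,
    ← differentiableOn_compl_singleton_and_continuousAt_iff (c := 1) Filter.univ_mem]
  refine ⟨DifferentiableOn.congr (f := fun s => (s - 1) * riemannZeta s)
    (fun s hs => DifferentiableAt.differentiableWithinAt ?_)
    fun s hs => zetaMulSub_of_ne (Set.mem_sdiff_singleton.mp hs).2,
    continuousWithinAt_compl_self.mp ?_⟩
  · exact DifferentiableAt.mul (by fun_prop)
      (differentiableAt_riemannZeta (Set.mem_sdiff_singleton.mp hs).2)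
  · simpa [zetaMulSub, continuousWithinAt_update_same] using riemannZeta_residue_one

/-- The `n`-th term in the series for `(s - 1) ζ(s) - 1`. -/
noncomputable def zetaTerm (s : ℂ) (n : ℕ) : ℂ :=
  (s - 1) * ((n + 1 : ℕ) : ℂ) ^ (-s) + ((n + 1 + 1 : ℕ) : ℂ) ^ (1 - s) - ((n + 1 : ℕ) : ℂ) ^ (1 - s)

theorem norm_zetaTerm_le {s : ℂ} (hs : 0 ≤ s.re) (n : ℕ) :
    ‖zetaTerm s n‖ ≤ ‖s - 1‖ * ‖s‖ * ((0 + 1 + n : ℕ) : ℝ) ^ (-s.re - 1) := by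
  have := norm_linear_add_cpow_le hs (a := ((n + 1 : ℕ) : ℝ)) (by positivity)
  rw [zetaTerm, show 0 + 1 + n = n + 1 by ring]
  simpa only [ofReal_natCast, ofReal_add, ofReal_one, Nat.cast_add, Nat.cast_one] using this

theorem differentiableOn_zetaTerm :
    DifferentiableOn ℂ (fun s => ∑' k, zetaTerm s k) {s | 0 < s.re} := by
  intro s₀ hs₀
  have hs₀' : 0 < s₀.re := hs₀
  set U : Set ℂ := {s | s₀.re / 2 < s.re} ∩ Metric.ball 0 (‖s₀‖ + 1) with hU
  have hUo : IsOpen U := (isOpen_lt continuous_const continuous_re).inter Metric.isOpen_ball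
  have hmem : s₀ ∈ U := ⟨show s₀.re / 2 < s₀.re by linarith, by simp⟩
  have := differentiableOn_tsum_of_summable_norm (F := fun k s => zetaTerm s k) (U := U)
    ((summable_rpow_neg_sub_one (half_pos hs₀') 0).mul_left ((‖s₀‖ + 1 + 1) * (‖s₀‖ + 1)))
    (fun k => ?_) hUo ?_
  · exact (this.differentiableAt (hUo.mem_nhds hmem)).differentiableWithinAt
  · apply Differentiable.differentiableOn
    unfold zetaTerm
    intro s
    refine DifferentiableAt.sub (DifferentiableAt.add (DifferentiableAt.mul (by fun_prop) ?_) ?_) ?_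
    all_goals
      refine DifferentiableAt.const_cpow (by fun_prop) (Or.inl ?_)
      exact Nat.cast_ne_zero.2 (by omega)
  · rintro k s ⟨hs1, hs2⟩
    have hs1' : s₀.re / 2 < s.re := hs1
    refine (norm_zetaTerm_le (by linarith) k).trans ?_
    have h1 : ‖s‖ < ‖s₀‖ + 1 := by simpa using hs2
    have h2 : ‖s - 1‖ ≤ ‖s₀‖ + 1 + 1 := (norm_sub_le _ _).trans (by simp; linarith)
    gcongr
    exact_mod_cast (by omega : 1 ≤ 0 + 1 + k)

theorem zetaMulSub_eq_of_one_lt {s : ℂ} (hs : 1 < s.re) :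
    zetaMulSub s = 1 + ∑' k, zetaTerm s k := by
  have hs1 : s ≠ 1 := by rintro rfl; simp at hs
  rw [zetaMulSub_of_ne hs1, zeta_eq_tsum_one_div_nat_add_one_cpow hs]
  have hsum : Summable (fun n : ℕ => 1 / ((n : ℂ) + 1) ^ s) := by
    have := (summable_nat_add_iff 1).2 (Complex.summable_one_div_nat_cpow.2 hs)
    simpa using this
  have t1 := (hsum.hasSum.mul_left (s - 1)).tendsto_sum_nat
  have t2 := (Summable.of_norm_bounded
    ((summable_rpow_neg_sub_one (show 0 < s.re by linarith) 0).mul_left (‖s - 1‖ * ‖s‖))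
    (norm_zetaTerm_le (show 0 ≤ s.re by linarith))).hasSum.tendsto_sum_nat
  have t3 : Filter.Tendsto (fun M : ℕ => ((M + 1 : ℕ) : ℂ) ^ (1 - s)) Filter.atTop (nhds 0) := by
    rw [tendsto_zero_iff_norm_tendsto_zero]
    have := (tendsto_rpow_neg_atTop (show 0 < s.re - 1 by linarith)).comp
        (tendsto_natCast_atTop_atTop.comp (Filter.tendsto_add_atTop_nat 1))
    refine this.congr (fun M => ?_)
    rw [norm_natCast_cpow_of_pos (by omega)]
    simp
  have t4 := (t2.const_add 1).sub t3
  rw [sub_zero] at t4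
  rw [← tsum_mul_left] at *
  refine tendsto_nhds_unique t1 (t4.congr (fun M => ?_))
  induction M with
  | zero => simp
  | succ M ih =>
    rw [sum_range_succ, sum_range_succ, ← ih, zetaTerm, cpow_neg]
    push_cast
    ring

theorem zetaMulSub_eq {s : ℂ} (hs : 0 < s.re) : zetaMulSub s = 1 + ∑' k, zetaTerm s k := by
  have hUo : IsOpen {s : ℂ | 0 < s.re} := isOpen_lt continuous_const continuous_re
  refine AnalyticOnNhd.eqOn_of_preconnected_of_eventuallyEq (𝕜 := ℂ) (U := {s : ℂ | 0 < s.re})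
    (z₀ := 2) (f := zetaMulSub) (g := fun s => 1 + ∑' k, zetaTerm s k) ?_ ?_
    isPreconnected_re_pos (by simp) ?_ hs
  · exact (differentiable_zetaMulSub.differentiableOn).analyticOnNhd hUo
  · exact (differentiableOn_zetaTerm.const_add 1).analyticOnNhd hUo
  · have : {s : ℂ | 1 < s.re} ∈ nhds (2 : ℂ) :=
      (isOpen_lt continuous_const continuous_re).mem_nhds (by simp)
    filter_upwards [this] with z hz
    exact zetaMulSub_eq_of_one_lt hz

theorem tsum_rpow_neg_sub_one_le' {σ : ℝ} (hσ : 0 < σ) :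
    ∑' k : ℕ, ((0 + 1 + k : ℕ) : ℝ) ^ (-σ - 1) ≤ 1 + 1 / σ := by
  have := (summable_rpow_neg_sub_one hσ 0).sum_add_tsum_nat_add 1
  rw [← this]
  have h := tsum_rpow_neg_sub_one_le hσ (N := 1) le_rfl
  simp only [Nat.cast_one, Real.one_rpow] at h
  refine add_le_add (by simp) (le_trans (le_of_eq ?_) h)
  congr 1; ext k; congr 2; ring

/-- Polynomial growth of `(s - 1) ζ(s)`. -/
theorem norm_zetaMulSub_le {s : ℂ} (hs : 0 < s.re) :
    ‖zetaMulSub s‖ ≤ 1 + ‖s - 1‖ * ‖s‖ * (1 + 1 / s.re) := by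
  rw [zetaMulSub_eq hs]
  refine (norm_add_le _ _).trans ?_
  rw [norm_one]
  gcongr
  refine (tsum_of_norm_bounded ((summable_rpow_neg_sub_one hs 0).mul_left (‖s - 1‖ * ‖s‖)).hasSum
    (norm_zetaTerm_le hs.le)).trans ?_
  rw [tsum_mul_left]
  gcongr
  exact tsum_rpow_neg_sub_one_le' hs

theorem norm_LSeries_le {f : ℕ → ℂ} (hf : ∀ n, ‖f n‖ ≤ 1) {s : ℂ} (hs : 1 < s.re) :
    ‖LSeries f s‖ ≤ 1 + 1 / (s.re - 1) := by
  have hsum := summable_rpow_neg_sub_one (sub_pos.2 hs) 0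
  refine (tsum_of_norm_bounded (g := fun n => ((n : ℕ) : ℝ) ^ (-s.re)) ?_ (fun n => ?_)).trans
    (tsum_rpow_neg_sub_one_le' (sub_pos.2 hs))
  · rw [← hasSum_nat_add_iff' 1]
    simp only [range_one, sum_singleton, CharP.cast_eq_zero]
    rw [Real.zero_rpow (by linarith), sub_zero]
    have e : (fun k : ℕ => ((0 + 1 + k : ℕ) : ℝ) ^ (-(s.re - 1) - 1)) =
        fun k : ℕ => ((k + 1 : ℕ) : ℝ) ^ (-s.re) := by
      ext k
      rw [show k + 1 = 0 + 1 + k by ring]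
      congr 1; ring
    rw [← e]
    exact hsum.hasSum
  · rcases eq_or_ne n 0 with rfl | hn
    · simp [Real.zero_rpow_nonneg]
    · rw [LSeries.norm_term_eq, if_neg hn, Real.rpow_neg (by positivity), ← one_div]
      gcongr
      exact hf n

/-- A Dirichlet `L`-function is not too small to the right of the line `Re s = 1`. -/
theorem DirichletCharacter.norm_LFunction_ge {q : ℕ} [NeZero q] (χ : DirichletCharacter ℂ q) {s : ℂ}
    (hs : 1 < s.re) : (1 + 1 / (s.re - 1))⁻¹ ≤ ‖χ.LFunction s‖ := by
  have h := congrArg norm (LSeries.mul_mu_eq_one χ hs)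
  rw [norm_mul, norm_one, ← LFunction_eq_LSeries χ hs] at h
  have hb := norm_LSeries_le (f := (fun n : ℕ => χ n) * (fun n : ℕ => ((ArithmeticFunction.moebius n : ℤ) : ℂ)))
    (fun n => ?_) hs
  · have hpos : 0 < 1 + 1 / (s.re - 1) := by
      have := sub_pos.2 hs
      positivity
    rw [inv_le_iff_one_le_mul₀ hpos]
    calc (1 : ℝ) = _ := h.symm
      _ ≤ _ := mul_le_mul_of_nonneg_left hb (norm_nonneg _)
      _ = _ := by ring
  · rw [Pi.mul_apply, norm_mul]
    refine mul_le_one₀ (χ.norm_le_one _) (norm_nonneg _) ?_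
    rw [Complex.norm_intCast]
    exact_mod_cast ArithmeticFunction.abs_moebius_le_one

theorem norm_riemannZeta_ge {s : ℂ} (hs : 1 < s.re) :
    (1 + 1 / (s.re - 1))⁻¹ ≤ ‖riemannZeta s‖ := by
  have := DirichletCharacter.norm_LFunction_ge (1 : DirichletCharacter ℂ 1) hs
  rwa [DirichletCharacter.LFunction_modOne_eq] at this

variable {q : ℕ} [NeZero q]

/-- Convexity-free polynomial bound for `L(s, χ)`. -/
theorem DirichletCharacter.norm_LFunction_le {χ : DirichletCharacter ℂ q} (hχ : χ ≠ 1) {s : ℂ}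
    (hs : 1 / 2 ≤ s.re) : ‖χ.LFunction s‖ ≤ 4 * q * ‖s‖ := by
  have hs0 : 0 < s.re := by linarith
  have h := norm_LFunction_sub_sum_le hχ (N := 1) le_rfl hs0
  have h1 : ‖χ.LFunction s‖ ≤ 1 + q * ‖s‖ * (1 / s.re) := by
    have h2 := norm_le_norm_add_norm_sub' (χ.LFunction s)
      (∑ n ∈ range 1, χ ((n + 1 : ℕ) : ZMod q) * ((n + 1 : ℕ) : ℂ) ^ (-s))
    simp only [Nat.cast_one, Real.one_rpow] at h
    refine h2.trans (add_le_add ?_ h)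
    simp
  have hq : (1 : ℝ) ≤ q := by exact_mod_cast NeZero.pos q
  have hn : s.re ≤ ‖s‖ := re_le_norm s
  have h3 : 1 / s.re ≤ 2 := by
    rw [div_le_iff₀ hs0]; linarith
  have h4 : q * ‖s‖ * (1 / s.re) ≤ q * ‖s‖ * 2 := by gcongr
  nlinarith

/-- Logarithmic bound for `L(s, χ)` close to the line `Re s = 1`. -/
theorem DirichletCharacter.norm_LFunction_le_log {χ : DirichletCharacter ℂ q} (hχ : χ ≠ 1) {s : ℂ}
    {x : ℝ} (hx : 8 ≤ x) (hqx : q * ‖s‖ ≤ x)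
    (hs : 1 - 1 / Real.log x ≤ s.re) : ‖χ.LFunction s‖ ≤ 20 * Real.log x := by
  have hlog : 2 ≤ Real.log x := by
    have h8 : Real.log 8 = 3 * Real.log 2 := by
      rw [show (8 : ℝ) = 2 ^ 3 by norm_num, Real.log_pow]; norm_num
    have := Real.log_le_log (by norm_num) hx
    have := Real.log_two_gt_d9
    linarith
  have hs2 : 1 / 2 ≤ s.re := by
    have : 1 / Real.log x ≤ 1 / 2 := one_div_le_one_div_of_le (by norm_num) hlog
    linarith
  have hs0 : 0 < s.re := by linarith
  set N := ⌊x⌋₊ with hN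
  have hNx : (N : ℝ) ≤ x := Nat.floor_le (by linarith)
  have hN1 : 1 ≤ N := Nat.le_floor (by simp; linarith)
  have hNx2 : x ≤ 2 * N := by
    have := Nat.lt_floor_add_one x
    have : (1 : ℝ) ≤ N := by exact_mod_cast hN1
    rw [hN] at *
    linarith
  have hN0 : (0 : ℝ) < N := by exact_mod_cast hN1
  have hpow : ∀ n : ℕ, 1 ≤ n → n ≤ N → (n : ℝ) ^ (-s.re) ≤ Real.exp 1 * (1 / n) := by
    intro n hn hnN
    have hn0 : (0 : ℝ) < n := by exact_mod_cast hn
    have hlogn : Real.log n ≤ Real.log x := Real.log_le_log hn0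
      (le_trans (by exact_mod_cast hnN) hNx)
    have hlogn0 : 0 ≤ Real.log n := Real.log_nonneg (by exact_mod_cast hn)
    rw [show (1 : ℝ) / n = Real.exp (-Real.log n) by rw [Real.exp_neg, Real.exp_log hn0, one_div],
      ← Real.exp_add, Real.rpow_def_of_pos hn0]
    apply Real.exp_le_exp.2
    have h1 : Real.log n * (1 - s.re) ≤ 1 := by
      calc _ ≤ Real.log n * (1 / Real.log x) := by gcongr; linarith
        _ ≤ 1 := by rw [mul_one_div, div_le_one (by linarith)]; exact hlogn
    linarith
  have h := norm_LFunction_sub_sum_le hχ hN1 hs0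
  have h2 := norm_le_norm_add_norm_sub' (χ.LFunction s)
      (∑ n ∈ range N, χ ((n + 1 : ℕ) : ZMod q) * ((n + 1 : ℕ) : ℂ) ^ (-s))
  have he : Real.exp 1 < 2.7182818286 := Real.exp_one_lt_d9
  have h3 : ‖∑ n ∈ range N, χ ((n + 1 : ℕ) : ZMod q) * ((n + 1 : ℕ) : ℂ) ^ (-s)‖ ≤
      Real.exp 1 * (1 + Real.log x) := by
    calc _ ≤ ∑ n ∈ range N, Real.exp 1 * (1 / ((n + 1 : ℕ) : ℝ)) := by
          refine norm_sum_le_of_le _ (fun n hn => ?_)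
          rw [norm_mul, norm_natCast_cpow_of_pos (by omega), neg_re]
          exact (mul_le_of_le_one_left (by positivity) (χ.norm_le_one _)).trans
            (hpow (n + 1) (by omega) (by have := mem_range.1 hn; omega))
      _ = Real.exp 1 * (harmonic N : ℝ) := by
          rw [← mul_sum, harmonic]; push_cast; simp
      _ ≤ Real.exp 1 * (1 + Real.log x) := by
          gcongr
          refine (harmonic_le_one_add_log N).trans ?_
          gcongr
  have h4 : q * ‖s‖ * ((N : ℝ) ^ (-s.re) / s.re) ≤ x * ((Real.exp 1 * (1 / N)) * 2) := by
    have h5 : (N : ℝ) ^ (-s.re) / s.re ≤ (Real.exp 1 * (1 / N)) * 2 := by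
      rw [div_eq_mul_inv]
      gcongr
      · exact hpow N hN1 le_rfl
      · rw [inv_le_comm₀ hs0 (by norm_num)]; linarith
    gcongr
  have h6 : x * ((Real.exp 1 * (1 / N)) * 2) ≤ 4 * Real.exp 1 := by
    have : x * (1 / N) ≤ 2 := by
      rw [mul_one_div, div_le_iff₀ hN0]; exact hNx2
    nlinarith [Real.exp_pos 1]
  nlinarith

end

section

open Complex Set Finset ArithmeticFunction

theorem re_four_mul_add_sq_nonneg {z : ℂ} (hz : ‖z‖ = 1) : 0 ≤ 3 + 4 * z.re + (z ^ 2).re := by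
  have h : z.re ^ 2 + z.im ^ 2 = 1 := by
    have := Complex.sq_norm z
    rw [hz, normSq_apply] at this
    nlinarith
  rw [sq, mul_re]
  nlinarith [sq_nonneg (z.re + 1)]

/-- The `3-4-1` inequality for von Mangoldt series. -/
theorem re_vonMangoldt_comb_nonneg {a b : ℕ → ℂ} (ha : ∀ n, ‖a n‖ ≤ 1) (hb : ∀ n, ‖b n‖ ≤ 1)
    {u γ : ℝ} (hu : 0 < u)
    (hab : ∀ n : ℕ, n ≠ 0 → 0 ≤ 3 + 4 * (a n * (n : ℂ) ^ (-(γ * I))).re +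
      (b n * (n : ℂ) ^ (-(2 * γ * I))).re) :
    0 ≤ 3 * (LSeries (fun n => (vonMangoldt n : ℂ)) (1 + u)).re +
      4 * (LSeries (a * (fun n => (vonMangoldt n : ℂ))) (1 + u + γ * I)).re +
      (LSeries (b * (fun n => (vonMangoldt n : ℂ))) (1 + u + 2 * γ * I)).re := by
  have hsum : ∀ (c : ℕ → ℂ) (_ : ∀ n, ‖c n‖ ≤ 1) (s : ℂ), 1 < s.re →
      LSeriesSummable (c * (fun n => (vonMangoldt n : ℂ))) s := by
    intro c hc s hs
    refine .of_norm <| (LSeriesSummable_vonMangoldt hs).norm.of_nonneg_of_le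
      (fun _ => norm_nonneg _) fun n => LSeries.norm_term_le s ?_
    rw [Pi.mul_apply, norm_mul]
    exact mul_le_of_le_one_left (norm_nonneg _) (hc n)
  have h1 := hasSum_re (LSeriesSummable_vonMangoldt (s := (1 + u : ℂ)) (by simp [hu])).hasSum
  have h2 := hasSum_re (hsum a ha (1 + u + γ * I) (by simp [hu])).hasSum
  have h3 := hasSum_re (hsum b hb (1 + u + 2 * γ * I) (by simp [hu])).hasSum
  have h := ((h1.mul_left 3).add (h2.mul_left 4)).add h3
  refine h.nonneg (fun n => ?_)
  rcases eq_or_ne n 0 with rfl | hn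
  · simp
  have hn0 : (n : ℂ) ≠ 0 := Nat.cast_ne_zero.2 hn
  set r : ℝ := vonMangoldt n * (n : ℝ) ^ (-(1 + u)) with hr
  have hr0 : 0 ≤ r := mul_nonneg vonMangoldt_nonneg (by positivity)
  have key : ∀ (c t : ℂ), c * (vonMangoldt n : ℂ) / (n : ℂ) ^ (1 + u + t) =
      (r : ℂ) * (c * (n : ℂ) ^ (-t)) := by
    intro c t
    rw [hr, div_eq_mul_inv, ← cpow_neg, neg_add, cpow_add _ _ hn0]
    push_cast
    rw [ofReal_cpow (by positivity)]
    push_cast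
    ring
  have e1 : LSeries.term (fun n => (vonMangoldt n : ℂ)) (1 + u) n = (r : ℂ) := by
    rw [LSeries.term_of_ne_zero hn]
    have := key 1 0
    simpa using this
  rw [e1, LSeries.term_of_ne_zero hn, LSeries.term_of_ne_zero hn, Pi.mul_apply, Pi.mul_apply, key,
    key, re_ofReal_mul, re_ofReal_mul, ofReal_re]
  have := mul_nonneg hr0 (hab n hn)
  linarith

theorem norm_natCast_cpow_neg_mul_I {n : ℕ} (hn : n ≠ 0) (γ : ℝ) :
    ‖(n : ℂ) ^ (-(γ * I))‖ = 1 := by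
  rw [norm_natCast_cpow_of_pos (Nat.pos_of_ne_zero hn)]; simp

theorem cpow_neg_two_mul (n : ℕ) (γ : ℝ) :
    (n : ℂ) ^ (-(2 * γ * I)) = ((n : ℂ) ^ (-(γ * I))) ^ 2 := by
  rw [← cpow_nat_mul]; congr 1; push_cast; ring

variable {q : ℕ} [NeZero q]

theorem DirichletCharacter.neg_deriv_div_eq {χ : DirichletCharacter ℂ q} {s : ℂ} (hs : 1 < s.re) :
    LSeries ((fun n : ℕ => χ n) * (fun n => (vonMangoldt n : ℂ))) s =
      -(deriv χ.LFunction s / χ.LFunction s) := by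
  rw [DirichletCharacter.LSeries_twist_vonMangoldt_eq χ hs, deriv_LFunction_eq_deriv_LSeries χ hs,
    LFunction_eq_LSeries χ hs, neg_div]

theorem norm_char_mul_cpow_eq_one {χ : DirichletCharacter ℂ q} {n : ℕ} (hn : n ≠ 0)
    (h : χ n ≠ 0) (γ : ℝ) : ‖χ n * (n : ℂ) ^ (-(γ * I))‖ = 1 := by
  rw [norm_mul, norm_natCast_cpow_neg_mul_I hn, mul_one]
  by_cases hu : IsUnit (n : ZMod q)
  · obtain ⟨v, hv⟩ := hu
    rw [← hv]; exact χ.unit_norm_eq_one v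
  · exact absurd (χ.map_nonunit hu) h

theorem DirichletCharacter.comb_nonneg {χ : DirichletCharacter ℂ q} {u γ : ℝ} (hu : 0 < u) :
    0 ≤ -(3 * (deriv riemannZeta (1 + u) / riemannZeta (1 + u)).re) -
      4 * (deriv χ.LFunction (1 + u + γ * I) / χ.LFunction (1 + u + γ * I)).re -
      (deriv (χ ^ 2).LFunction (1 + u + 2 * γ * I) / (χ ^ 2).LFunction (1 + u + 2 * γ * I)).re := by
  have h := re_vonMangoldt_comb_nonneg (a := fun n : ℕ => χ n) (b := fun n : ℕ => (χ ^ 2) n)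
    (fun n => χ.norm_le_one _) (fun n => (χ ^ 2).norm_le_one _) (u := u) (γ := γ) hu ?_
  · rw [neg_deriv_div_eq (by simp [hu]), neg_deriv_div_eq (by simp [hu]),
      LSeries_vonMangoldt_eq_deriv_riemannZeta_div (by simp [hu]), neg_re, neg_re, neg_div, neg_re] at h
    linarith
  · intro n hn
    simp only [MulChar.pow_apply' χ two_ne_zero]
    rw [cpow_neg_two_mul, ← mul_pow]
    by_cases h0 : χ n = 0
    · simp [h0]
    · exact re_four_mul_add_sq_nonneg (norm_char_mul_cpow_eq_one hn h0 γ)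

theorem DirichletCharacter.comb_nonneg_of_sq_eq_one {χ : DirichletCharacter ℂ q} (hχ : χ ^ 2 = 1)
    {u γ : ℝ} (hu : 0 < u) :
    0 ≤ -(3 * (deriv riemannZeta (1 + u) / riemannZeta (1 + u)).re) -
      4 * (deriv χ.LFunction (1 + u + γ * I) / χ.LFunction (1 + u + γ * I)).re -
      (deriv riemannZeta (1 + u + 2 * γ * I) / riemannZeta (1 + u + 2 * γ * I)).re := by
  have h := re_vonMangoldt_comb_nonneg (a := fun n : ℕ => χ n) (b := 1)
    (fun n => χ.norm_le_one _) (fun n => by simp) (u := u) (γ := γ) hu ?_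
  · rw [one_mul, neg_deriv_div_eq (by simp [hu]),
      LSeries_vonMangoldt_eq_deriv_riemannZeta_div (by simp [hu]),
      LSeries_vonMangoldt_eq_deriv_riemannZeta_div (by simp [hu]), neg_re, neg_div, neg_div, neg_re,
      neg_re] at h
    linarith
  · intro n hn
    rw [cpow_neg_two_mul, Pi.one_apply, one_mul]
    by_cases h0 : χ n = 0
    · have : ‖((n : ℂ) ^ (-(γ * I))) ^ 2‖ = 1 := by
        rw [norm_pow, norm_natCast_cpow_neg_mul_I hn, one_pow]
      have h1 := (abs_le.1 (abs_re_le_norm (((n : ℂ) ^ (-(γ * I))) ^ 2))).1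
      rw [this] at h1
      simp only [h0, zero_mul, zero_re, mul_zero, add_zero]
      linarith
    · have h1 : (χ n) ^ 2 = 1 := by
        have : (χ ^ 2) n = 1 := by
          rw [hχ]
          by_cases hu : IsUnit (n : ZMod q)
          · exact MulChar.one_apply hu
          · exact absurd (χ.map_nonunit hu) h0
        rwa [MulChar.pow_apply' χ two_ne_zero] at this
      have := re_four_mul_add_sq_nonneg (norm_char_mul_cpow_eq_one hn h0 γ)
      rwa [mul_pow, h1, one_mul] at this

end

section

open Complex Set Finset ArithmeticFunction

variable {q : ℕ} [NeZero q]

theorem inv_one_add_one_div_ge {u : ℝ} (hu : 0 < u) (hu1 : u ≤ 1) : u / 2 ≤ (1 + 1 / u)⁻¹ := by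
  rw [show 1 + 1 / u = (u + 1) / u by field_simp, inv_div]
  apply div_le_div_of_nonneg_left hu.le (by linarith) (by linarith)

theorem norm_le_of_mem_sphere_half {u γ : ℝ} (hu : 0 < u) (hu1 : u ≤ 1 / 2) {z : ℂ}
    (hz : z ∈ Metric.sphere (1 + u + γ * I : ℂ) (1 / 2)) :
    1 / 2 ≤ z.re ∧ ‖z‖ ≤ |γ| + 2 ∧ ‖z - 1‖ ≤ |γ| + 2 := by
  have hz' : ‖z - (1 + u + γ * I)‖ = 1 / 2 := by simpa [dist_eq_norm] using hz
  have hγ : ‖(γ * I : ℂ)‖ = |γ| := by simp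
  have hun : ‖(u : ℂ)‖ = u := by simp [abs_of_pos hu]
  refine ⟨?_, ?_, ?_⟩
  · have := (abs_le.1 (abs_re_le_norm (z - (1 + u + γ * I)))).1
    simp at this
    norm_num [hz'] at this
    linarith
  · calc ‖z‖ = ‖(z - (1 + u + γ * I)) + 1 + u + γ * I‖ := by ring_nf
      _ ≤ ‖z - (1 + u + γ * I)‖ + ‖(1 : ℂ)‖ + ‖(u : ℂ)‖ + ‖(γ * I : ℂ)‖ := norm_add₄_le
      _ ≤ _ := by rw [hz', norm_one, hγ, hun]; linarith
  · calc ‖z - 1‖ = ‖(z - (1 + u + γ * I)) + u + γ * I‖ := by ring_nf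
      _ ≤ ‖z - (1 + u + γ * I)‖ + ‖(u : ℂ)‖ + ‖(γ * I : ℂ)‖ := norm_add₃_le
      _ ≤ _ := by rw [hz', hγ, hun]; linarith

theorem DirichletCharacter.log_ratio_le (χ : DirichletCharacter ℂ q) {u γ : ℝ} (hu : 0 < u)
    (hu1 : u ≤ 1 / 2) : Real.log (4 * q * (|γ| + 2) / ‖χ.LFunction (1 + u + γ * I)‖) ≤
      Real.log (8 * (q * (|γ| + 2)) / u) := by
  have hq : (0 : ℝ) < q := by exact_mod_cast NeZero.pos q
  have h := norm_LFunction_ge χ (s := 1 + u + γ * I) (by simp [hu])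
  simp only [add_re, one_re, ofReal_re, mul_re, I_re, mul_zero, ofReal_im, I_im, mul_one, sub_self,
    add_zero, add_sub_cancel_left] at h
  have h' : u / 2 ≤ ‖χ.LFunction (1 + u + γ * I)‖ := (inv_one_add_one_div_ge hu (by linarith)).trans h
  have hpos : 0 < ‖χ.LFunction (1 + u + γ * I)‖ := lt_of_lt_of_le (by positivity) h'
  apply Real.log_le_log (by positivity)
  rw [div_le_div_iff₀ hpos hu]
  have := mul_le_mul_of_nonneg_left h' (show 0 ≤ 8 * (q * (|γ| + 2)) by positivity)
  linarith

theorem DirichletCharacter.re_le_of_LFunction_eq_zero {χ : DirichletCharacter ℂ q} (hχ : χ ≠ 1)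
    {u γ : ℝ} (hu : 0 < u) (z : ℂ) (hz : χ.LFunction z = 0) : z.re ≤ (1 + u + γ * I : ℂ).re := by
  by_contra! h
  simp at h
  exact χ.LFunction_ne_zero_of_one_le_re (Or.inl hχ) (by linarith) hz

theorem DirichletCharacter.re_logDeriv_ge {χ : DirichletCharacter ℂ q} (hχ : χ ≠ 1) {u γ : ℝ}
    (hu : 0 < u) (hu1 : u ≤ 1 / 2) :
    -(16 * Real.log (8 * (q * (|γ| + 2)) / u)) ≤
      (deriv χ.LFunction (1 + u + γ * I) / χ.LFunction (1 + u + γ * I)).re := by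
  have h := re_deriv_div_ge_at (f := χ.LFunction) (s₀ := 1 + u + γ * I) (R := 1 / 2)
    (K := 4 * q * (|γ| + 2)) (by norm_num) (differentiable_LFunction hχ)
    (χ.LFunction_ne_zero_of_one_le_re (Or.inl hχ) (by simp [hu.le])) (fun z hz => ?_)
    (fun z hz => re_le_of_LFunction_eq_zero hχ hu z hz)
  · have := log_ratio_le χ (γ := γ) hu hu1
    linarith
  · obtain ⟨h1, h2, -⟩ := norm_le_of_mem_sphere_half hu hu1 hz
    refine (norm_LFunction_le hχ h1).trans ?_
    gcongr

theorem DirichletCharacter.re_logDeriv_ge_of_zero {χ : DirichletCharacter ℂ q} (hχ : χ ≠ 1)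
    {u γ y : ℝ} (hu : 0 < u) (hu1 : u ≤ 1 / 2) (hy : 0 < y) (hy1 : y < 1 / 2)
    (hρ : χ.LFunction (1 + u + γ * I - y) = 0) :
    1 / y - 2 - 16 * Real.log (8 * (q * (|γ| + 2)) / u) ≤
      (deriv χ.LFunction (1 + u + γ * I) / χ.LFunction (1 + u + γ * I)).re := by
  have h := re_deriv_div_ge_at_of_zero (f := χ.LFunction) (s₀ := 1 + u + γ * I) (R := 1 / 2)
    (K := 4 * q * (|γ| + 2)) (by norm_num) (differentiable_LFunction hχ)
    (χ.LFunction_ne_zero_of_one_le_re (Or.inl hχ) (by simp [hu.le])) (fun z hz => ?_)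
    (fun z hz => re_le_of_LFunction_eq_zero hχ hu z hz) hy hy1 hρ
  · have := log_ratio_le χ (γ := γ) hu hu1
    linarith
  · obtain ⟨h1, h2, -⟩ := norm_le_of_mem_sphere_half hu hu1 hz
    refine (norm_LFunction_le hχ h1).trans ?_
    gcongr

theorem re_zeta_logDeriv_ge {u γ : ℝ} (hu : 0 < u) (hu1 : u ≤ 1 / 2) :
    -(u / (u ^ 2 + γ ^ 2)) - 32 * Real.log (8 * (|γ| + 2) / u) ≤
      (deriv riemannZeta (1 + u + γ * I) / riemannZeta (1 + u + γ * I)).re := by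
  set s₀ : ℂ := 1 + u + γ * I with hs₀
  have hre : s₀.re = 1 + u := by simp [hs₀]
  have him : s₀.im = γ := by simp [hs₀]
  have hs1 : s₀ ≠ 1 := fun h => by rw [h] at hre; simp at hre; linarith
  have hz0 : riemannZeta s₀ ≠ 0 := riemannZeta_ne_zero_of_one_le_re (by linarith)
  have hf0 : zetaMulSub s₀ ≠ 0 := by
    rw [zetaMulSub_of_ne hs1]; exact mul_ne_zero (sub_ne_zero.2 hs1) hz0
  have h := re_deriv_div_ge_at (f := zetaMulSub) (s₀ := s₀) (R := 1 / 2)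
    (K := 4 * (|γ| + 2) ^ 2) (by norm_num) differentiable_zetaMulSub hf0 (fun z hz => ?_)
    (fun z hz => ?_)
  · have hlow : u ^ 2 / 2 ≤ ‖zetaMulSub s₀‖ := by
      rw [zetaMulSub_of_ne hs1, norm_mul]
      have h1 := norm_riemannZeta_ge (s := s₀) (by linarith)
      rw [hre, add_sub_cancel_left] at h1
      have h2 := (inv_one_add_one_div_ge hu (by linarith)).trans h1
      have h3 : u ≤ ‖s₀ - 1‖ := by
        have := re_le_norm (s₀ - 1)
        rw [sub_re, hre] at this; simpa using this
      calc u ^ 2 / 2 = u * (u / 2) := by ring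
        _ ≤ _ := by gcongr
    have hlog : Real.log (4 * (|γ| + 2) ^ 2 / ‖zetaMulSub s₀‖) ≤ 2 * Real.log (8 * (|γ| + 2) / u) := by
      have : 2 * Real.log (8 * (|γ| + 2) / u) = Real.log ((8 * (|γ| + 2) / u) ^ 2) := by
        rw [Real.log_pow]; norm_num
      rw [this]
      have hpos : 0 < ‖zetaMulSub s₀‖ := norm_pos_iff.2 hf0
      apply Real.log_le_log (by positivity)
      rw [div_pow, div_le_div_iff₀ hpos (by positivity)]
      have h5 := mul_le_mul_of_nonneg_left hlow (show 0 ≤ 64 * (|γ| + 2) ^ 2 by positivity)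
      nlinarith [sq_nonneg (u * (|γ| + 2))]
    have hd : deriv zetaMulSub s₀ / zetaMulSub s₀ =
        1 / (s₀ - 1) + deriv riemannZeta s₀ / riemannZeta s₀ := by
      have h6 : HasDerivAt zetaMulSub (1 * riemannZeta s₀ + (s₀ - 1) * deriv riemannZeta s₀) s₀ := by
        refine (((hasDerivAt_id s₀).sub_const 1).mul
          (differentiableAt_riemannZeta hs1).hasDerivAt).congr_of_eventuallyEq ?_
        filter_upwards [isOpen_ne.mem_nhds hs1] with z hz
        exact zetaMulSub_of_ne hz
      rw [h6.deriv, zetaMulSub_of_ne hs1]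
      have := sub_ne_zero.2 hs1
      field_simp
    have hre1 : (1 / (s₀ - 1)).re = u / (u ^ 2 + γ ^ 2) := by
      rw [one_div, inv_re, normSq_apply]
      simp only [sub_re, sub_im, hre, him, one_re, one_im]
      congr 1 <;> ring
    rw [hd, add_re, hre1] at h
    linarith
  · obtain ⟨h1, h2, h3⟩ := norm_le_of_mem_sphere_half hu hu1 hz
    have h4 : 1 / z.re ≤ 2 := by rw [div_le_iff₀ (by linarith)]; linarith
    calc _ ≤ 1 + ‖z - 1‖ * ‖z‖ * (1 + 1 / z.re) := norm_zetaMulSub_le (by linarith)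
      _ ≤ 1 + (|γ| + 2) * (|γ| + 2) * (1 + 2) := by
        have : 0 ≤ 1 / z.re := by have : 0 < z.re := by linarith
                                  positivity
        gcongr
      _ ≤ _ := by nlinarith [abs_nonneg γ]
  · by_contra! hlt
    rw [hre] at hlt
    have hz1 : z ≠ 1 := by rintro rfl; simp at hlt; linarith
    rw [zetaMulSub_of_ne hz1] at hz
    exact mul_ne_zero (sub_ne_zero.2 hz1) (riemannZeta_ne_zero_of_one_le_re (by linarith)) hz

/-- If `0 < u ≤ 10⁻⁸ / log x` then the error terms in the zero-free region argument are
negligible against `1 / u`. -/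
theorem mul_log_div_le {u x : ℝ} (hx : 6 ≤ x) (hu : 0 < u) (hux : u * Real.log x ≤ 1 / 10 ^ 8) :
    u * Real.log (16 * x / u) ≤ 3 / 10 ^ 4 := by
  have hlx : 1 ≤ Real.log x := by
    rw [Real.le_log_iff_exp_le (by linarith)]
    linarith [Real.exp_one_lt_d9]
  have hu8 : u ≤ 1 / 10 ^ 8 := by nlinarith
  have h16 : Real.log 16 ≤ 3 := by
    rw [show (16 : ℝ) = 2 ^ 4 by norm_num, Real.log_pow]
    have := Real.log_two_lt_d9
    norm_num; linarith
  rw [mul_div_assoc, Real.log_mul (by norm_num) (by positivity), Real.log_div (by positivity) hu.ne']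
  have hs : √u ≤ 1 / 10 ^ 4 := by
    rw [Real.sqrt_le_left (by norm_num)]; norm_num at hu8 ⊢; exact hu8
  have hsp : 0 < √u := Real.sqrt_pos.2 hu
  have hlu : -Real.log u ≤ 2 * (√u)⁻¹ := by
    have h1 : Real.log u = 2 * Real.log (√u) := by rw [Real.log_sqrt hu.le]; ring
    have h2 := Real.log_le_sub_one_of_pos (inv_pos.2 hsp)
    rw [Real.log_inv] at h2
    linarith
  have h3 : u * (√u)⁻¹ = √u := by
    nth_rewrite 1 [← Real.mul_self_sqrt hu.le]
    field_simp
  have h4 : u * (-Real.log u) ≤ 2 * √u := by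
    calc _ ≤ u * (2 * (√u)⁻¹) := by gcongr
      _ = 2 * (u * (√u)⁻¹) := by ring
      _ = _ := by rw [h3]
  nlinarith

theorem no_zero_arith {u y x T : ℝ} (hx : 6 ≤ x) (hu : 0 < u) (hux : u * Real.log x ≤ 1 / 10 ^ 8)
    (hy : 0 < y) (hyu : y ≤ 6 / 5 * u) (hT : T ≤ 1 / (100 * u))
    (h : 0 ≤ 3 / u - 4 / y + T + 8 + 208 * Real.log (16 * x / u)) : False := by
  have h1 := mul_log_div_le hx hu hux
  have hlx : 1 ≤ Real.log x := by
    rw [Real.le_log_iff_exp_le (by linarith)]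
    linarith [Real.exp_one_lt_d9]
  have hu8 : u ≤ 1 / 10 ^ 8 := by nlinarith
  have h2 : 4 / (6 / 5 * u) ≤ 4 / y := by gcongr
  have h3 : 0 ≤ u * (3 / u - 4 / (6 / 5 * u) + 1 / (100 * u) + 8 + 208 * Real.log (16 * x / u)) :=
    mul_nonneg hu.le (by linarith)
  have h4 : u * (3 / u - 4 / (6 / 5 * u) + 1 / (100 * u) + 8 + 208 * Real.log (16 * x / u)) =
      3 - 10 / 3 + 1 / 100 + 8 * u + 208 * (u * Real.log (16 * x / u)) := by
    field_simp; ring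
  rw [h4] at h3
  norm_num at h3 hu8 h1
  linarith

theorem log_comp_le {q₀ t x u : ℝ} (hq : 1 ≤ q₀) (ht : 0 ≤ t) (hx : x = q₀ * (t + 2)) (hu : 0 < u) :
    Real.log (8 * (t + 2) / u) ≤ Real.log (16 * x / u) ∧
    Real.log (8 * (2 * t + 2) / u) ≤ Real.log (16 * x / u) ∧
    Real.log (8 * (q₀ * (t + 2)) / u) ≤ Real.log (16 * x / u) ∧
    Real.log (8 * (q₀ * (2 * t + 2)) / u) ≤ Real.log (16 * x / u) ∧
    Real.log (8 * (0 + 2) / u) ≤ Real.log (16 * x / u) := by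
  refine ⟨?_, ?_, ?_, ?_, ?_⟩ <;>
  · apply Real.log_le_log (by positivity)
    rw [hx]
    apply div_le_div_of_nonneg_right _ hu.le
    nlinarith [mul_nonneg (sub_nonneg.2 hq) ht]

/-- Zero-free region for characters which are not quadratic. -/
theorem DirichletCharacter.LFunction_ne_zero_of_sq_ne_one {χ : DirichletCharacter ℂ q} (hq : 3 ≤ q)
    (hχ : χ ^ 2 ≠ 1) {s : ℂ}
    (hs : 1 - 1 / (10 ^ 9 * Real.log (q * (|s.im| + 2))) ≤ s.re) : χ.LFunction s ≠ 0 := by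
  intro hzero
  have hχ1 : χ ≠ 1 := by rintro rfl; simp at hχ
  have hq3 : (3 : ℝ) ≤ q := by exact_mod_cast hq
  set γ := s.im with hγ
  set x := q * (|γ| + 2) with hx
  have hx6 : 6 ≤ x := by nlinarith [abs_nonneg γ]
  have hlx : 1 ≤ Real.log x := by
    rw [Real.le_log_iff_exp_le (by linarith)]
    linarith [Real.exp_one_lt_d9]
  set u := 1 / (10 ^ 8 * Real.log x) with hu
  have hu0 : 0 < u := by positivity
  have hux : u * Real.log x = 1 / 10 ^ 8 := by rw [hu]; field_simp
  have hu8 : u ≤ 1 / 10 ^ 8 := by nlinarith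
  have hre : s.re < 1 := by
    by_contra! h
    exact χ.LFunction_ne_zero_of_one_le_re (Or.inl hχ1) h hzero
  have hyu : 1 + u - s.re ≤ 6 / 5 * u := by
    have : 1 / (10 ^ 9 * Real.log x) = u / 10 := by rw [hu]; field_simp
    rw [this] at hs
    linarith
  have hy0 : 0 < 1 + u - s.re := by linarith
  have hρ : χ.LFunction (1 + u + γ * I - (1 + u - s.re : ℝ)) = 0 := by
    convert hzero using 2
    apply Complex.ext <;> simp [hγ]
  obtain ⟨l1, l2, l3, l4, l5⟩ := log_comp_le (q₀ := q) (by linarith) (abs_nonneg γ) hx hu0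
  have c1 := comb_nonneg (χ := χ) (γ := γ) hu0
  have c2 := re_zeta_logDeriv_ge (γ := 0) hu0 (by norm_num at hu8 ⊢; linarith)
  have c3 := re_logDeriv_ge_of_zero hχ1 (γ := γ) hu0 (by norm_num at hu8 ⊢; linarith) hy0
    (by norm_num at hu8 ⊢; linarith) hρ
  have c4 := re_logDeriv_ge hχ (γ := 2 * γ) hu0 (by norm_num at hu8 ⊢; linarith)
  simp only [ofReal_zero, zero_mul, add_zero, abs_zero, ne_eq, OfNat.ofNat_ne_zero,
    not_false_eq_true, zero_pow] at c2
  rw [abs_mul, abs_two] at c4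
  push_cast at c4
  have hui : u / u ^ 2 = 1 / u := by field_simp
  rw [hui] at c2
  refine no_zero_arith (T := 0) hx6 hu0 hux.le hy0 hyu (by positivity) ?_
  have e1 : 3 / u = 3 * (1 / u) := by ring
  have e2 : 4 / (1 + u - s.re) = 4 * (1 / (1 + u - s.re)) := by ring
  rw [e1, e2]
  have hE : 0 ≤ Real.log (16 * x / u) := by
    apply Real.log_nonneg
    rw [le_div_iff₀ hu0]
    norm_num at hu8
    linarith
  linarith

/-- Zero-free region for quadratic characters, away from the real axis. -/
theorem DirichletCharacter.LFunction_ne_zero_of_sq_eq_one {χ : DirichletCharacter ℂ q} (hq : 3 ≤ q)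
    (hχ1 : χ ≠ 1) (hχ : χ ^ 2 = 1) {s : ℂ} (him : s.im ≠ 0)
    (hs : 1 - 1 / (10 ^ 9 * Real.log (q * (|s.im| + 2))) ≤ s.re) (hs' : 1 - |s.im| / 100 ≤ s.re) :
    χ.LFunction s ≠ 0 := by
  intro hzero
  have hq3 : (3 : ℝ) ≤ q := by exact_mod_cast hq
  set γ := s.im with hγ
  have hγ0 : 0 < |γ| := abs_pos.2 him
  set x := q * (|γ| + 2) with hx
  have hx6 : 6 ≤ x := by nlinarith [abs_nonneg γ]
  have hlx : 1 ≤ Real.log x := by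
    rw [Real.le_log_iff_exp_le (by linarith)]
    linarith [Real.exp_one_lt_d9]
  set u := min (1 / (10 ^ 8 * Real.log x)) (|γ| / 10) with hu
  have hu0 : 0 < u := by positivity
  have hux : u * Real.log x ≤ 1 / 10 ^ 8 := by
    calc _ ≤ 1 / (10 ^ 8 * Real.log x) * Real.log x := by gcongr; exact min_le_left _ _
      _ = _ := by field_simp
  have huγ : u ≤ |γ| / 10 := min_le_right _ _
  have hu8 : u ≤ 1 / 10 ^ 8 := by nlinarith
  have hre : s.re < 1 := by
    by_contra! h
    exact χ.LFunction_ne_zero_of_one_le_re (Or.inl hχ1) h hzero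
  have hyu : 1 + u - s.re ≤ 6 / 5 * u := by
    rcases min_choice (1 / (10 ^ 8 * Real.log x)) (|γ| / 10) with h | h
    · have : 1 / (10 ^ 9 * Real.log x) = u / 10 := by rw [hu, h]; field_simp
      rw [this] at hs
      linarith
    · have : |γ| / 100 = u / 10 := by rw [hu, h]; ring
      rw [this] at hs'
      linarith
  have hy0 : 0 < 1 + u - s.re := by linarith
  have hρ : χ.LFunction (1 + u + γ * I - (1 + u - s.re : ℝ)) = 0 := by
    convert hzero using 2
    apply Complex.ext <;> simp [hγ]
  obtain ⟨l1, l2, l3, l4, l5⟩ := log_comp_le (q₀ := q) (by linarith) (abs_nonneg γ) hx hu0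
  have c1 := comb_nonneg_of_sq_eq_one hχ (γ := γ) hu0
  have c2 := re_zeta_logDeriv_ge (γ := 0) hu0 (by norm_num at hu8 ⊢; linarith)
  have c3 := re_logDeriv_ge_of_zero hχ1 (γ := γ) hu0 (by norm_num at hu8 ⊢; linarith) hy0
    (by norm_num at hu8 ⊢; linarith) hρ
  have c4 := re_zeta_logDeriv_ge (γ := 2 * γ) hu0 (by norm_num at hu8 ⊢; linarith)
  simp only [ofReal_zero, zero_mul, add_zero, abs_zero, ne_eq, OfNat.ofNat_ne_zero,
    not_false_eq_true, zero_pow] at c2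
  rw [abs_mul, abs_two] at c4
  push_cast at c4
  have hui : u / u ^ 2 = 1 / u := by field_simp
  rw [hui] at c2
  have hT : u / (u ^ 2 + (2 * γ) ^ 2) ≤ 1 / (100 * u) := by
    rw [div_le_div_iff₀ (by positivity) (by positivity)]
    have : (10 * u) ^ 2 ≤ γ ^ 2 := by rw [← sq_abs γ]; gcongr; linarith
    nlinarith
  refine no_zero_arith hx6 hu0 hux hy0 hyu hT ?_
  have e1 : 3 / u = 3 * (1 / u) := by ring
  have e2 : 4 / (1 + u - s.re) = 4 * (1 / (1 + u - s.re)) := by ring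
  rw [e1, e2]
  have hE : 0 ≤ Real.log (16 * x / u) := by
    apply Real.log_nonneg
    rw [le_div_iff₀ hu0]
    norm_num at hu8
    linarith
  linarith

end

section

open Complex Set Finset

/-- `sinh y ≤ y cosh y` for `y ≥ 0`. -/
theorem sinh_le_mul_cosh {y : ℝ} (hy : 0 ≤ y) : Real.sinh y ≤ y * Real.cosh y := by
  have hmono : MonotoneOn (fun y : ℝ => y * Real.cosh y - Real.sinh y) (Ici 0) := by
    have hd : ∀ y : ℝ, HasDerivAt (fun y : ℝ => y * Real.cosh y - Real.sinh y) (y * Real.sinh y) y := by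
      intro y
      exact (((hasDerivAt_id y).mul (Real.hasDerivAt_cosh y)).sub (Real.hasDerivAt_sinh y)).congr_deriv
        (by simp)
    refine monotoneOn_of_deriv_nonneg (convex_Ici 0)
      (fun y _ => (hd y).continuousAt.continuousWithinAt)
      (fun y _ => (hd y).differentiableAt.differentiableWithinAt) ?_
    intro y hy
    rw [interior_Ici] at hy
    rw [(hd y).deriv]
    exact mul_nonneg (le_of_lt hy) (Real.sinh_nonneg_iff.2 (le_of_lt hy))
  have := hmono (mem_Ici.2 le_rfl) (mem_Ici.2 hy) hy
  simp at this
  linarith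

/-- Lazarević's inequality. -/
theorem pow_three_mul_cosh_le_sinh_pow_three {y : ℝ} (hy : 0 ≤ y) :
    y ^ 3 * Real.cosh y ≤ Real.sinh y ^ 3 := by
  set a : ℝ := -(1 / 3) with ha
  have hd : ∀ y : ℝ, HasDerivAt (fun y : ℝ => Real.sinh y * Real.cosh y ^ a - y)
      (Real.cosh y * Real.cosh y ^ a + Real.sinh y * (Real.sinh y * a * Real.cosh y ^ (a - 1)) - 1) y := by
    intro y
    exact ((Real.hasDerivAt_sinh y).mul
      ((Real.hasDerivAt_cosh y).rpow_const (Or.inl (Real.cosh_pos y).ne'))).sub (hasDerivAt_id y)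
  have hmono : MonotoneOn (fun y : ℝ => Real.sinh y * Real.cosh y ^ a - y) (Ici 0) := by
    refine monotoneOn_of_deriv_nonneg (convex_Ici 0)
      (fun y _ => (hd y).continuousAt.continuousWithinAt)
      (fun y _ => (hd y).differentiableAt.differentiableWithinAt) ?_
    intro y _
    rw [(hd y).deriv]
    have hc : 0 < Real.cosh y := Real.cosh_pos y
    have hs : Real.sinh y ^ 2 = Real.cosh y ^ 2 - 1 := by rw [Real.sinh_sq]
    set t := Real.cosh y ^ (1 / 3 : ℝ) with ht
    have ht0 : 0 < t := Real.rpow_pos_of_pos hc _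
    have hct : Real.cosh y = t ^ 3 := by
      rw [ht, ← Real.rpow_natCast, ← Real.rpow_mul hc.le]; norm_num
    have h1 : Real.cosh y ^ a = t⁻¹ := by rw [ha, Real.rpow_neg hc.le]
    have h2 : Real.cosh y ^ (a - 1) = t⁻¹ / t ^ 3 := by
      rw [Real.rpow_sub_one hc.ne', h1, ← hct]
    have h3 : Real.cosh y * Real.cosh y ^ a
        + Real.sinh y * (Real.sinh y * a * Real.cosh y ^ (a - 1)) - 1
        = (t ^ 2 - 1) ^ 2 * (2 * t ^ 2 + 1) / (3 * t ^ 4) := by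
      have : Real.sinh y * (Real.sinh y * a * Real.cosh y ^ (a - 1))
        = a * Real.cosh y ^ (a - 1) * Real.sinh y ^ 2 := by ring
      rw [this, hs, h1, h2, hct, ha]
      field_simp
      ring
    rw [h3]
    positivity
  have h := hmono (mem_Ici.2 le_rfl) (mem_Ici.2 hy) hy
  simp only [Real.sinh_zero, zero_mul, sub_zero] at h
  have hc : 0 < Real.cosh y := Real.cosh_pos y
  have h' : y ≤ Real.sinh y * Real.cosh y ^ a := by linarith
  have h3 : y ^ 3 ≤ (Real.sinh y * Real.cosh y ^ a) ^ 3 := pow_le_pow_left₀ hy h' 3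
  have h4 : (Real.cosh y ^ a) ^ 3 * Real.cosh y = 1 := by
    rw [← Real.rpow_natCast, ← Real.rpow_mul hc.le, ← Real.rpow_add_one hc.ne', ha]
    norm_num
  calc y ^ 3 * Real.cosh y ≤ (Real.sinh y * Real.cosh y ^ a) ^ 3 * Real.cosh y := by gcongr
    _ = Real.sinh y ^ 3 * ((Real.cosh y ^ a) ^ 3 * Real.cosh y) := by ring
    _ = _ := by rw [h4, mul_one]

/-- The function `1 / (exp v - 1) - 1 / v`. -/
noncomputable def boseDefect (v : ℝ) : ℝ := 1 / (Real.exp v - 1) - 1 / v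

theorem exp_sub_one_eq_mul_sinh (v : ℝ) :
    Real.exp v - 1 = 2 * Real.exp (v / 2) * Real.sinh (v / 2) := by
  rw [Real.sinh_eq, Real.exp_neg]
  have : Real.exp v = Real.exp (v / 2) ^ 2 := by rw [← Real.exp_nat_mul]; ring_nf
  rw [this]
  have := (Real.exp_pos (v / 2)).ne'
  field_simp

theorem hasDerivAt_boseDefect {v : ℝ} (hv : 0 < v) :
    HasDerivAt boseDefect (1 / 4 * (1 / (v / 2) ^ 2 - 1 / Real.sinh (v / 2) ^ 2)) v := by
  have he : Real.exp v - 1 ≠ 0 := by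
    have := Real.add_one_lt_exp hv.ne'; linarith
  have h1 : HasDerivAt (fun v => (Real.exp v - 1)⁻¹ - v⁻¹)
      (-Real.exp v / (Real.exp v - 1) ^ 2 - -1 / v ^ 2) v :=
    (((Real.hasDerivAt_exp v).sub_const 1).inv he).sub ((hasDerivAt_id v).inv hv.ne')
  have h2 : boseDefect = fun v => (Real.exp v - 1)⁻¹ - v⁻¹ := by
    funext v; simp [boseDefect]
  rw [h2]
  refine h1.congr_deriv ?_
  have hs : Real.sinh (v / 2) ≠ 0 := (Real.sinh_pos_iff.2 (by positivity)).ne'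
  have : Real.exp v = Real.exp (v / 2) ^ 2 := by rw [← Real.exp_nat_mul]; ring_nf
  rw [exp_sub_one_eq_mul_sinh, this]
  have := (Real.exp_pos (v / 2)).ne'
  field_simp
  ring

theorem antitoneOn_inv_sq_sub_inv_sinh_sq :
    AntitoneOn (fun y : ℝ => 1 / y ^ 2 - 1 / Real.sinh y ^ 2) (Ioi 0) := by
  have hd : ∀ y : ℝ, 0 < y → HasDerivAt (fun y : ℝ => 1 / y ^ 2 - 1 / Real.sinh y ^ 2)
      (-2 / y ^ 3 + 2 * Real.cosh y / Real.sinh y ^ 3) y := by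
    intro y hy
    have hs : Real.sinh y ≠ 0 := (Real.sinh_pos_iff.2 hy).ne'
    have h1 : HasDerivAt (fun y : ℝ => (y ^ 2)⁻¹ - (Real.sinh y ^ 2)⁻¹)
      (-(2 * y) / (y ^ 2) ^ 2 - -(2 * Real.sinh y * Real.cosh y) / (Real.sinh y ^ 2) ^ 2) y := by
      refine HasDerivAt.sub (HasDerivAt.inv ?_ (by positivity)) (HasDerivAt.inv ?_ (by positivity))
      · exact (hasDerivAt_pow 2 y).congr_deriv (by simp)
      · exact ((Real.hasDerivAt_sinh y).pow 2).congr_deriv (by simp)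
    simp only [one_div]
    refine h1.congr_deriv ?_
    field_simp
    ring
  refine antitoneOn_of_deriv_nonpos (convex_Ioi 0)
    (fun y hy => (hd y hy).continuousAt.continuousWithinAt)
    (fun y hy => (hd y (by simpa using hy)).differentiableAt.differentiableWithinAt) ?_
  intro y hy
  have hy : 0 < y := by simpa using hy
  rw [(hd y hy).deriv]
  have hs : 0 < Real.sinh y := Real.sinh_pos_iff.2 hy
  have h := pow_three_mul_cosh_le_sinh_pow_three hy.le
  have : 2 * Real.cosh y / Real.sinh y ^ 3 ≤ 2 / y ^ 3 := by
    rw [div_le_div_iff₀ (by positivity) (by positivity)]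
    nlinarith
  have h2 : -2 / y ^ 3 = -(2 / y ^ 3) := by ring
  linarith

theorem deriv_boseDefect_nonneg {v : ℝ} (hv : 0 < v) : 0 ≤ deriv boseDefect v := by
  rw [(hasDerivAt_boseDefect hv).deriv]
  have h2 : 0 < v / 2 := by positivity
  have h : v / 2 ≤ Real.sinh (v / 2) := Real.self_le_sinh_iff.2 h2.le
  have : 1 / Real.sinh (v / 2) ^ 2 ≤ 1 / (v / 2) ^ 2 := by gcongr
  linarith

theorem deriv_boseDefect_le {v : ℝ} (hv : 0 < v) : deriv boseDefect v ≤ 1 / 4 := by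
  rw [(hasDerivAt_boseDefect hv).deriv]
  have h2 : 0 < v / 2 := by positivity
  set y := v / 2
  have hs : 0 < Real.sinh y := Real.sinh_pos_iff.2 h2
  have h := sinh_le_mul_cosh h2.le
  have h3 : 1 / y ^ 2 ≤ Real.cosh y ^ 2 / Real.sinh y ^ 2 := by
    rw [div_le_div_iff₀ (by positivity) (by positivity)]
    have := pow_le_pow_left₀ hs.le h 2
    nlinarith
  have h4 : Real.cosh y ^ 2 / Real.sinh y ^ 2 = 1 + 1 / Real.sinh y ^ 2 := by
    rw [Real.cosh_sq]; field_simp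
  linarith

theorem differentiableOn_boseDefect : DifferentiableOn ℝ boseDefect (Ioi 0) :=
  fun _ hv => (hasDerivAt_boseDefect hv).differentiableAt.differentiableWithinAt

theorem monotoneOn_boseDefect : MonotoneOn boseDefect (Ioi 0) :=
  monotoneOn_of_deriv_nonneg (convex_Ioi 0) differentiableOn_boseDefect.continuousOn
    (by simpa using differentiableOn_boseDefect)
    (fun v hv => deriv_boseDefect_nonneg (by simpa using hv))

theorem concaveOn_boseDefect : ConcaveOn ℝ (Ioi 0) boseDefect := by
  refine AntitoneOn.concaveOn_of_deriv (convex_Ioi 0) differentiableOn_boseDefect.continuousOn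
    (by simpa using differentiableOn_boseDefect) ?_
  rw [interior_Ioi]
  intro a ha b hb hab
  rw [(hasDerivAt_boseDefect ha).deriv, (hasDerivAt_boseDefect hb).deriv]
  have ha' : (0 : ℝ) < a := ha
  have hb' : (0 : ℝ) < b := hb
  have := antitoneOn_inv_sq_sub_inv_sinh_sq (a := a / 2) (b := b / 2) (by simpa using ha')
    (by simpa using hb') (by linarith)
  simp only at this
  linarith

theorem boseDefect_sub_le {a b : ℝ} (ha : 0 < a) (hab : a ≤ b) :
    boseDefect b - boseDefect a ≤ 1 / 4 * (b - a) :=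
  (convex_Ioi 0).image_sub_le_mul_sub_of_deriv_le differentiableOn_boseDefect.continuousOn
    (by simpa using differentiableOn_boseDefect)
    (fun v hv => deriv_boseDefect_le (by simpa using hv)) a ha b (lt_of_lt_of_le ha hab) hab

theorem boseDefect_tendsto_atTop : Filter.Tendsto boseDefect Filter.atTop (nhds 0) := by
  have h1 : Filter.Tendsto (fun v : ℝ => (Real.exp v - 1)⁻¹) Filter.atTop (nhds 0) :=
    Filter.Tendsto.inv_tendsto_atTop
      (Filter.tendsto_atTop_add_const_right _ _ Real.tendsto_exp_atTop)
  have := h1.sub (tendsto_inv_atTop_zero (𝕜 := ℝ))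
  simp only [sub_zero] at this
  refine this.congr fun v => ?_
  simp [boseDefect]

/-- Twice summing by parts: geometric sums weighted by a difference of two concave sequences. -/
theorem norm_sum_mul_pow_le_of_antitone {a : ℕ → ℝ} (ha : Antitone a) (ha0 : ∀ n, 0 ≤ a n) {z : ℂ}
    (hz : ‖z‖ = 1) (N : ℕ) : ‖1 - z‖ * ‖∑ d ∈ range N, (a d : ℂ) * z ^ d‖ ≤ 2 * a 0 := by
  have key : ∀ N, (1 - z) * ∑ d ∈ range (N + 1), (a d : ℂ) * z ^ d =
      a 0 + ∑ d ∈ range N, ((a (d + 1) - a d : ℝ) : ℂ) * z ^ (d + 1) - a N * z ^ (N + 1) := by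
    intro N
    induction N with
    | zero => simp; ring
    | succ N ih =>
      rw [sum_range_succ, mul_add, ih, sum_range_succ (n := N)]
      push_cast; ring
  rcases N with _ | N
  · simpa using ha0 0
  rw [← norm_mul, key]
  have h1 : ‖∑ d ∈ range N, ((a (d + 1) - a d : ℝ) : ℂ) * z ^ (d + 1)‖ ≤ a 0 - a N := by
    refine (norm_sum_le _ _).trans ?_
    have : ∀ d ∈ range N, ‖((a (d + 1) - a d : ℝ) : ℂ) * z ^ (d + 1)‖ = a d - a (d + 1) := by
      intro d _
      rw [norm_mul, norm_pow, hz, one_pow, mul_one, Complex.norm_real, Real.norm_eq_abs,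
        abs_of_nonpos (by linarith [ha (Nat.le_succ d)])]
      ring
    rw [sum_congr rfl this, sum_range_sub']
  have h2 : ‖(a N : ℂ) * z ^ (N + 1)‖ = a N := by
    rw [norm_mul, norm_pow, hz, one_pow, mul_one, Complex.norm_real, Real.norm_eq_abs,
      abs_of_nonneg (ha0 N)]
  have h3 : ‖(a 0 : ℂ)‖ = a 0 := by
    rw [Complex.norm_real, Real.norm_eq_abs, abs_of_nonneg (ha0 0)]
  calc _ ≤ _ := norm_sub_le _ _
    _ ≤ _ := add_le_add_left (norm_add_le _ _) _
    _ ≤ _ := by rw [h2, h3]; linarith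

theorem norm_sum_mul_pow_le_of_concave {k₁ k₂ : ℕ → ℝ} {A : ℝ}
    (hm₁ : Monotone k₁) (hm₂ : Monotone k₂)
    (hc₁ : Antitone fun d => k₁ (d + 1) - k₁ d) (hc₂ : Antitone fun d => k₂ (d + 1) - k₂ d)
    (hA : |k₁ 0 - k₂ 0| + (k₁ 1 - k₁ 0) + (k₂ 1 - k₂ 0) ≤ A) {z : ℂ}
    (hz : ‖z‖ = 1) (hz1 : z ≠ 1) (N : ℕ) :
    ‖∑ d ∈ range (N + 1), ((k₁ d - k₂ d : ℝ) : ℂ) * z ^ d‖ ≤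
      |k₁ N - k₂ N| / ‖1 - z‖ + 2 * A / ‖1 - z‖ ^ 2 := by
  have hpos : 0 < ‖1 - z‖ := norm_pos_iff.2 (sub_ne_zero.2 (Ne.symm hz1))
  have hle2 : ‖1 - z‖ ≤ 2 := by
    refine (norm_sub_le _ _).trans ?_
    rw [hz, norm_one]; norm_num
  have key : ∀ N, (1 - z) * ∑ d ∈ range (N + 1), ((k₁ d - k₂ d : ℝ) : ℂ) * z ^ d =
      ((k₁ 0 - k₂ 0 : ℝ) : ℂ) + z * (∑ d ∈ range N, ((k₁ (d + 1) - k₁ d : ℝ) : ℂ) * z ^ d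
        - ∑ d ∈ range N, ((k₂ (d + 1) - k₂ d : ℝ) : ℂ) * z ^ d)
        - ((k₁ N - k₂ N : ℝ) : ℂ) * z ^ (N + 1) := by
    intro N
    induction N with
    | zero => simp; ring
    | succ N ih =>
      rw [sum_range_succ, mul_add, ih, sum_range_succ (n := N), sum_range_succ (n := N)]
      push_cast; ring
  have h1 := norm_sum_mul_pow_le_of_antitone hc₁ (fun d => by linarith [hm₁ (Nat.le_succ d)]) hz N
  have h2 := norm_sum_mul_pow_le_of_antitone hc₂ (fun d => by linarith [hm₂ (Nat.le_succ d)]) hz N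
  simp only [zero_add] at h1 h2
  have h3 : ‖1 - z‖ * ‖∑ d ∈ range (N + 1), ((k₁ d - k₂ d : ℝ) : ℂ) * z ^ d‖ ≤
      |k₁ 0 - k₂ 0| + (‖∑ d ∈ range N, ((k₁ (d + 1) - k₁ d : ℝ) : ℂ) * z ^ d‖
        + ‖∑ d ∈ range N, ((k₂ (d + 1) - k₂ d : ℝ) : ℂ) * z ^ d‖) + |k₁ N - k₂ N| := by
    rw [← norm_mul, key]
    refine (norm_sub_le _ _).trans ?_
    rw [norm_mul _ (z ^ (N + 1)), norm_pow, hz, one_pow, mul_one, Complex.norm_real,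
      Real.norm_eq_abs]
    refine add_le_add_left ((norm_add_le _ _).trans ?_) _
    rw [Complex.norm_real, Real.norm_eq_abs, norm_mul, hz, one_mul]
    exact add_le_add_right (norm_sub_le _ _) _
  set X := ‖∑ d ∈ range (N + 1), ((k₁ d - k₂ d : ℝ) : ℂ) * z ^ d‖
  set t := ‖1 - z‖
  have h0 : t * |k₁ 0 - k₂ 0| ≤ 2 * |k₁ 0 - k₂ 0| := by gcongr
  have h4 : t ^ 2 * X ≤ t * |k₁ N - k₂ N| + 2 * A := by
    have := mul_le_mul_of_nonneg_left h3 hpos.le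
    nlinarith
  have : |k₁ N - k₂ N| / t + 2 * A / t ^ 2 = (t * |k₁ N - k₂ N| + 2 * A) / t ^ 2 := by
    field_simp
  rw [this, le_div_iff₀ (by positivity)]
  linarith

end

section

open Complex Set Finset
open scoped ZMod

theorem four_mul_le_norm_exp_sub_one {t : ℝ} (h0 : 0 ≤ t) (h1 : t ≤ 1 / 2) :
    4 * t ≤ ‖Complex.exp (I * ((2 * Real.pi * t : ℝ) : ℂ)) - 1‖ := by
  rw [Complex.norm_exp_I_mul_ofReal_sub_one]
  have hpi := Real.pi_pos
  have h := Real.mul_le_sin (x := Real.pi * t) (by positivity) (by nlinarith)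
  have h2 : 2 / Real.pi * (Real.pi * t) = 2 * t := by field_simp
  rw [h2] at h
  rw [Real.norm_eq_abs]
  refine le_trans ?_ (le_abs_self _)
  have : 2 * Real.pi * t / 2 = Real.pi * t := by ring
  rw [this]; linarith

theorem inv_sq_norm_exp_sub_one_le {N v : ℕ} (hv : 1 ≤ v) (hvN : v < N) :
    (‖Complex.exp (I * ((2 * Real.pi * (v / N : ℝ) : ℝ) : ℂ)) - 1‖ ^ 2)⁻¹ ≤
      (N : ℝ) ^ 2 / 16 * (1 / (v : ℝ) ^ 2 + 1 / ((N - v : ℕ) : ℝ) ^ 2) := by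
  have hN : (0 : ℝ) < N := by exact_mod_cast (by omega : 0 < N)
  have hv0 : (0 : ℝ) < v := by exact_mod_cast hv
  have hsub : ((N - v : ℕ) : ℝ) = N - v := by rw [Nat.cast_sub hvN.le]
  have hw0 : (0 : ℝ) < ((N - v : ℕ) : ℝ) := by exact_mod_cast (by omega : 0 < N - v)
  rcases le_or_gt ((v : ℝ) / N) (1 / 2) with h | h
  · have h1 := four_mul_le_norm_exp_sub_one (t := (v / N : ℝ)) (by positivity) h
    calc _ ≤ ((4 * ((v : ℝ) / N)) ^ 2)⁻¹ := by gcongr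
      _ = (N : ℝ) ^ 2 / 16 * (1 / (v : ℝ) ^ 2) := by field_simp; norm_num
      _ ≤ _ := by gcongr; linarith [show (0 : ℝ) ≤ 1 / ((N - v : ℕ) : ℝ) ^ 2 by positivity]
  · have h2 : ((N - v : ℕ) : ℝ) / N ≤ 1 / 2 := by
      rw [hsub, sub_div, div_self hN.ne']; linarith
    have h1 := four_mul_le_norm_exp_sub_one (t := (((N - v : ℕ) : ℝ) / N : ℝ)) (by positivity) h2
    have h3 : ‖Complex.exp (I * ((2 * Real.pi * (((N - v : ℕ) : ℝ) / N : ℝ) : ℝ) : ℂ)) - 1‖ =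
        ‖Complex.exp (I * ((2 * Real.pi * (v / N : ℝ) : ℝ) : ℂ)) - 1‖ := by
      rw [Complex.norm_exp_I_mul_ofReal_sub_one, Complex.norm_exp_I_mul_ofReal_sub_one]
      have : 2 * Real.pi * (((N - v : ℕ) : ℝ) / N) / 2 = Real.pi - 2 * Real.pi * (v / N : ℝ) / 2 := by
        rw [hsub]; field_simp
      rw [this, Real.sin_pi_sub]
    rw [h3] at h1
    calc _ ≤ ((4 * (((N - v : ℕ) : ℝ) / N)) ^ 2)⁻¹ := by gcongr
      _ = (N : ℝ) ^ 2 / 16 * (1 / ((N - v : ℕ) : ℝ) ^ 2) := by field_simp; norm_num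
      _ ≤ _ := by gcongr; linarith [show (0 : ℝ) ≤ 1 / (v : ℝ) ^ 2 by positivity]

theorem sum_range_inv_sq_le (n : ℕ) : ∑ v ∈ range n, 1 / ((v + 1 : ℕ) : ℝ) ^ 2 ≤ 2 := by
  have : ∀ n : ℕ, ∑ v ∈ range (n + 1), 1 / ((v + 1 : ℕ) : ℝ) ^ 2 ≤ 2 - 1 / ((n + 1 : ℕ) : ℝ) := by
    intro n
    induction n with
    | zero => norm_num
    | succ n ih =>
      rw [sum_range_succ]
      have h : 1 / ((n + 1 + 1 : ℕ) : ℝ) ^ 2 ≤ 1 / ((n + 1 : ℕ) : ℝ) - 1 / ((n + 1 + 1 : ℕ) : ℝ) := by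
        push_cast
        rw [div_sub_div _ _ (by positivity) (by positivity),
          div_le_div_iff₀ (by positivity) (by positivity)]
        nlinarith
      linarith
  rcases n with _ | n
  · simp
  · have h := this n
    have : (0 : ℝ) ≤ 1 / ((n + 1 : ℕ) : ℝ) := by positivity
    linarith

variable {f : ℕ} [NeZero f]

theorem ZMod.norm_one_sub_stdAddChar (j : ZMod f) :
    ‖1 - ZMod.stdAddChar j‖ =
      ‖Complex.exp (I * ((2 * Real.pi * ((j.val : ℝ) / f) : ℝ) : ℂ)) - 1‖ := by
  have hj : ((j.val : ℤ) : ZMod f) = j := by simp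
  conv_lhs => rw [← hj, ZMod.stdAddChar_coe, norm_sub_rev]
  congr 3
  push_cast
  ring

theorem ZMod.sum_inv_sq_norm_one_sub_stdAddChar_le :
    ∑ j : ZMod f with j ≠ 0, (‖1 - ZMod.stdAddChar j‖ ^ 2)⁻¹ ≤ (f : ℝ) ^ 2 / 4 := by
  have hfpos : 0 < f := Nat.pos_of_ne_zero (NeZero.ne f)
  have h1 : ∀ j ∈ ({j : ZMod f | j ≠ 0} : Finset (ZMod f)), (‖1 - ZMod.stdAddChar j‖ ^ 2)⁻¹ ≤
      (f : ℝ) ^ 2 / 16 * (1 / (j.val : ℝ) ^ 2 + 1 / ((f - j.val : ℕ) : ℝ) ^ 2) := by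
    intro j hj
    have hj : j ≠ 0 := by simpa using hj
    rw [ZMod.norm_one_sub_stdAddChar]
    exact inv_sq_norm_exp_sub_one_le (Nat.one_le_iff_ne_zero.2 ((ZMod.val_ne_zero j).2 hj))
      (ZMod.val_lt j)
  refine (sum_le_sum h1).trans ?_
  have h2 : ∑ j : ZMod f with j ≠ 0,
      (f : ℝ) ^ 2 / 16 * (1 / (j.val : ℝ) ^ 2 + 1 / ((f - j.val : ℕ) : ℝ) ^ 2) =
      ∑ v ∈ range (f - 1),
        (f : ℝ) ^ 2 / 16 * (1 / ((v + 1 : ℕ) : ℝ) ^ 2 + 1 / ((f - (v + 1) : ℕ) : ℝ) ^ 2) := by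
    refine sum_bij' (fun j _ => j.val - 1) (fun v _ => ((v + 1 : ℕ) : ZMod f)) ?_ ?_ ?_ ?_ ?_
    · intro j hj
      have hj : j ≠ 0 := by simpa using hj
      have := ZMod.val_lt j
      have := (ZMod.val_ne_zero j).2 hj
      simp only [Finset.mem_range]; omega
    · intro v hv
      rw [Finset.mem_range] at hv
      simp only [mem_filter, Finset.mem_univ, true_and]
      rw [ne_eq, ZMod.natCast_eq_zero_iff]
      intro h
      have := Nat.le_of_dvd (by omega) h
      omega
    · intro j hj
      have hj : j ≠ 0 := by simpa using hj
      have := (ZMod.val_ne_zero j).2 hj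
      rw [Nat.sub_add_cancel (by omega)]
      simp
    · intro v hv
      rw [Finset.mem_range] at hv
      rw [ZMod.val_natCast, Nat.mod_eq_of_lt (by omega)]
      omega
    · intro j hj
      have hj : j ≠ 0 := by simpa using hj
      have := (ZMod.val_ne_zero j).2 hj
      rw [Nat.sub_add_cancel (by omega)]
  rw [h2, ← mul_sum, sum_add_distrib]
  have h3 : ∑ v ∈ range (f - 1), 1 / ((f - (v + 1) : ℕ) : ℝ) ^ 2 =
      ∑ v ∈ range (f - 1), 1 / ((v + 1 : ℕ) : ℝ) ^ 2 := by
    rw [← sum_range_reflect]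
    refine sum_congr rfl fun v hv => ?_
    rw [Finset.mem_range] at hv
    congr 4
    omega
  rw [h3]
  have := sum_range_inv_sq_le (f - 1)
  nlinarith [show (0 : ℝ) ≤ (f : ℝ) ^ 2 by positivity]

theorem DirichletCharacter.inv_eq_self_of_sq_eq_one {n : ℕ} {χ : DirichletCharacter ℂ n} (h : χ ^ 2 = 1) :
    χ⁻¹ = χ := by
  rw [inv_eq_iff_mul_eq_one, ← sq, h]

theorem DirichletCharacter.exists_gauss_expansion {χ : DirichletCharacter ℂ f}
    (hp : χ.IsPrimitive) (h2 : χ ^ 2 = 1) :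
    ∃ τ : ℂ, ‖τ‖ = Real.sqrt f ∧
      ∀ k : ZMod f, τ * χ k = ∑ j : ZMod f, ZMod.stdAddChar (-(j * k)) * χ j := by
  have hinv := DirichletCharacter.inv_eq_self_of_sq_eq_one h2
  have hF : 𝓕 (χ : ZMod f → ℂ) = fun k => (χ (-1) * gaussSum χ ZMod.stdAddChar) * χ k := by
    funext k
    rw [hp.fourierTransform_eq_inv_mul_gaussSum, hinv, neg_eq_neg_one_mul, map_mul]
    ring
  generalize χ (-1) * gaussSum χ ZMod.stdAddChar = τ at hF
  refine ⟨τ, ?_, ?_⟩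
  · have h := ZMod.dft_dft (χ : ZMod f → ℂ)
    have h' : 𝓕 (𝓕 (χ : ZMod f → ℂ)) = fun k => τ * (τ * χ k) := by
      rw [hF, ZMod.dft_const_mul, hF]
    have h1 := congr_fun (h'.symm.trans h) 1
    simp only [map_one, mul_one, smul_eq_mul] at h1
    have hn : ‖χ (-1)‖ = 1 := by
      have := χ.unit_norm_eq_one (-1)
      simpa using this
    have h3 := congrArg norm h1
    rw [norm_mul, norm_mul, hn, mul_one, Complex.norm_natCast] at h3
    rw [← h3, Real.sqrt_mul_self (norm_nonneg _)]
  · intro k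
    have := congr_fun hF k
    rw [ZMod.dft_apply] at this
    rw [← this]
    simp [smul_eq_mul]

theorem DirichletCharacter.norm_sum_mul_concave_le {χ : DirichletCharacter ℂ f}
    (hp : χ.IsPrimitive) (h2 : χ ^ 2 = 1) (hχ : χ ≠ 1) {k₁ k₂ : ℕ → ℝ} {A : ℝ} 
    (hm₁ : Monotone k₁) (hm₂ : Monotone k₂)
    (hc₁ : Antitone fun d => k₁ (d + 1) - k₁ d) (hc₂ : Antitone fun d => k₂ (d + 1) - k₂ d)
    (hA : |k₁ 0 - k₂ 0| + (k₁ 1 - k₁ 0) + (k₂ 1 - k₂ 0) ≤ A) (N : ℕ) :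
    ‖∑ d ∈ range (N + 1), χ ((d + 1 : ℕ) : ZMod f) * ((k₁ d - k₂ d : ℝ) : ℂ)‖ ≤
      |k₁ N - k₂ N| * (∑ j : ZMod f with j ≠ 0, ‖1 - ZMod.stdAddChar j‖⁻¹) / Real.sqrt f
        + A * (f : ℝ) ^ 2 / (2 * Real.sqrt f) := by
  obtain ⟨τ, hτ, hexp⟩ := DirichletCharacter.exists_gauss_expansion hp h2
  have hf : (0 : ℝ) < f := by exact_mod_cast Nat.pos_of_ne_zero (NeZero.ne f)
  have hsq : 0 < Real.sqrt f := Real.sqrt_pos.2 hf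
  have hA0 : 0 ≤ A := by
    have h1 := hm₁ (Nat.zero_le 1)
    have h2 := hm₂ (Nat.zero_le 1)
    have := abs_nonneg (k₁ 0 - k₂ 0)
    linarith
  have hχ0 : χ 0 = 0 := by
    refine χ.map_nonunit ?_
    have : Nontrivial (ZMod f) := by
      refine ZMod.nontrivial_iff.2 ?_
      rintro rfl
      exact hχ (DirichletCharacter.level_one χ)
    exact not_isUnit_zero
  have e1 : τ * ∑ d ∈ range (N + 1), χ ((d + 1 : ℕ) : ZMod f) * ((k₁ d - k₂ d : ℝ) : ℂ) =
      ∑ j : ZMod f with j ≠ 0, χ j * ZMod.stdAddChar (-j) *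
        ∑ d ∈ range (N + 1), ((k₁ d - k₂ d : ℝ) : ℂ) * ZMod.stdAddChar (-j) ^ d := by
    have e2 : ∀ d ∈ range (N + 1), τ * (χ ((d + 1 : ℕ) : ZMod f) * ((k₁ d - k₂ d : ℝ) : ℂ)) =
        ∑ j : ZMod f with j ≠ 0, χ j * ZMod.stdAddChar (-j) *
          (((k₁ d - k₂ d : ℝ) : ℂ) * ZMod.stdAddChar (-j) ^ d) := by
      intro d _
      rw [← mul_assoc, hexp, sum_mul]
      rw [← sum_filter_add_sum_filter_not univ (fun j : ZMod f => j ≠ 0)]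
      have : ∑ j : ZMod f with ¬ (j ≠ 0), ZMod.stdAddChar (-(j * ((d + 1 : ℕ) : ZMod f))) * χ j *
          ((k₁ d - k₂ d : ℝ) : ℂ) = 0 := by
        refine sum_eq_zero fun j hj => ?_
        have : j = 0 := by simpa using hj
        rw [this, hχ0]; ring
      rw [this, add_zero]
      refine sum_congr rfl fun j _ => ?_
      have : -(j * ((d + 1 : ℕ) : ZMod f)) = (d + 1) • (-j) := by
        rw [nsmul_eq_mul]; ring
      rw [this, AddChar.map_nsmul_eq_pow]
      ring
    rw [mul_sum, sum_congr rfl e2, sum_comm]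
    refine sum_congr rfl fun j _ => ?_
    rw [mul_sum]
  have e3 : Real.sqrt f *
      ‖∑ d ∈ range (N + 1), χ ((d + 1 : ℕ) : ZMod f) * ((k₁ d - k₂ d : ℝ) : ℂ)‖ ≤
      ∑ j : ZMod f with j ≠ 0, (|k₁ N - k₂ N| * ‖1 - ZMod.stdAddChar (-j)‖⁻¹
        + 2 * A * (‖1 - ZMod.stdAddChar (-j)‖ ^ 2)⁻¹) := by
    rw [← hτ, ← norm_mul, e1]
    refine (norm_sum_le _ _).trans (sum_le_sum fun j hj => ?_)
    have hj : j ≠ 0 := by simpa using hj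
    have hz : ‖ZMod.stdAddChar (-j)‖ = 1 := AddChar.norm_apply _ _
    have hz1 : ZMod.stdAddChar (-j) ≠ 1 := by
      intro h
      have h' : ZMod.stdAddChar (-j) = ZMod.stdAddChar (0 : ZMod f) := by simpa using h
      have := ZMod.injective_stdAddChar h'
      exact hj (by simpa using this)
    have h := norm_sum_mul_pow_le_of_concave hm₁ hm₂ hc₁ hc₂ hA hz hz1 N
    rw [norm_mul, norm_mul, hz, mul_one]
    refine (mul_le_of_le_one_left (norm_nonneg _) (χ.norm_le_one j)).trans ?_
    simpa [div_eq_mul_inv] using h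
  have e4 : ∀ g : ZMod f → ℝ, ∑ j : ZMod f with j ≠ 0, g (-j) = ∑ j : ZMod f with j ≠ 0, g j := by
    intro g
    refine sum_nbij' (fun j => -j) (fun j => -j) ?_ ?_ ?_ ?_ ?_ <;> simp
  rw [e4 (fun j => |k₁ N - k₂ N| * ‖1 - ZMod.stdAddChar j‖⁻¹
        + 2 * A * (‖1 - ZMod.stdAddChar j‖ ^ 2)⁻¹), sum_add_distrib, ← mul_sum, ← mul_sum] at e3
  have h5 := ZMod.sum_inv_sq_norm_one_sub_stdAddChar_le (f := f)
  have h6 : 2 * A * ∑ j : ZMod f with j ≠ 0, (‖1 - ZMod.stdAddChar j‖ ^ 2)⁻¹ ≤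
      A * (f : ℝ) ^ 2 / 2 := by nlinarith
  have h7 : A * (f : ℝ) ^ 2 / (2 * Real.sqrt f) = (A * (f : ℝ) ^ 2 / 2) / Real.sqrt f := by
    field_simp
  rw [h7, ← add_div, le_div_iff₀ hsq]
  linarith

end

section

open Complex Set Finset
open scoped ComplexOrder

theorem hasSum_pnat_geometric {w : ℂ} (hw : ‖w‖ < 1) :
    HasSum (fun m : ℕ+ => w ^ (m : ℕ)) (w / (1 - w)) := by
  have h := (hasSum_geometric_of_norm_lt_one hw).mul_left w
  rw [← Equiv.pnatEquivNat.symm.hasSum_iff]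
  rw [← div_eq_mul_inv] at h
  have e : ((fun m : ℕ+ => w ^ (m : ℕ)) ∘ Equiv.pnatEquivNat.symm) = fun n => w * w ^ n := by
    funext n
    simp [pow_succ']
  rwa [e]

variable {f : ℕ}

theorem DirichletCharacter.one_le_zetaMul_sq {χ : DirichletCharacter ℂ f} (hχ : χ ^ 2 = 1) {m : ℕ}
    (hm : m ≠ 0) : 1 ≤ χ.zetaMul (m ^ 2) := by
  rw [χ.isMultiplicative_zetaMul.multiplicative_factorization _ (pow_ne_zero 2 hm)]
  rw [Finsupp.prod]
  refine Finset.prod_induction _ (fun z : ℂ => 1 ≤ z)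
    (fun a b ha hb => one_le_mul_of_one_le_of_one_le ha hb) le_rfl ?_
  intro p hp
  have hp' : p.Prime := Nat.prime_of_mem_primeFactors hp
  rw [Nat.factorization_pow, Finsupp.smul_apply, smul_eq_mul]
  generalize m.factorization p = k
  have hi : ∀ i, toArithmeticFunction (fun n : ℕ => χ (n : ZMod f)) (p ^ i) = χ (p : ZMod f) ^ i := by
    intro i
    have h0 : p ^ i ≠ 0 := pow_ne_zero i hp'.ne_zero
    change (if p ^ i = 0 then 0 else χ ((p ^ i : ℕ) : ZMod f)) = _
    rw [if_neg h0, Nat.cast_pow, map_pow]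
  rw [DirichletCharacter.zetaMul, ArithmeticFunction.coe_zeta_mul_apply,
    Nat.sum_divisors_prime_pow hp', sum_congr rfl fun i _ => hi i]
  rcases MulChar.isQuadratic_iff_sq_eq_one.mpr hχ p with h | h | h
  · rw [h, Finset.sum_range_succ']
    simp
  · have : (0 : ℂ) ≤ ((2 * k : ℕ) : ℂ) := Nat.cast_nonneg _
    rw [h]
    simpa using this
  · simp only [h, neg_one_geom_sum]
    rw [if_neg]
    intro h
    have := Nat.even_add_one.1 h
    exact this (even_two_mul k)

theorem DirichletCharacter.exists_lambert (χ : DirichletCharacter ℂ f) {r : ℝ} (hr0 : 0 ≤ r)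
    (hr : r < 1) : ∃ S : ℂ, HasSum (fun n : ℕ+ => χ.zetaMul n * (r : ℂ) ^ (n : ℕ)) S ∧
      HasSum (fun d : ℕ+ => χ ((d : ℕ) : ZMod f) * ((r : ℂ) ^ (d : ℕ) / (1 - (r : ℂ) ^ (d : ℕ)))) S := by
  have hr' : ‖(r : ℂ)‖ < 1 := by
    rwa [Complex.norm_real, Real.norm_eq_abs, abs_of_nonneg hr0]
  set F : ℕ+ × ℕ+ → ℂ := fun c => χ ((c.1 : ℕ) : ZMod f) * (r : ℂ) ^ (c.1 * c.2 : ℕ) with hF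
  have hsum : Summable F := by
    refine Summable.of_norm_bounded ((summable_prod_mul_pow 0 hr').norm) ?_
    intro c
    simp only [hF, norm_mul, pow_zero, one_mul]
    exact mul_le_of_le_one_left (norm_nonneg _) (χ.norm_le_one _)
  obtain ⟨S, hS⟩ := hsum
  refine ⟨S, ?_, ?_⟩
  · have h1 := (sigmaAntidiagonalEquivProd.hasSum_iff).2 hS
    refine h1.sigma fun n => ?_
    have h2 := hasSum_fintype (fun x : Nat.divisorsAntidiagonal (n : ℕ) =>
      (F ∘ sigmaAntidiagonalEquivProd) ⟨n, x⟩)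
    have h3 : ∑ x : Nat.divisorsAntidiagonal (n : ℕ), (F ∘ sigmaAntidiagonalEquivProd) ⟨n, x⟩ =
        χ.zetaMul n * (r : ℂ) ^ (n : ℕ) := by
      rw [DirichletCharacter.zetaMul, mul_comm (ArithmeticFunction.zeta : ArithmeticFunction ℂ),
        ArithmeticFunction.mul_apply, sum_mul, ← sum_coe_sort (Nat.divisorsAntidiagonal (n : ℕ))]
      refine sum_congr rfl fun x _ => ?_
      obtain ⟨hx1, _⟩ := Nat.mem_divisorsAntidiagonal.1 x.2
      have ha : x.1.1 ≠ 0 := by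
        intro h; rw [h, zero_mul] at hx1; exact n.ne_zero hx1.symm
      have hb : x.1.2 ≠ 0 := by
        intro h; rw [h, mul_zero] at hx1; exact n.ne_zero hx1.symm
      rw [ArithmeticFunction.natCoe_apply, ArithmeticFunction.zeta_apply_ne hb, Nat.cast_one,
        mul_one]
      simp only [toArithmeticFunction, ArithmeticFunction.coe_mk, if_neg ha]
      simp only [hF, Function.comp, sigmaAntidiagonalEquivProd, divisorsAntidiagonalFactors,
        Equiv.coe_fn_mk, PNat.mk_coe]
      rw [hx1]
    rwa [h3] at h2
  · refine hS.prod_fiberwise fun d => ?_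
    have hd : ‖(r : ℂ) ^ (d : ℕ)‖ < 1 := by
      rw [norm_pow]; exact pow_lt_one₀ (norm_nonneg _) hr' d.ne_zero
    have := (hasSum_pnat_geometric hd).mul_left (χ ((d : ℕ) : ZMod f))
    simpa [hF, pow_mul] using this

theorem antitone_diff_boseDefect {c : ℝ} (hc : 0 < c) :
    Antitone fun d : ℕ => boseDefect (((d + 1 : ℕ) + 1 : ℕ) * c) - boseDefect ((d + 1 : ℕ) * c) := by
  refine antitone_nat_of_succ_le fun d => ?_
  have hx : (((d + 1 : ℕ) : ℝ) * c) ∈ Set.Ioi (0 : ℝ) := Set.mem_Ioi.2 (by positivity)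
  have hy : (((d + 1 + 1 + 1 : ℕ) : ℝ) * c) ∈ Set.Ioi (0 : ℝ) := Set.mem_Ioi.2 (by positivity)
  have h := concaveOn_boseDefect.2 hx hy (by norm_num : (0 : ℝ) ≤ 1 / 2)
    (by norm_num : (0 : ℝ) ≤ 1 / 2) (by norm_num)
  have e : (1 / 2 : ℝ) • (((d + 1 : ℕ) : ℝ) * c) + (1 / 2 : ℝ) • (((d + 1 + 1 + 1 : ℕ) : ℝ) * c) =
      ((d + 1 + 1 : ℕ) : ℝ) * c := by
    simp only [smul_eq_mul]; push_cast; ring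
  rw [e] at h
  simp only [smul_eq_mul] at h
  linarith

theorem monotone_boseDefect_mul {c : ℝ} (hc : 0 < c) :
    Monotone fun d : ℕ => boseDefect ((d + 1 : ℕ) * c) := by
  intro a b hab
  refine monotoneOn_boseDefect (Set.mem_Ioi.2 (by positivity)) (Set.mem_Ioi.2 (by positivity)) ?_
  gcongr

theorem tendsto_boseDefect_mul {c : ℝ} (hc : 0 < c) :
    Filter.Tendsto (fun d : ℕ => boseDefect ((d + 1 : ℕ) * c)) Filter.atTop (nhds 0) := by
  refine boseDefect_tendsto_atTop.comp ?_
  refine Filter.Tendsto.atTop_mul_const hc ?_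
  exact tendsto_natCast_atTop_atTop.comp (Filter.tendsto_add_atTop_nat 1)

theorem lambert_term_eq {x : ℝ} (hx : 0 < x) {d : ℕ} (hd : 0 < d) :
    Real.exp (-(1 / x)) ^ d / (1 - Real.exp (-(1 / x)) ^ d)
      - Real.exp (-(2 / x)) ^ d / (1 - Real.exp (-(2 / x)) ^ d) =
    x / 2 * (1 / d) + (boseDefect (d * (1 / x)) - boseDefect (d * (2 / x))) := by
  have hd' : (0 : ℝ) < d := by exact_mod_cast hd
  have key : ∀ c : ℝ, 0 < c → Real.exp (-c) ^ d / (1 - Real.exp (-c) ^ d) =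
      1 / (d * c) + boseDefect (d * c) := by
    intro c hc
    have hv : 0 < d * c := by positivity
    have h1 : Real.exp (-c) ^ d = (Real.exp (d * c))⁻¹ := by
      rw [← Real.exp_nat_mul, ← Real.exp_neg]; ring_nf
    have h2 : Real.exp (d * c) - 1 ≠ 0 := by
      have := Real.add_one_lt_exp hv.ne'; linarith
    have h3 := (Real.exp_pos (d * c)).ne'
    rw [h1, boseDefect]
    have : 1 - (Real.exp (d * c))⁻¹ = (Real.exp (d * c) - 1) / Real.exp (d * c) := by field_simp
    rw [this]
    field_simp
    ring
  rw [key _ (by positivity), key _ (by positivity)]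
  field_simp
  ring

theorem DirichletCharacter.norm_lambert_ge {χ : DirichletCharacter ℂ f} (hχ : χ ^ 2 = 1) {M : ℕ}
    (hM : 1 ≤ M) {S : ℂ}
    (hS : HasSum (fun n : ℕ+ => χ.zetaMul n * ((Real.exp (-(1 / (4 * (M : ℝ) ^ 2))) ^ (n : ℕ)
      - Real.exp (-(2 / (4 * (M : ℝ) ^ 2))) ^ (n : ℕ) : ℝ) : ℂ)) S) : 0.16 * M ≤ ‖S‖ := by
  have hM' : (0 : ℝ) < M := by exact_mod_cast hM
  set x : ℝ := 4 * (M : ℝ) ^ 2 with hx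
  have hx0 : 0 < x := by positivity
  have hre := Complex.reCLM.hasSum hS
  have hpow : ∀ n : ℕ, Real.exp (-(1 / x)) ^ n - Real.exp (-(2 / x)) ^ n =
      Real.exp (-(n / x)) - Real.exp (-(n / x)) ^ 2 := by
    intro n
    rw [← Real.exp_nat_mul, ← Real.exp_nat_mul, ← Real.exp_nat_mul]
    congr 2
    · ring
    · push_cast; ring
  have hterm : ∀ n : ℕ, (Complex.reCLM (χ.zetaMul n * ((Real.exp (-(1 / x)) ^ n
      - Real.exp (-(2 / x)) ^ n : ℝ) : ℂ))) =
      (χ.zetaMul n).re * (Real.exp (-(n / x)) - Real.exp (-(n / x)) ^ 2) := by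
    intro n
    rw [hpow, Complex.reCLM_apply, Complex.re_mul_ofReal]
  have hw0 : ∀ n : ℕ, 0 ≤ Real.exp (-(n / x)) - Real.exp (-(n / x)) ^ 2 := by
    intro n
    have h1 : Real.exp (-(n / x)) ≤ 1 := Real.exp_le_one_iff.2 (by
      have : (0 : ℝ) ≤ n / x := by positivity
      linarith)
    have h2 := Real.exp_pos (-(n / x))
    nlinarith
  have hinj : Function.Injective fun m : ℕ => (Nat.succPNat (m + M - 1) ^ 2 : ℕ+) := by
    intro a b hab
    have h1 : ((Nat.succPNat (a + M - 1) ^ 2 : ℕ+) : ℕ) = ((Nat.succPNat (b + M - 1) ^ 2 : ℕ+) : ℕ) := by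
      exact congrArg _ hab
    simp only [PNat.pow_coe, Nat.succPNat_coe] at h1
    have := Nat.pow_left_injective (n := 2) (by norm_num) h1
    simp only [Nat.succ_eq_add_one] at this
    omega
  have h1 : ∑ n ∈ (range M).image (fun m : ℕ => (Nat.succPNat (m + M - 1) ^ 2 : ℕ+)),
      (Complex.reCLM (χ.zetaMul n * ((Real.exp (-(1 / x)) ^ (n : ℕ)
      - Real.exp (-(2 / x)) ^ (n : ℕ) : ℝ) : ℂ))) ≤ Complex.reCLM S := by
    refine sum_le_hasSum _ (fun n _ => ?_) hre
    change 0 ≤ Complex.reCLM _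
    rw [hterm]
    exact mul_nonneg (Complex.le_def.1 (DirichletCharacter.zetaMul_nonneg hχ n)).1 (hw0 n)
  rw [sum_image hinj.injOn] at h1
  have h2 : ∀ m ∈ range M, (0.16 : ℝ) ≤ Complex.reCLM
      (χ.zetaMul (Nat.succPNat (m + M - 1) ^ 2 : ℕ+) *
      ((Real.exp (-(1 / x)) ^ ((Nat.succPNat (m + M - 1) ^ 2 : ℕ+) : ℕ)
      - Real.exp (-(2 / x)) ^ ((Nat.succPNat (m + M - 1) ^ 2 : ℕ+) : ℕ) : ℝ) : ℂ)) := by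
    intro m hm
    rw [Finset.mem_range] at hm
    rw [hterm]
    have e : ((Nat.succPNat (m + M - 1) ^ 2 : ℕ+) : ℕ) = (m + M) ^ 2 := by
      rw [PNat.pow_coe, Nat.succPNat_coe, Nat.succ_eq_add_one]
      congr 1; omega
    rw [e]
    have hz := (Complex.le_def.1 (DirichletCharacter.one_le_zetaMul_sq hχ
      (by omega : m + M ≠ 0))).1
    rw [Complex.one_re] at hz
    have hu1 : (((m + M) ^ 2 : ℕ) : ℝ) / x ≤ 1 := by
      rw [div_le_one hx0, hx]
      have : (m : ℝ) ≤ M := by exact_mod_cast hm.le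
      push_cast
      nlinarith
    have hu2 : 1 / 4 ≤ (((m + M) ^ 2 : ℕ) : ℝ) / x := by
      rw [le_div_iff₀ hx0, hx]
      push_cast
      have : (0 : ℝ) ≤ m := by positivity
      nlinarith
    set u := (((m + M) ^ 2 : ℕ) : ℝ) / x
    have ht1 : 0.36 ≤ Real.exp (-u) := by
      have h3 := Real.exp_neg_one_gt_d9
      have h4 : Real.exp (-1) ≤ Real.exp (-u) := Real.exp_le_exp.2 (by linarith)
      linarith
    have ht2 : Real.exp (-u) ≤ 0.8 := by
      have h3 : Real.exp (-u) ≤ Real.exp (-(1 / 4)) := Real.exp_le_exp.2 (by linarith)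
      have h4 : Real.exp (-(1 / 4)) ≤ 0.8 := by
        rw [Real.exp_neg]
        have := Real.add_one_le_exp (1 / 4 : ℝ)
        calc _ ≤ (1 / 4 + 1 : ℝ)⁻¹ := by gcongr
          _ = _ := by norm_num
      linarith
    have h5 : (0.16 : ℝ) ≤ Real.exp (-u) - Real.exp (-u) ^ 2 := by nlinarith
    nlinarith
  have h3 := sum_le_sum h2
  rw [sum_const, card_range, nsmul_eq_mul] at h3
  have h4 : Complex.reCLM S ≤ ‖S‖ := Complex.re_le_norm S
  linarith

variable [NeZero f]

theorem DirichletCharacter.tendsto_sum_LFunction_one {χ : DirichletCharacter ℂ f} (hχ : χ ≠ 1) :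
    Filter.Tendsto (fun N : ℕ => ∑ n ∈ range N, χ ((n + 1 : ℕ) : ZMod f) * (1 / ((n + 1 : ℕ) : ℂ)))
      Filter.atTop (nhds (χ.LFunction 1)) := by
  rw [tendsto_iff_norm_sub_tendsto_zero]
  have h0 : Filter.Tendsto (fun N : ℕ => (f : ℝ) * (1 / (N : ℝ))) Filter.atTop (nhds 0) := by
    simpa using tendsto_one_div_atTop_nhds_zero_nat.const_mul (f : ℝ)
  refine squeeze_zero' (Filter.Eventually.of_forall fun _ => norm_nonneg _) ?_ h0
  filter_upwards [Filter.eventually_ge_atTop 1] with N hN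
  have h := DirichletCharacter.norm_LFunction_sub_sum_le hχ hN (s := 1) (by simp)
  rw [norm_sub_rev]
  simpa [Real.rpow_neg_one, Complex.cpow_neg_one] using h

theorem DirichletCharacter.norm_lambert_sub_le {χ : DirichletCharacter ℂ f}
    (hp : χ.IsPrimitive) (h2 : χ ^ 2 = 1) (hχ : χ ≠ 1) {x : ℝ} (hx : 0 < x) {S : ℂ}
    (hS : HasSum (fun d : ℕ+ => χ ((d : ℕ) : ZMod f) *
      ((Real.exp (-(1 / x)) ^ (d : ℕ) / (1 - Real.exp (-(1 / x)) ^ (d : ℕ))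
      - Real.exp (-(2 / x)) ^ (d : ℕ) / (1 - Real.exp (-(2 / x)) ^ (d : ℕ)) : ℝ) : ℂ)) S) :
    ‖S - x / 2 * χ.LFunction 1‖ ≤ (f : ℝ) ^ 2 / (2 * x * Real.sqrt f) := by
  set k₁ : ℕ → ℝ := fun d => boseDefect ((d + 1 : ℕ) * (1 / x)) with hk₁
  set k₂ : ℕ → ℝ := fun d => boseDefect ((d + 1 : ℕ) * (2 / x)) with hk₂
  have hS' : HasSum (fun d : ℕ => χ ((d + 1 : ℕ) : ZMod f) *
      ((x / 2 * (1 / ((d + 1 : ℕ) : ℝ)) + (k₁ d - k₂ d) : ℝ) : ℂ)) S := by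
    rw [← Equiv.pnatEquivNat.symm.hasSum_iff] at hS
    convert hS using 2 with d
    rw [Function.comp]
    have := lambert_term_eq hx (Nat.succ_pos d)
    simp only [Equiv.pnatEquivNat_symm_apply, Nat.succPNat_coe]
    rw [this]
  have hlim : Filter.Tendsto (fun N : ℕ => ∑ d ∈ range (N + 1), χ ((d + 1 : ℕ) : ZMod f) *
      ((k₁ d - k₂ d : ℝ) : ℂ)) Filter.atTop (nhds (S - x / 2 * χ.LFunction 1)) := by
    have h1 := (hS'.tendsto_sum_nat.sub
      ((DirichletCharacter.tendsto_sum_LFunction_one hχ).const_mul (x / 2 : ℂ))).comp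
        (Filter.tendsto_add_atTop_nat 1)
    refine h1.congr fun N => ?_
    simp only [Function.comp]
    rw [mul_sum, ← sum_sub_distrib]
    refine sum_congr rfl fun d _ => ?_
    push_cast
    ring
  have h1x : 0 < 1 / x := by positivity
  have h2x : 0 < 2 / x := by positivity
  have hA : |k₁ 0 - k₂ 0| + (k₁ 1 - k₁ 0) + (k₂ 1 - k₂ 0) ≤ 1 / x := by
    have e1 : k₁ 0 ≤ k₂ 0 := by
      refine monotoneOn_boseDefect (Set.mem_Ioi.2 (by positivity)) (Set.mem_Ioi.2 (by positivity)) ?_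
      gcongr; norm_num
    have e2 : k₂ 0 - k₁ 0 ≤ 1 / 4 * ((0 + 1 : ℕ) * (2 / x) - (0 + 1 : ℕ) * (1 / x)) :=
      boseDefect_sub_le (by positivity) (by gcongr; norm_num)
    have e3 : k₁ 1 - k₁ 0 ≤ 1 / 4 * ((1 + 1 : ℕ) * (1 / x) - (0 + 1 : ℕ) * (1 / x)) :=
      boseDefect_sub_le (by positivity) (by gcongr; norm_num)
    have e4 : k₂ 1 - k₂ 0 ≤ 1 / 4 * ((1 + 1 : ℕ) * (2 / x) - (0 + 1 : ℕ) * (2 / x)) :=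
      boseDefect_sub_le (by positivity) (by gcongr; norm_num)
    rw [abs_of_nonpos (by linarith)]
    have e5 : (2 : ℝ) / x = 2 * (1 / x) := by ring
    rw [e5] at e2 e4
    push_cast at e2 e3 e4
    linarith
  have hbound := DirichletCharacter.norm_sum_mul_concave_le hp h2 hχ (monotone_boseDefect_mul h1x)
    (monotone_boseDefect_mul h2x) (antitone_diff_boseDefect h1x) (antitone_diff_boseDefect h2x) hA
  have hr : Filter.Tendsto (fun N : ℕ => |k₁ N - k₂ N| *
      (∑ j : ZMod f with j ≠ 0, ‖1 - ZMod.stdAddChar j‖⁻¹) / Real.sqrt f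
        + 1 / x * (f : ℝ) ^ 2 / (2 * Real.sqrt f)) Filter.atTop
      (nhds ((f : ℝ) ^ 2 / (2 * x * Real.sqrt f))) := by
    have h1 := ((((tendsto_boseDefect_mul h1x).sub (tendsto_boseDefect_mul h2x)).abs.mul_const
      (∑ j : ZMod f with j ≠ 0, ‖1 - ZMod.stdAddChar j‖⁻¹)).div_const (Real.sqrt f)).add_const
        (1 / x * (f : ℝ) ^ 2 / (2 * Real.sqrt f))
    have e : |(0 : ℝ) - 0| * (∑ j : ZMod f with j ≠ 0, ‖1 - ZMod.stdAddChar j‖⁻¹) / Real.sqrt f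
        + 1 / x * (f : ℝ) ^ 2 / (2 * Real.sqrt f) = (f : ℝ) ^ 2 / (2 * x * Real.sqrt f) := by
      rw [sub_zero, abs_zero, zero_mul, zero_div, zero_add]
      field_simp
    rw [e] at h1
    exact h1
  exact le_of_tendsto_of_tendsto' hlim.norm hr hbound

/-- A lower bound for `L(1, χ)`, `χ` a primitive real character. -/
theorem DirichletCharacter.norm_LFunction_one_ge {χ : DirichletCharacter ℂ f}
    (hp : χ.IsPrimitive) (h2 : χ ^ 2 = 1) (hχ : χ ≠ 1) :
    1 / (60 * Real.sqrt f) ≤ ‖χ.LFunction 1‖ := by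
  have hf1 : 1 ≤ f := Nat.one_le_iff_ne_zero.2 (NeZero.ne f)
  have hf : (1 : ℝ) ≤ f := by exact_mod_cast hf1
  set y := Real.sqrt f with hy
  have hy1 : 1 ≤ y := Real.one_le_sqrt.2 hf
  have hyf : (f : ℝ) = y ^ 2 := (Real.sq_sqrt (by linarith)).symm
  obtain ⟨M, hM1, hM2⟩ : ∃ M : ℕ, 2 * y ≤ M ∧ (M : ℝ) ≤ 4 * y := by
    refine ⟨⌈2 * y⌉₊, Nat.le_ceil _, ?_⟩
    have := Nat.ceil_lt_add_one (a := 2 * y) (by linarith)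
    linarith
  have hM0 : (0 : ℝ) < M := by linarith
  have hMpos : 1 ≤ M := by exact_mod_cast hM0
  set x : ℝ := 4 * (M : ℝ) ^ 2 with hx
  have hx0 : 0 < x := by positivity
  have hlt : ∀ c : ℝ, 0 < c → Real.exp (-c) < 1 := fun c hc => Real.exp_lt_one_iff.2 (by linarith)
  obtain ⟨S₁, hS₁, hT₁⟩ := χ.exists_lambert (Real.exp_pos (-(1 / x))).le (hlt _ (by positivity))
  obtain ⟨S₂, hS₂, hT₂⟩ := χ.exists_lambert (Real.exp_pos (-(2 / x))).le (hlt _ (by positivity))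
  have hS := hS₁.sub hS₂
  have hT := hT₁.sub hT₂
  have hlow : 0.16 * M ≤ ‖S₁ - S₂‖ := by
    refine DirichletCharacter.norm_lambert_ge h2 hMpos ?_
    rw [← hx]
    refine HasSum.congr_fun hS fun n => ?_
    push_cast
    rw [mul_sub]
  have hup : ‖(S₁ - S₂) - x / 2 * χ.LFunction 1‖ ≤ (f : ℝ) ^ 2 / (2 * x * y) := by
    refine DirichletCharacter.norm_lambert_sub_le hp h2 hχ hx0 ?_
    refine HasSum.congr_fun hT fun n => ?_
    push_cast
    rw [mul_sub]
  have h3 : ‖(x / 2 : ℂ) * χ.LFunction 1‖ = 2 * M ^ 2 * ‖χ.LFunction 1‖ := by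
    rw [norm_mul]
    have : (x / 2 : ℂ) = ((2 * M ^ 2 : ℝ) : ℂ) := by rw [hx]; push_cast; ring
    rw [this, Complex.norm_real, Real.norm_eq_abs, abs_of_nonneg (by positivity)]
  have h4 : ‖S₁ - S₂‖ ≤ (f : ℝ) ^ 2 / (2 * x * y) + 2 * M ^ 2 * ‖χ.LFunction 1‖ := by
    rw [← h3]
    calc _ = ‖((S₁ - S₂) - x / 2 * χ.LFunction 1) + x / 2 * χ.LFunction 1‖ := by ring_nf
      _ ≤ _ := (norm_add_le _ _).trans (by gcongr)
  have h5 : (f : ℝ) ^ 2 / (2 * x * y) ≤ M / 64 := by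
    rw [div_le_div_iff₀ (by positivity) (by norm_num), hyf, hx]
    have : (2 * y) ^ 3 ≤ (M : ℝ) ^ 3 := pow_le_pow_left₀ (by linarith) hM1 3
    nlinarith
  have h6 : 0.14 * M ≤ 2 * M ^ 2 * ‖χ.LFunction 1‖ := by linarith
  have h7 : 0.07 ≤ M * ‖χ.LFunction 1‖ := by
    by_contra! h
    nlinarith
  have h8 : 0.07 ≤ 4 * y * ‖χ.LFunction 1‖ := h7.trans (by gcongr)
  rw [div_le_iff₀ (by positivity)]
  linarith

end

section

open Complex

namespace DirichletCharacter

theorem one_sub_mul_prime_cpow_ne_zero {f : ℕ} (ψ : DirichletCharacter ℂ f) {p : ℕ}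
    (hp : p.Prime) {s : ℂ} (hs : 0 < s.re) : 1 - ψ p * (p : ℂ) ^ (-s) ≠ 0 := by
  intro h
  have h1 : ‖ψ p * (p : ℂ) ^ (-s)‖ = 1 := by
    rw [← sub_eq_zero.1 h, norm_one]
  have h2 : ‖(p : ℂ) ^ (-s)‖ < 1 := by
    rw [Complex.norm_natCast_cpow_of_pos hp.pos]
    exact Real.rpow_lt_one_of_one_lt_of_neg (by exact_mod_cast hp.one_lt) (by simpa using hs)
  rw [norm_mul] at h1
  nlinarith [ψ.norm_le_one p, norm_nonneg (ψ p), norm_nonneg ((p : ℂ) ^ (-s))]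

theorem log_eight_mul_le {q : ℕ} (hq : 3 ≤ q) : Real.log (8 * q) ≤ 3 * Real.log q := by
  have hq' : (3 : ℝ) ≤ q := by exact_mod_cast hq
  rw [show (3 : ℝ) * Real.log q = Real.log ((q : ℝ) ^ 3) by rw [Real.log_pow]; norm_num]
  apply Real.log_le_log (by positivity)
  nlinarith [mul_nonneg (by linarith : (0 : ℝ) ≤ q) (by nlinarith : (0 : ℝ) ≤ (q : ℝ) ^ 2 - 9)]

theorem one_le_log {q : ℕ} (hq : 3 ≤ q) : 1 ≤ Real.log q := by
  rw [Real.le_log_iff_exp_le (by positivity)]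
  have hq' : (3 : ℝ) ≤ q := by exact_mod_cast hq
  linarith [Real.exp_one_lt_d9]

theorem LFunction_ne_zero_of_isPrimitive_of_norm_sub_one_le {f q : ℕ} [NeZero f]
    {ψ : DirichletCharacter ℂ f} (hp : ψ.IsPrimitive) (h2 : ψ ^ 2 = 1) (hψ : ψ ≠ 1)
    (hq : 3 ≤ q) (hfq : f ≤ q) {s : ℂ}
    (hs : ‖s - 1‖ ≤ 1 / (30000 * (Real.sqrt q * Real.log q ^ 2))) : ψ.LFunction s ≠ 0 := by
  have hq' : (3 : ℝ) ≤ q := by exact_mod_cast hq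
  have hfq' : (f : ℝ) ≤ q := by exact_mod_cast hfq
  have hf0 : (0 : ℝ) < f := by exact_mod_cast NeZero.pos f
  have hl := one_le_log hq
  have hl8 := log_eight_mul_le hq
  set L := Real.log (8 * q) with hL
  have hL1 : 1 ≤ L := hl.trans (Real.log_le_log (by positivity) (by linarith))
  have hsq : 1 ≤ Real.sqrt q := by rw [Real.one_le_sqrt]; linarith
  have hbd : ∀ z ∈ Metric.ball (1 : ℂ) (1 / L), ‖ψ.LFunction z‖ ≤ 20 * L := by
    intro z hz
    rw [Metric.mem_ball, dist_eq_norm] at hz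
    refine norm_LFunction_le_log hψ (by linarith) ?_ ?_
    · have : ‖z‖ ≤ 2 := by
        have h1 : 1 / L ≤ 1 := by rw [div_le_one (by linarith)]; exact hL1
        calc ‖z‖ = ‖(z - 1) + 1‖ := by ring_nf
          _ ≤ ‖z - 1‖ + 1 := (norm_add_le _ _).trans (by simp)
          _ ≤ 2 := by linarith
      nlinarith [norm_nonneg z]
    · have := (abs_le.1 (abs_re_le_norm (z - 1))).1
      simp at this
      simp at hz ⊢
      linarith
  have hmem1 : (1 : ℂ) ∈ Metric.ball (1 : ℂ) (1 / L) := Metric.mem_ball_self (by positivity)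
  have hsmem : s ∈ Metric.ball (1 : ℂ) (1 / L) := by
    rw [Metric.mem_ball, dist_eq_norm]
    refine hs.trans_lt ?_
    apply one_div_lt_one_div_of_lt (by linarith)
    nlinarith [mul_le_mul hsq (by nlinarith : Real.log q ≤ Real.log q ^ 2) (by linarith) (by positivity)]
  have hmaps : Set.MapsTo ψ.LFunction (Metric.ball (1 : ℂ) (1 / L))
      (Metric.ball (ψ.LFunction 1) (41 * L)) := by
    intro z hz
    rw [Metric.mem_ball, dist_eq_norm]
    have := norm_sub_le (ψ.LFunction z) (ψ.LFunction 1)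
    linarith [hbd z hz, hbd 1 hmem1]
  have hsch := Complex.dist_le_div_mul_dist_of_mapsTo_ball
    (differentiable_LFunction hψ).differentiableOn (hmaps.mono_right Metric.ball_subset_closedBall)
    hsmem
  have hlow := norm_LFunction_one_ge hp h2 hψ
  rw [dist_eq_norm, dist_eq_norm] at hsch
  intro h0
  rw [h0, zero_sub, norm_neg] at hsch
  have h1 : 41 * L / (1 / L) = 41 * L ^ 2 := by field_simp
  rw [h1] at hsch
  have h3 : 41 * L ^ 2 ≤ 369 * Real.log q ^ 2 := by nlinarith
  have h4 : 1 / (60 * Real.sqrt q) ≤ 1 / (60 * Real.sqrt f) := by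
    have := Real.sqrt_pos.2 hf0
    have := Real.sqrt_le_sqrt hfq'
    gcongr
  have h5 : 1 / (60 * Real.sqrt q) ≤ 369 * Real.log q ^ 2 *
      (1 / (30000 * (Real.sqrt q * Real.log q ^ 2))) :=
    (h4.trans hlow).trans (hsch.trans (by gcongr))
  have h6 : 369 * Real.log q ^ 2 * (1 / (30000 * (Real.sqrt q * Real.log q ^ 2))) =
      369 / 30000 * (1 / Real.sqrt q) := by field_simp
  have h7 : 1 / (60 * Real.sqrt q) = 1 / 60 * (1 / Real.sqrt q) := by field_simp
  rw [h6, h7] at h5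
  have : 0 < 1 / Real.sqrt q := by positivity
  linarith

theorem LFunction_ne_zero_of_norm_sub_one_le {q : ℕ} [NeZero q] {χ : DirichletCharacter ℂ q}
    (hq : 3 ≤ q) (hχ : χ ≠ 1) (h2 : χ ^ 2 = 1) {s : ℂ}
    (hs : ‖s - 1‖ ≤ 1 / (30000 * (Real.sqrt q * Real.log q ^ 2))) : χ.LFunction s ≠ 0 := by
  have : NeZero χ.conductor := ⟨χ.conductor_ne_zero⟩
  have hcl := χ.changeLevel_primitiveCharacter
  have hψ : χ.primitiveCharacter ≠ 1 := by
    intro h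
    rw [h, changeLevel_one] at hcl
    exact hχ hcl.symm
  have hψ2 : χ.primitiveCharacter ^ 2 = 1 := by
    rw [← changeLevel_eq_one_iff χ.conductor_dvd_level, map_pow, hcl, h2]
  have hfq : χ.conductor ≤ q := Nat.le_of_dvd (NeZero.pos q) χ.conductor_dvd_level
  have hl := one_le_log hq
  have hsq : 1 ≤ Real.sqrt q := by
    rw [Real.one_le_sqrt]; exact_mod_cast (by omega : 1 ≤ q)
  rw [← hcl, LFunction_changeLevel χ.conductor_dvd_level _ (Or.inl hψ)]
  refine mul_ne_zero (LFunction_ne_zero_of_isPrimitive_of_norm_sub_one_le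
    χ.primitiveCharacter_isPrimitive hψ2 hψ hq hfq hs) ?_
  rw [Finset.prod_ne_zero_iff]
  intro p hp
  apply one_sub_mul_prime_cpow_ne_zero _ (Nat.prime_of_mem_primeFactors hp)
  have h1 : ‖s - 1‖ < 1 := by
    refine hs.trans_lt ?_
    rw [div_lt_one (by positivity)]
    nlinarith [mul_le_mul hsq (by nlinarith : 1 ≤ Real.log q ^ 2) (by linarith) (by positivity)]
  have := (abs_le.1 (abs_re_le_norm (s - 1))).1
  simp at this
  linarith

theorem one_le_log_abs_add_three (t : ℝ) : 1 ≤ Real.log (|t| + 3) := by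
  rw [Real.le_log_iff_exp_le (by positivity)]
  linarith [Real.exp_one_lt_d9, abs_nonneg t]

theorem log_mul_le_two_mul_log_mul_log {q : ℕ} (hq : 3 ≤ q) (t : ℝ) :
    Real.log (q * (|t| + 2)) ≤ 2 * (Real.log q * Real.log (|t| + 3)) := by
  have hq' : (3 : ℝ) ≤ q := by exact_mod_cast hq
  have h1 := one_le_log hq
  have h2 := one_le_log_abs_add_three t
  have h3 : Real.log (|t| + 2) ≤ Real.log (|t| + 3) := Real.log_le_log (by positivity) (by linarith)
  rw [Real.log_mul (by positivity) (by positivity)]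
  nlinarith

theorem LFunction_ne_zero_of_sq_ne_one' {q : ℕ} [NeZero q] {χ : DirichletCharacter ℂ q}
    (hq : 3 ≤ q) (hχ : χ ^ 2 ≠ 1) {s : ℂ}
    (hs : 1 - 1 / (2 * 10 ^ 9 * Real.log q) / Real.log (|s.im| + 3) ≤ s.re) :
    χ.LFunction s ≠ 0 := by
  refine LFunction_ne_zero_of_sq_ne_one hq hχ (le_trans ?_ hs)
  have h1 := one_le_log hq
  have h2 := one_le_log_abs_add_three s.im
  have h3 := log_mul_le_two_mul_log_mul_log hq s.im
  have hq' : (3 : ℝ) ≤ q := by exact_mod_cast hq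
  have h4 : 0 < Real.log (q * (|s.im| + 2)) := Real.log_pos (by nlinarith [abs_nonneg s.im])
  rw [div_div, sub_le_sub_iff_left]
  apply one_div_le_one_div_of_le (by positivity)
  nlinarith

theorem LFunction_ne_zero_of_sq_eq_one' {q : ℕ} [NeZero q] {χ : DirichletCharacter ℂ q}
    (hq : 3 ≤ q) (hχ1 : χ ≠ 1) (hχ : χ ^ 2 = 1) {s : ℂ}
    (hs : 1 - 1 / (10 ^ 10 * (Real.sqrt q * Real.log q ^ 2)) / Real.log (|s.im| + 3) ≤ s.re) :
    χ.LFunction s ≠ 0 := by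
  rcases le_or_gt 1 s.re with h1re | h1re
  · exact LFunction_ne_zero_of_one_le_re χ (Or.inl hχ1) h1re
  have h1 := one_le_log hq
  have h2 := one_le_log_abs_add_three s.im
  have h3 := log_mul_le_two_mul_log_mul_log hq s.im
  have hq' : (3 : ℝ) ≤ q := by exact_mod_cast hq
  have hsq : 1 ≤ Real.sqrt q := by rw [Real.one_le_sqrt]; linarith
  have h4 : 0 < Real.log (q * (|s.im| + 2)) := Real.log_pos (by nlinarith [abs_nonneg s.im])
  set D := Real.sqrt q * Real.log q ^ 2 with hD
  have hDl : Real.log q ≤ D := by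
    rw [hD]
    nlinarith [mul_le_mul hsq (by nlinarith : Real.log q ≤ Real.log q ^ 2) (by linarith)
      (by positivity)]
  have hD1 : 1 ≤ D := h1.trans hDl
  have hw : 1 / (10 ^ 10 * D) / Real.log (|s.im| + 3) ≤ 1 / (10 ^ 10 * D) :=
    div_le_self (by positivity) h2
  have hw2 : 1 / (10 ^ 10 * D) ≤ 1 / (30000 * D) / 1000 := by
    rw [div_div]
    apply one_div_le_one_div_of_le (by positivity)
    nlinarith
  rcases le_or_gt (1 / (30000 * D) / 2) |s.im| with him | him
  · have h0 : 0 < 1 / (30000 * D) := by positivity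
    refine LFunction_ne_zero_of_sq_eq_one hq hχ1 hχ ?_ (le_trans ?_ hs) ?_
    · rw [← abs_pos]; linarith
    · rw [div_div, sub_le_sub_iff_left]
      apply one_div_le_one_div_of_le (by positivity)
      have : Real.log q * Real.log (|s.im| + 3) ≤ D * Real.log (|s.im| + 3) := by gcongr
      nlinarith
    · linarith
  · apply LFunction_ne_zero_of_norm_sub_one_le hq hχ1 hχ
    have := Complex.norm_le_abs_re_add_abs_im (s - 1)
    have h5 : |(s - 1).re| ≤ 1 / (10 ^ 10 * D) := by
      rw [abs_le]
      simp only [sub_re, one_re]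
      have : 0 < 1 / (10 ^ 10 * D) := by positivity
      constructor <;> linarith
    have h6 : (s - 1).im = s.im := by simp
    rw [h6] at this
    have h0 : 0 < 1 / (30000 * D) := by positivity
    linarith

end DirichletCharacter

end

section

open Complex

/-- The region to the right of the curve `σ = 1 - a / log (|τ| + 3)`. -/
def logRegion (a : ℝ) : Set ℂ := {s : ℂ | 1 - a / Real.log (|s.im| + 3) < s.re}

theorem isOpen_logRegion (a : ℝ) : IsOpen (logRegion a) := by
  refine isOpen_lt ?_ continuous_re
  refine continuous_const.sub (continuous_const.div ?_ fun s => ?_)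
  · refine Continuous.log (by fun_prop) fun s => ?_
    positivity
  · linarith [DirichletCharacter.one_le_log_abs_add_three s.im]

theorem starConvex_logRegion {a : ℝ} (ha : 0 ≤ a) : StarConvex ℝ 2 (logRegion a) := by
  intro s hs w v hw hv hwv
  have hs' : 1 - a / Real.log (|s.im| + 3) < s.re := hs
  show 1 - a / Real.log (|(w • (2 : ℂ) + v • s).im| + 3) < (w • (2 : ℂ) + v • s).re
  have him : (w • (2 : ℂ) + v • s).im = v * s.im := by simp
  have hre : (w • (2 : ℂ) + v • s).re = 2 * w + v * s.re := by simp; ring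
  have h1 := DirichletCharacter.one_le_log_abs_add_three s.im
  have h2 := DirichletCharacter.one_le_log_abs_add_three (v * s.im)
  rw [him, hre]
  have hle : Real.log (|v * s.im| + 3) ≤ Real.log (|s.im| + 3) := by
    apply Real.log_le_log (by positivity)
    rw [abs_mul, abs_of_nonneg hv]
    nlinarith [abs_nonneg s.im]
  have h3 : a / Real.log (|s.im| + 3) ≤ a / Real.log (|v * s.im| + 3) := by gcongr
  have h4 : 0 ≤ a / Real.log (|s.im| + 3) := by positivity
  rcases hv.eq_or_lt with rfl | hv0
  · have : w = 1 := by linarith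
    subst this
    linarith
  · nlinarith [mul_lt_mul_of_pos_left hs' hv0]

theorem mem_logRegion_of_one_lt_re {a : ℝ} (ha : 0 ≤ a) {s : ℂ} (hs : 1 < s.re) :
    s ∈ logRegion a := by
  show 1 - a / Real.log (|s.im| + 3) < s.re
  have h1 := DirichletCharacter.one_le_log_abs_add_three s.im
  have h4 : 0 ≤ a / Real.log (|s.im| + 3) := by positivity
  linarith

theorem isSimplyConnected_logRegion {a : ℝ} (ha : 0 ≤ a) : IsSimplyConnected (logRegion a) := by
  have : ContractibleSpace (logRegion a) :=
    (starConvex_logRegion ha).contractibleSpace ⟨2, mem_logRegion_of_one_lt_re ha (by simp)⟩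
  exact SimplyConnectedSpace.ofContractible _

theorem Complex.differentiableAt_of_exp_eq {f g : ℂ → ℂ} {z : ℂ} (hf : ContinuousAt f z)
    (hg : DifferentiableAt ℂ g z) (h : ∀ᶠ w in nhds z, exp (f w) = g w) :
    DifferentiableAt ℂ f z := by
  have hz : exp (f z) = g z := h.self_of_nhds
  have hgz : g z ≠ 0 := hz ▸ exp_ne_zero _
  have hev : ∀ᶠ w in nhds z, ‖f w - f z‖ < 1 := by
    have := (hf.sub (continuousAt_const (y := f z))).norm
    exact this.eventually_lt continuousAt_const (by simp)
  have heq : f =ᶠ[nhds z] fun w => log (g w / g z) + f z := by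
    filter_upwards [h, hev] with w hw hw1
    rw [← hw, ← hz, ← exp_sub, log_exp]
    · ring
    · have := (abs_le.1 ((abs_im_le_norm (f w - f z)).trans hw1.le)).1
      linarith [Real.pi_gt_three]
    · have := (abs_le.1 ((abs_im_le_norm (f w - f z)).trans hw1.le)).2
      linarith [Real.pi_gt_three]
  refine DifferentiableAt.congr_of_eventuallyEq ?_ heq
  refine DifferentiableAt.add_const _ (DifferentiableAt.clog (hg.div_const _) ?_)
  rw [div_self hgz]
  exact one_mem_slitPlane

namespace DirichletCharacter

/-- The logarithm of the Euler product of a Dirichlet character. -/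
noncomputable def eulerLog {q : ℕ} (χ : DirichletCharacter ℂ q) (s : ℂ) : ℂ :=
  ∑' p : Nat.Primes, -log (1 - χ (p : ℕ) * ((p : ℕ) : ℂ) ^ (-s))

theorem norm_mul_vonMangoldt_div_log_le {q : ℕ} (χ : DirichletCharacter ℂ q) (n : ℕ) :
    ‖χ n * ArithmeticFunction.vonMangoldt n / Real.log n‖ ≤
      ArithmeticFunction.vonMangoldt n / Real.log n := by
  rw [norm_div, norm_mul, norm_real, norm_real, Real.norm_eq_abs, Real.norm_eq_abs,
    abs_of_nonneg ArithmeticFunction.vonMangoldt_nonneg, abs_of_nonneg (Real.log_natCast_nonneg n)]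
  gcongr
  exact mul_le_of_le_one_left ArithmeticFunction.vonMangoldt_nonneg (χ.norm_le_one n)

theorem vonMangoldt_div_log_le_one (n : ℕ) :
    ArithmeticFunction.vonMangoldt n / Real.log n ≤ 1 :=
  div_le_one_of_le₀ ArithmeticFunction.vonMangoldt_le_log (Real.log_natCast_nonneg n)

theorem differentiableOn_eulerLog {q : ℕ} (χ : DirichletCharacter ℂ q) :
    DifferentiableOn ℂ χ.eulerLog {s | 1 < s.re} := by
  have h1 : LSeries.abscissaOfAbsConv
      (fun n ↦ χ n * ArithmeticFunction.vonMangoldt n / Real.log n) ≤ 1 :=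
    LSeries.abscissaOfAbsConv_le_of_le_const ⟨1, fun n _ =>
      (χ.norm_mul_vonMangoldt_div_log_le n).trans (vonMangoldt_div_log_le_one n)⟩
  refine ((LSeries_differentiableOn _).mono fun s hs => ?_).congr fun s hs =>
    χ.eulerProduct_log_eq_LSeries hs
  have hs' : 1 < s.re := hs
  exact h1.trans_lt (by exact_mod_cast hs')

theorem norm_eulerLog_le {q : ℕ} (χ : DirichletCharacter ℂ q) {s : ℂ} (hs : 1 < s.re) :
    ‖χ.eulerLog s‖ ≤ Real.log (1 + 1 / (s.re - 1)) := by
  have hsum : Summable fun n : ℕ => ArithmeticFunction.vonMangoldt n /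
      ((n : ℝ) ^ s.re * Real.log n) := by
    refine Summable.of_nonneg_of_le (fun n => ?_) (fun n => ?_)
      (Real.summable_nat_rpow_inv.2 hs)
    · have := Real.log_natCast_nonneg n
      have : 0 ≤ ArithmeticFunction.vonMangoldt n := ArithmeticFunction.vonMangoldt_nonneg
      positivity
    · rw [mul_comm, ← div_div, div_eq_mul_inv]
      exact mul_le_of_le_one_left (by positivity) (vonMangoldt_div_log_le_one n)
  have h1 : ‖χ.eulerLog s‖ ≤ Real.log (riemannZeta (s.re : ℂ)).re := by
    rw [log_riemannZeta_eq hs, eulerLog, χ.eulerProduct_log_eq_LSeries hs]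
    refine tsum_of_norm_bounded hsum.hasSum fun n => ?_
    rcases eq_or_ne n 0 with rfl | hn
    · simp
    · rw [LSeries.term_of_ne_zero hn, norm_div, mul_comm ((n : ℝ) ^ s.re), ← div_div,
        Complex.norm_natCast_cpow_of_pos (Nat.pos_of_ne_zero hn)]
      gcongr
      exact χ.norm_mul_vonMangoldt_div_log_le n
  refine h1.trans ?_
  have h2 : ‖riemannZeta (s.re : ℂ)‖ ≤ 1 + 1 / (s.re - 1) := by
    rw [← LSeries_one_eq_riemannZeta (by simpa using hs)]
    have := norm_LSeries_le (f := 1) (s := (s.re : ℂ)) (by simp) (by simpa using hs)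
    simpa using this
  have hs1 := sub_pos.2 hs
  rcases le_or_gt (riemannZeta (s.re : ℂ)).re 0 with h0 | h0
  · have : Real.log (riemannZeta (s.re : ℂ)).re = Real.log |(riemannZeta (s.re : ℂ)).re| := by
      simp
    rw [this]
    rcases eq_or_ne (riemannZeta (s.re : ℂ)).re 0 with h00 | h00
    · rw [h00, abs_zero, Real.log_zero]
      exact Real.log_nonneg (by simp; linarith)
    · exact Real.log_le_log (abs_pos.2 h00) ((abs_re_le_norm _).trans h2)
  · exact Real.log_le_log h0 ((re_le_norm _).trans h2)

theorem exists_log_LFunction {q : ℕ} [NeZero q] {χ : DirichletCharacter ℂ q} (hχ : χ ≠ 1) {a : ℝ}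
    (ha : 0 ≤ a) (hU : ∀ s ∈ logRegion a, χ.LFunction s ≠ 0) :
    ∃ ℓ : ℂ → ℂ, DifferentiableOn ℂ ℓ (logRegion a) ∧
      (∀ s ∈ logRegion a, exp (ℓ s) = χ.LFunction s) ∧
      ∀ s : ℂ, 1 < s.re → ℓ s = χ.eulerLog s := by
  obtain ⟨f, hfc, hfe⟩ := Complex.exists_continuousOn_eqOn_exp_comp
    (isSimplyConnected_logRegion ha) (isOpen_logRegion a)
    (differentiable_LFunction hχ).continuous.continuousOn
    (by rintro ⟨s, hs, h0⟩; exact hU s hs h0)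
  have hfd : DifferentiableOn ℂ f (logRegion a) := fun s hs => by
    refine (Complex.differentiableAt_of_exp_eq
      (hfc.continuousAt ((isOpen_logRegion a).mem_nhds hs))
      (differentiable_LFunction hχ s) ?_).differentiableWithinAt
    filter_upwards [(isOpen_logRegion a).mem_nhds hs] with w hw using hfe hw
  have hopen : IsOpen {s : ℂ | 1 < s.re} := isOpen_lt continuous_const continuous_re
  have hconn : IsPreconnected {s : ℂ | 1 < s.re} := (convex_halfSpace_re_gt 1).isPreconnected
  have hsub : {s : ℂ | 1 < s.re} ⊆ logRegion a := fun s hs => mem_logRegion_of_one_lt_re ha hs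
  have hd : DifferentiableOn ℂ (fun s => f s - χ.eulerLog s) {s : ℂ | 1 < s.re} :=
    (hfd.mono hsub).sub χ.differentiableOn_eulerLog
  have hexp : ∀ s : ℂ, 1 < s.re → exp (f s - χ.eulerLog s) = 1 := by
    intro s hs
    have h1 : exp (f s) = χ.LFunction s := hfe (hsub hs)
    have h2 : exp (χ.eulerLog s) = χ.LFunction s := by
      rw [LFunction_eq_LSeries χ hs, ← χ.LSeries_eulerProduct_exp_log hs, eulerLog]
    rw [exp_sub, h1, h2, div_self (hU s (hsub hs))]
  obtain ⟨k, hk⟩ := hopen.exists_is_const_of_deriv_eq_zero hconn hd (by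
    intro s hs
    have hds := (hd s hs).differentiableAt (hopen.mem_nhds hs)
    have h1 := hds.hasDerivAt.cexp
    have h2 : HasDerivAt (fun w => exp (f w - χ.eulerLog w)) 0 s := by
      refine (hasDerivAt_const s (1 : ℂ)).congr_of_eventuallyEq ?_
      filter_upwards [hopen.mem_nhds hs] with w hw using hexp w hw
    have h3 := h1.unique h2
    rw [hexp s hs, one_mul] at h3
    exact h3)
  refine ⟨fun s => f s - k, hfd.sub_const k, fun s hs => ?_, fun s hs => ?_⟩
  · have hk1 : exp k = 1 := by
      rw [← hk 2 (by simp)]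
      exact hexp 2 (by simp)
    show exp (f s - k) = _
    rw [exp_sub, hk1, div_one]
    exact hfe hs
  · show f s - k = _
    rw [← hk s hs]
    ring

end DirichletCharacter

end

section

open Complex

theorem log_abs_add_four_le (t : ℝ) : Real.log (|t| + 4) ≤ 2 * Real.log (|t| + 3) := by
  rw [show 2 * Real.log (|t| + 3) = Real.log ((|t| + 3) ^ 2) by rw [Real.log_pow]; norm_num]
  apply Real.log_le_log (by positivity)
  nlinarith [abs_nonneg t]

namespace DirichletCharacter

variable {q : ℕ} [NeZero q] {χ : DirichletCharacter ℂ q}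

theorem norm_LFunction_le_of_near_line (hq : 3 ≤ q) (hχ : χ ≠ 1) {a : ℝ}
    (ha : 0 < a) (haq : a ≤ 1 / (10 * Real.log q)) {t : ℝ} {z : ℂ}
    (hz : ‖z‖ ≤ |t| + 3) (hre : 1 - a / (2 * Real.log (|t| + 3)) ≤ z.re) :
    ‖χ.LFunction z‖ ≤ 20 * (Real.log (|t| + 3) / a) := by
  have hl := one_le_log hq
  have hT := one_le_log_abs_add_three t
  have hl8 := log_eight_mul_le hq
  have hq' : (3 : ℝ) ≤ q := by exact_mod_cast hq
  set T := Real.log (|t| + 3) with hTdef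
  have hal : 10 * a * Real.log q ≤ 1 := by
    rw [le_div_iff₀ (by positivity)] at haq
    linarith
  have hlogx : Real.log (8 * q * (|t| + 3)) ≤ 4 * (Real.log q * T) := by
    rw [Real.log_mul (by positivity) (by positivity)]
    nlinarith
  have hlx0 : 0 < Real.log (8 * q * (|t| + 3)) := Real.log_pos (by nlinarith [abs_nonneg t])
  have h1 : Real.log (8 * q * (|t| + 3)) * a ≤ T := by
    nlinarith [mul_le_mul_of_nonneg_right hlogx ha.le, mul_le_mul_of_nonneg_right hal (by linarith : 0 ≤ T)]
  have h2 : Real.log (8 * q * (|t| + 3)) ≤ T / a := by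
    rw [le_div_iff₀ ha]; exact h1
  refine (norm_LFunction_le_log hχ (x := 8 * q * (|t| + 3)) ?_ ?_ ?_).trans (by gcongr)
  · nlinarith [abs_nonneg t]
  · calc (q : ℝ) * ‖z‖ ≤ q * (|t| + 3) := by gcongr
      _ ≤ _ := by nlinarith [abs_nonneg t]
  · refine le_trans ?_ hre
    rw [sub_le_sub_iff_left, div_le_div_iff₀ (by positivity) hlx0]
    linarith

theorem norm_log_LFunction_le (hq : 3 ≤ q) (hχ : χ ≠ 1) {a : ℝ} (ha : 0 < a)
    (haq : a ≤ 1 / (10 * Real.log q)) {ℓ : ℂ → ℂ} (hd : DifferentiableOn ℂ ℓ (logRegion a))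
    (hexp : ∀ s ∈ logRegion a, exp (ℓ s) = χ.LFunction s)
    (heu : ∀ s : ℂ, 1 < s.re → ℓ s = χ.eulerLog s) {s : ℂ}
    (hs : 1 - a / (8 * Real.log (|s.im| + 3)) ≤ s.re) :
    ‖ℓ s‖ ≤ 13 * Real.log (100 * (Real.log (|s.im| + 3) / a)) := by
  have hl := one_le_log hq
  have hT := one_le_log_abs_add_three s.im
  have hT4 := log_abs_add_four_le s.im
  have hT34 : Real.log (|s.im| + 3) ≤ Real.log (|s.im| + 4) :=
    Real.log_le_log (by positivity) (by linarith)
  set T := Real.log (|s.im| + 3) with hTdef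
  set T' := Real.log (|s.im| + 4) with hT'def
  have ha1 : a ≤ 1 / 10 := haq.trans (by gcongr; linarith)
  set W := a / T' with hW
  have hT'0 : 0 < T' := by linarith
  have hW0 : 0 < W := by positivity
  have hWle : W ≤ a / T := by rw [hW]; gcongr
  have hWge : a / (2 * T) ≤ W := by rw [hW]; gcongr
  have haT : a / T ≤ 1 / 10 := (div_le_self ha.le hT).trans ha1
  have hTa : 10 ≤ T / a := by rw [le_div_iff₀ ha]; linarith
  have hW2 : 2 / W ≤ 4 * (T / a) := by
    rw [hW]
    rw [div_div_eq_mul_div, ← mul_div_assoc]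
    exact div_le_div_of_nonneg_right (by linarith) ha.le
  have hline : ∀ z : ℂ, 1 + W / 2 ≤ z.re → ‖ℓ z‖ ≤ Real.log (100 * (T / a)) := by
    intro z hz
    rw [heu z (by linarith)]
    refine (χ.norm_eulerLog_le (by linarith)).trans ?_
    have h0 : 0 < 1 / (z.re - 1) := one_div_pos.2 (by linarith)
    apply Real.log_le_log (by linarith)
    have : 1 / (z.re - 1) ≤ 1 / (W / 2) := by
      apply one_div_le_one_div_of_le (by positivity); linarith
    rw [one_div_div] at this
    linarith
  have hΛ : 0 ≤ Real.log (100 * (T / a)) := Real.log_nonneg (by linarith)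
  rcases le_or_gt (1 + W / 2) s.re with hcase | hcase
  · linarith [hline s hcase]
  set s₀ : ℂ := ⟨1 + W / 2, s.im⟩ with hs₀
  have hball : ∀ z ∈ Metric.ball (0 : ℂ) W, s₀ + z ∈ logRegion a ∧
      ‖χ.LFunction (s₀ + z)‖ ≤ 20 * (T / a) := by
    intro z hz
    rw [mem_ball_zero_iff] at hz
    have hre := (abs_le.1 ((abs_re_le_norm z).trans hz.le)).1
    have hre' := (abs_le.1 ((abs_re_le_norm z).trans hz.le)).2
    have him := (abs_im_le_norm z).trans hz.le
    have hsre : (s₀ + z).re = 1 + W / 2 + z.re := by simp [hs₀]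
    have hsim : (s₀ + z).im = s.im + z.im := by simp [hs₀]
    have himle : |(s₀ + z).im| ≤ |s.im| + 1 / 10 := by
      rw [hsim]
      refine (abs_add_le _ _).trans ?_
      linarith
    constructor
    · show 1 - a / Real.log (|(s₀ + z).im| + 3) < (s₀ + z).re
      have h1 : W ≤ a / Real.log (|(s₀ + z).im| + 3) := by
        have := one_le_log_abs_add_three (s₀ + z).im
        rw [hW]
        gcongr a / ?_
        apply Real.log_le_log (by positivity)
        linarith
      rw [hsre]
      linarith
    · refine norm_LFunction_le_of_near_line hq hχ ha haq ?_ ?_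
      · refine (norm_le_abs_re_add_abs_im _).trans ?_
        have : |(s₀ + z).re| ≤ 2 := by
          rw [hsre, abs_le]; constructor <;> linarith
        linarith
      · rw [hsre]
        have : a / (2 * T) = a / T / 2 := by ring
        linarith
  have hM : 0 < Real.log (20 * (T / a)) := Real.log_pos (by linarith)
  have hz₀ : ‖s - s₀‖ ≤ 3 / 4 * W := by
    have h1 : s - s₀ = ((s.re - (1 + W / 2) : ℝ) : ℂ) := by
      apply Complex.ext <;> simp [hs₀]
    rw [h1, norm_real, Real.norm_eq_abs, abs_le]
    have : a / (8 * T) = a / (2 * T) / 4 := by ring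
    constructor <;> linarith
  have hBC := Complex.borelCaratheodory (f := fun z => ℓ (s₀ + z)) (z := s - s₀) hM
    (R := W) ?_ ?_ hW0 ?_
  · simp only [add_zero, add_sub_cancel] at hBC
    refine hBC.trans ?_
    have h0 : ‖ℓ s₀‖ ≤ Real.log (100 * (T / a)) := hline s₀ le_rfl
    have hMle : Real.log (20 * (T / a)) ≤ Real.log (100 * (T / a)) :=
      Real.log_le_log (by linarith) (by linarith)
    have hden : 1 / 4 * W ≤ W - ‖s - s₀‖ := by linarith
    have hden0 : 0 < W - ‖s - s₀‖ := by linarith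
    have e1 : 2 * Real.log (20 * (T / a)) * ‖s - s₀‖ / (W - ‖s - s₀‖) ≤
        6 * Real.log (100 * (T / a)) := by
      rw [div_le_iff₀ hden0]
      have : Real.log (20 * (T / a)) * ‖s - s₀‖ ≤
          Real.log (100 * (T / a)) * (3 * (W - ‖s - s₀‖)) := by
        apply mul_le_mul hMle (by linarith) (norm_nonneg _) hΛ
      linarith
    have e2 : ‖ℓ s₀‖ * (W + ‖s - s₀‖) / (W - ‖s - s₀‖) ≤ 7 * Real.log (100 * (T / a)) := by
      rw [div_le_iff₀ hden0]
      have : ‖ℓ s₀‖ * (W + ‖s - s₀‖) ≤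
          Real.log (100 * (T / a)) * (7 * (W - ‖s - s₀‖)) := by
        apply mul_le_mul h0 (by linarith) (by positivity) hΛ
      linarith
    linarith
  · refine hd.comp (by fun_prop) fun z hz => (hball z hz).1
  · intro z hz
    show (ℓ (s₀ + z)).re ≤ _
    obtain ⟨h1, h2⟩ := hball z hz
    rw [Real.le_log_iff_exp_le (by linarith), ← norm_exp, hexp _ h1]
    exact h2
  · rw [mem_ball_zero_iff]; linarith

end DirichletCharacter

end

section

theorem Nat.card_divisors_le_two_mul_sqrt {n : ℕ} (hn : n ≠ 0) :
    n.divisors.card ≤ 2 * n.sqrt := by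
  have hsub : n.divisors ⊆ Finset.Icc 1 n.sqrt ∪ (Finset.Icc 1 n.sqrt).image (n / ·) := by
    intro d hd
    have hdn := Nat.dvd_of_mem_divisors hd
    have hd0 := Nat.pos_of_mem_divisors hd
    rw [Finset.mem_union]
    rcases le_or_gt d n.sqrt with h | h
    · exact Or.inl (Finset.mem_Icc.2 ⟨hd0, h⟩)
    · refine Or.inr (Finset.mem_image.2 ⟨n / d, Finset.mem_Icc.2 ⟨?_, ?_⟩, ?_⟩)
      · exact Nat.div_pos (Nat.le_of_dvd (Nat.pos_of_ne_zero hn) hdn) hd0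
      · rw [Nat.sqrt_lt] at h
        rw [Nat.le_sqrt]
        by_contra! hcon
        obtain ⟨k, hk⟩ := hdn
        have hk' : n / d = k := by rw [hk]; exact Nat.mul_div_cancel_left k hd0
        rw [hk'] at hcon
        nlinarith [Nat.mul_self_le_mul_self_iff.2 (le_refl d), mul_pos hd0 hd0]
      · exact Nat.div_div_self hdn hn
  refine (Finset.card_le_card hsub).trans ((Finset.card_union_le _ _).trans ?_)
  have h1 : (Finset.Icc 1 n.sqrt).card = n.sqrt := by simp
  have h2 : ((Finset.Icc 1 n.sqrt).image (n / ·)).card ≤ n.sqrt :=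
    Finset.card_image_le.trans h1.le
  omega

theorem ZMod.card_sq_eq_one_le {q : ℕ} [NeZero q] :
    (Finset.univ.filter fun x : ZMod q => x ^ 2 = 1).card ≤ 4 * q.sqrt := by
  have hq0 : q ≠ 0 := NeZero.ne q
  have hcard : (Finset.univ.filter fun x : ZMod q => x ^ 2 = 1).card ≤
      (q.divisors ×ˢ (Finset.univ : Finset Bool)).card := by
    apply Finset.card_le_card_of_injOn
      (fun x : ZMod q => (Int.gcd ((x.val : ℤ) - 1) q, decide (2 * x.val < q)))
    · intro x _
      refine Finset.mem_coe.2 (Finset.mem_product.2 ⟨?_, Finset.mem_univ _⟩)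
      rw [Nat.mem_divisors]
      refine ⟨?_, hq0⟩
      have := Int.gcd_dvd_right ((x.val : ℤ) - 1) q
      exact_mod_cast this
    · have key : ∀ x : ZMod q, x ^ 2 = 1 →
          (q : ℤ) ∣ (Int.gcd ((x.val : ℤ) - 1) q : ℤ) * ((x.val : ℤ) + 1) := by
        intro x hx
        have h1 : (q : ℤ) ∣ ((x.val : ℤ) - 1) * ((x.val : ℤ) + 1) := by
          rw [← ZMod.intCast_zmod_eq_zero_iff_dvd]
          push_cast
          rw [ZMod.natCast_zmod_val]
          linear_combination hx
        rw [Int.gcd_eq_gcd_ab]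
        rw [show (((x.val : ℤ) - 1) * Int.gcdA ((x.val : ℤ) - 1) q +
            q * Int.gcdB ((x.val : ℤ) - 1) q) * ((x.val : ℤ) + 1) =
          ((x.val : ℤ) - 1) * ((x.val : ℤ) + 1) * Int.gcdA ((x.val : ℤ) - 1) q +
            q * (Int.gcdB ((x.val : ℤ) - 1) q * ((x.val : ℤ) + 1)) by ring]
        exact dvd_add (h1.mul_right _) (dvd_mul_right _ _)
      intro x hx y hy hxy
      have hx2 : x ^ 2 = 1 := (Finset.mem_filter.1 (Finset.mem_coe.1 hx)).2
      have hy2 : y ^ 2 = 1 := (Finset.mem_filter.1 (Finset.mem_coe.1 hy)).2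
      obtain ⟨hd, hb⟩ := Prod.mk.inj hxy
      have kx := key x hx2
      have ky := key y hy2
      rw [← hd] at ky
      have dx : (Int.gcd ((x.val : ℤ) - 1) q : ℤ) ∣ (x.val : ℤ) - 1 := Int.gcd_dvd_left _ _
      have dy : (Int.gcd ((x.val : ℤ) - 1) q : ℤ) ∣ (y.val : ℤ) - 1 := by
        rw [hd]; exact Int.gcd_dvd_left _ _
      generalize (Int.gcd ((x.val : ℤ) - 1) q : ℤ) = d at kx ky dx dy
      have hxlt : (x.val : ℤ) < q := by exact_mod_cast x.val_lt
      have hylt : (y.val : ℤ) < q := by exact_mod_cast y.val_lt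
      have e1 : (q : ℤ) ∣ ((x.val : ℤ) - 1) * ((x.val : ℤ) - y.val) := by
        refine dvd_trans ?_ (mul_dvd_mul_right dx _)
        have := dvd_sub kx ky
        rwa [← mul_sub, add_sub_add_right_eq_sub] at this
      have e2 : (q : ℤ) ∣ ((x.val : ℤ) + 1) * ((x.val : ℤ) - y.val) := by
        have : d ∣ (x.val : ℤ) - y.val := by
          have := dvd_sub dx dy
          rwa [sub_sub_sub_cancel_right] at this
        rw [mul_comm]
        exact kx.trans (mul_dvd_mul_right this _)
      have e3 : (q : ℤ) ∣ 2 * ((x.val : ℤ) - y.val) := by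
        have := dvd_sub e2 e1
        rwa [show ((x.val : ℤ) + 1) * ((x.val : ℤ) - y.val) -
          ((x.val : ℤ) - 1) * ((x.val : ℤ) - y.val) = 2 * ((x.val : ℤ) - y.val) by ring] at this
      have hb' : 2 * x.val < q ↔ 2 * y.val < q := by simpa using hb
      apply ZMod.val_injective
      have e4 : 2 * ((x.val : ℤ) - y.val) = 0 := by
        apply Int.eq_zero_of_abs_lt_dvd e3
        rw [abs_lt]
        by_cases h : 2 * x.val < q
        · have h' := hb'.1 h
          constructor <;> omega
        · have h' : ¬ 2 * y.val < q := fun h2 => h (hb'.2 h2)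
          constructor <;> omega
      omega
  refine hcard.trans ?_
  rw [Finset.card_product, Finset.card_univ, Fintype.card_bool]
  have := Nat.card_divisors_le_two_mul_sqrt hq0
  omega

theorem DirichletCharacter.card_sq_eq_one_le {q : ℕ} [NeZero q] :
    (Finset.univ.filter fun χ : DirichletCharacter ℂ q => χ ^ 2 = 1).card ≤ 4 * q.sqrt := by
  obtain ⟨e⟩ := DirichletCharacter.mulEquiv_units ℂ q
  refine le_trans ?_ (ZMod.card_sq_eq_one_le (q := q))
  apply Finset.card_le_card_of_injOn (fun χ => ((e χ : (ZMod q)ˣ) : ZMod q))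
  · intro χ hχ
    have h2 : χ ^ 2 = 1 := (Finset.mem_filter.1 (Finset.mem_coe.1 hχ)).2
    refine Finset.mem_coe.2 (Finset.mem_filter.2 ⟨Finset.mem_univ _, ?_⟩)
    rw [← Units.val_pow_eq_pow_val, ← map_pow, h2, map_one, Units.val_one]
  · intro χ _ ψ _ h
    exact e.injective (Units.ext h)

theorem sum_primeFactors_le {f : ℕ → ℝ} (h2 : f 2 ≤ 1) (h3 : f 3 ≤ 1)
    (h5 : ∀ p : ℕ, 5 ≤ p → f p ≤ Real.log p / 4) {q : ℕ} (hq : q ≠ 0) :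
    ∑ p ∈ q.primeFactors, f p ≤ 2 + Real.log q / 4 := by
  have hle : ∀ p ∈ q.primeFactors,
      f p ≤ Real.log p / 4 + ((if p = 2 then 1 else 0) + (if p = 3 then 1 else 0)) := by
    intro p hp
    have hpp := Nat.prime_of_mem_primeFactors hp
    have hl := Real.log_natCast_nonneg p
    by_cases e2 : p = 2
    · subst e2; norm_num at hl ⊢; linarith
    by_cases e3 : p = 3
    · subst e3; norm_num at hl ⊢; linarith
    have h4 : p ≠ 4 := by rintro rfl; norm_num at hpp
    have := hpp.two_le
    simpa [e2, e3] using h5 p (by omega)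
  refine (Finset.sum_le_sum hle).trans ?_
  rw [Finset.sum_add_distrib, Finset.sum_add_distrib, Finset.sum_ite_eq', Finset.sum_ite_eq',
    ← Finset.sum_div]
  have hlog : ∑ p ∈ q.primeFactors, Real.log p ≤ Real.log q := by
    rw [← Real.log_prod fun p hp => by exact_mod_cast (Nat.prime_of_mem_primeFactors hp).ne_zero]
    have hpos : 0 < ∏ p ∈ q.primeFactors, p :=
      Finset.prod_pos fun p hp => (Nat.prime_of_mem_primeFactors hp).pos
    have hle : ∏ p ∈ q.primeFactors, p ≤ q :=
      Nat.le_of_dvd (Nat.pos_of_ne_zero hq) (Nat.prod_primeFactors_dvd q)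
    rw [← Nat.cast_prod]
    exact Real.log_le_log (by exact_mod_cast hpos) (by exact_mod_cast hle)
  have e2 : (if 2 ∈ q.primeFactors then (1 : ℝ) else 0) ≤ 1 := by split_ifs <;> norm_num
  have e3 : (if 3 ∈ q.primeFactors then (1 : ℝ) else 0) ≤ 1 := by split_ifs <;> norm_num
  linarith

theorem four_thirds_le_log {p : ℕ} (hp : 5 ≤ p) : 4 / 3 ≤ Real.log p := by
  have hp' : (5 : ℝ) ≤ p := by exact_mod_cast hp
  refine le_trans ?_ (Real.log_le_log (by norm_num) hp')
  have : Real.log (Real.exp 4) ≤ Real.log ((5 : ℝ) ^ 3) := by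
    apply Real.log_le_log (Real.exp_pos _)
    rw [show (4 : ℝ) = ((4 : ℕ) : ℝ) * 1 by norm_num, Real.exp_nat_mul]
    calc Real.exp 1 ^ 4 ≤ 3 ^ 4 := by
          gcongr
          linarith [Real.exp_one_lt_d9]
      _ ≤ _ := by norm_num
  rw [Real.log_exp, Real.log_pow] at this
  push_cast at this
  linarith

theorem sum_primeFactors_rpow_le {q : ℕ} (hq : q ≠ 0) :
    ∑ p ∈ q.primeFactors, (p : ℝ) ^ (-(3 / 4) : ℝ) ≤ 2 + Real.log q / 4 := by
  refine sum_primeFactors_le (f := fun p => (p : ℝ) ^ (-(3 / 4) : ℝ)) ?_ ?_ (fun p hp => ?_) hq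
  · exact Real.rpow_le_one_of_one_le_of_nonpos (by norm_num) (by norm_num)
  · exact Real.rpow_le_one_of_one_le_of_nonpos (by norm_num) (by norm_num)
  · have h1 : (p : ℝ) ^ (-(3 / 4) : ℝ) ≤ 1 / 3 := by
      have hp' : (5 : ℝ) ≤ p := by exact_mod_cast hp
      rw [Real.rpow_neg (by positivity), one_div]
      apply inv_anti₀ (by norm_num)
      have h3 : (3 : ℝ) = (81 : ℝ) ^ (1 / 4 : ℝ) := by
        rw [show (81 : ℝ) = 3 ^ (4 : ℝ) by norm_num, ← Real.rpow_mul (by norm_num)]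
        norm_num
      rw [show (3 / 4 : ℝ) = 3 * (1 / 4) by norm_num, Real.rpow_mul (by positivity)]
      refine h3.le.trans ?_
      apply Real.rpow_le_rpow (by norm_num) _ (by norm_num)
      rw [show (3 : ℝ) = ((3 : ℕ) : ℝ) by norm_num, Real.rpow_natCast]
      calc (81 : ℝ) ≤ 5 ^ 3 := by norm_num
        _ ≤ _ := by gcongr
    have := four_thirds_le_log hp
    show (p : ℝ) ^ (-(3 / 4) : ℝ) ≤ _
    linarith

theorem log_le_log_totient_add {q : ℕ} (hq : q ≠ 0) :
    Real.log q ≤ Real.log q.totient + (2 + Real.log q / 4) := by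
  have hb : ∑ p ∈ q.primeFactors, Real.log ((p : ℝ) / (p - 1)) ≤ 2 + Real.log q / 4 := by
    refine sum_primeFactors_le (f := fun p => Real.log ((p : ℝ) / (p - 1))) ?_ ?_
      (fun p hp => ?_) hq
    · norm_num; linarith [Real.log_two_lt_d9]
    · norm_num; linarith [Real.log_le_sub_one_of_pos (show (0 : ℝ) < 3 / 2 by norm_num)]
    · have hp' : (5 : ℝ) ≤ p := by exact_mod_cast hp
      have h1 := Real.log_le_sub_one_of_pos (show 0 < (p : ℝ) / (p - 1) by
        apply div_pos <;> linarith)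
      have h2 : (p : ℝ) / (p - 1) - 1 ≤ 1 / 4 := by
        rw [div_sub_one (by linarith), div_le_div_iff₀ (by linarith) (by norm_num)]
        linarith
      have := four_thirds_le_log hp
      show Real.log ((p : ℝ) / (p - 1)) ≤ _
      linarith
  refine le_trans (le_of_eq ?_) (add_le_add_right hb (Real.log q.totient))
  have hp1 : ∀ p ∈ q.primeFactors, (0 : ℝ) < (p : ℝ) - 1 := by
    intro p hp
    have : (2 : ℝ) ≤ p := by exact_mod_cast (Nat.prime_of_mem_primeFactors hp).two_le
    linarith
  have hp0 : ∀ p ∈ q.primeFactors, (0 : ℝ) < (p : ℝ) := fun p hp => by linarith [hp1 p hp]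
  have hφ : (0 : ℝ) < q.totient := by
    exact_mod_cast Nat.totient_pos.2 (Nat.pos_of_ne_zero hq)
  rw [← Real.log_prod fun p hp => (div_pos (hp0 p hp) (hp1 p hp)).ne', Finset.prod_div_distrib,
    ← Real.log_mul hφ.ne' (div_pos (Finset.prod_pos hp0) (Finset.prod_pos hp1)).ne',
    ← mul_div_assoc]
  congr 1
  rw [eq_div_iff (Finset.prod_pos hp1).ne']
  have := Nat.totient_mul_prod_primeFactors q
  have h := congrArg (Nat.cast : ℕ → ℝ) this
  push_cast at h
  rw [h]
  congr 1
  refine Finset.prod_congr rfl fun p hp => ?_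
  rw [Nat.cast_sub (Nat.prime_of_mem_primeFactors hp).one_le, Nat.cast_one]

theorem DirichletCharacter.log_mul_card_sq_eq_one_le {q : ℕ} [NeZero q] :
    Real.log q * (Finset.univ.filter fun χ : DirichletCharacter ℂ q => χ ^ 2 = 1).card ≤
      144 * q.totient := by
  have hq0 : q ≠ 0 := NeZero.ne q
  have hqpos : (0 : ℝ) < q := by exact_mod_cast NeZero.pos q
  have hφ : (0 : ℝ) < q.totient := by
    exact_mod_cast Nat.totient_pos.2 (Nat.pos_of_ne_zero hq0)
  set L := Real.log q with hL
  have hL0 : 0 ≤ L := Real.log_natCast_nonneg q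
  have hcard : ((Finset.univ.filter fun χ : DirichletCharacter ℂ q => χ ^ 2 = 1).card : ℝ) ≤
      4 * Real.exp (L / 2) := by
    have h1 : ((Finset.univ.filter fun χ : DirichletCharacter ℂ q => χ ^ 2 = 1).card : ℝ) ≤
        ((4 * q.sqrt : ℕ) : ℝ) := by exact_mod_cast DirichletCharacter.card_sq_eq_one_le (q := q)
    refine h1.trans ?_
    push_cast
    have h2 : (q.sqrt : ℝ) ≤ Real.sqrt q := Real.nat_sqrt_le_real_sqrt
    have h3 : Real.sqrt q = Real.exp (L / 2) := by
      rw [Real.exp_half, hL, Real.exp_log hqpos]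
    rw [← h3]
    gcongr
  have hL4 : L ≤ 4 * Real.exp (L / 4) := by linarith [Real.add_one_le_exp (L / 4)]
  have htot : Real.exp (L * (3 / 4)) ≤ 9 * q.totient := by
    have h1 := log_le_log_totient_add hq0
    have h2 : L * (3 / 4) ≤ 2 + Real.log q.totient := by linarith
    refine (Real.exp_le_exp.2 h2).trans ?_
    rw [Real.exp_add, Real.exp_log hφ]
    gcongr
    rw [show (2 : ℝ) = ((2 : ℕ) : ℝ) * 1 by norm_num, Real.exp_nat_mul]
    nlinarith [Real.exp_one_lt_d9, Real.exp_pos 1]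
  calc _ ≤ (4 * Real.exp (L / 4)) * (4 * Real.exp (L / 2)) := by gcongr
    _ = 16 * Real.exp (L * (3 / 4)) := by
      rw [show L * (3 / 4) = L / 4 + L / 2 by ring, Real.exp_add]; ring
    _ ≤ _ := by linarith

end

section

open Finset

namespace DirichletCharacter

variable {q : ℕ}

/-- The coefficient of `χ` in the Fourier expansion of the indicator function of `A`. -/
noncomputable def fourierCoeff (A : Finset (ZMod q)) (χ : DirichletCharacter ℂ q) : ℂ :=
  (∑ a ∈ A, χ⁻¹ a) / q.totient

theorem inv_apply_eq_apply_inv (χ : DirichletCharacter ℂ q) {a : ZMod q} (ha : IsUnit a) :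
    χ⁻¹ a = χ a⁻¹ := by
  have h1 : χ a * χ a⁻¹ = 1 := by
    rw [← map_mul, ZMod.mul_inv_of_unit a ha, map_one]
  rw [MulChar.inv_apply_eq_inv, Ring.inverse_eq_inv', eq_comm]
  exact eq_inv_of_mul_eq_one_right h1

theorem fourierCoeff_one {A : Finset (ZMod q)} (hA : ∀ a ∈ A, IsUnit a) :
    fourierCoeff A (1 : DirichletCharacter ℂ q) = A.card / q.totient := by
  rw [fourierCoeff, inv_one, sum_congr rfl fun a ha => MulChar.one_apply (hA a ha)]
  simp

theorem norm_fourierCoeff_le (A : Finset (ZMod q)) (χ : DirichletCharacter ℂ q) :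
    ‖fourierCoeff A χ‖ ≤ A.card / q.totient := by
  rw [fourierCoeff, norm_div, Complex.norm_natCast]
  gcongr
  refine (norm_sum_le _ _).trans ?_
  refine (sum_le_sum fun a _ => χ⁻¹.norm_le_one a).trans ?_
  simp

variable [NeZero q]

theorem totient_pos_real : (0 : ℝ) < q.totient := by
  exact_mod_cast Nat.totient_pos.2 (NeZero.pos q)

theorem sum_inv_apply_mul_apply {a : ZMod q} (ha : IsUnit a) (b : ZMod q) :
    ∑ χ : DirichletCharacter ℂ q, χ⁻¹ a * χ b = if a = b then (q.totient : ℂ) else 0 := by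
  rw [← sum_char_inv_mul_char_eq ℂ ha b]
  exact sum_congr rfl fun χ _ => by rw [χ.inv_apply_eq_apply_inv ha]

theorem sum_fourierCoeff_mul {A : Finset (ZMod q)} (hA : ∀ a ∈ A, IsUnit a) (b : ZMod q) :
    ∑ χ : DirichletCharacter ℂ q, fourierCoeff A χ * χ b = if b ∈ A then 1 else 0 := by
  have hφ : (q.totient : ℂ) ≠ 0 := by exact_mod_cast (totient_pos_real (q := q)).ne'
  simp only [fourierCoeff, div_mul_eq_mul_div, sum_mul]
  rw [← sum_div, sum_comm, sum_congr rfl fun a ha => sum_inv_apply_mul_apply (hA a ha) b,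
    sum_ite_eq']
  split_ifs <;> simp [hφ]

theorem sum_norm_sq_fourierCoeff {A : Finset (ZMod q)} (hA : ∀ a ∈ A, IsUnit a) :
    ∑ χ : DirichletCharacter ℂ q, ‖fourierCoeff A χ‖ ^ 2 = A.card / q.totient := by
  have hφ : (q.totient : ℂ) ≠ 0 := by exact_mod_cast (totient_pos_real (q := q)).ne'
  have h1 : ∀ χ : DirichletCharacter ℂ q, (((‖fourierCoeff A χ‖ ^ 2 : ℝ)) : ℂ) =
      (∑ b ∈ A, fourierCoeff A χ * χ b) / q.totient := by
    intro χ
    push_cast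
    rw [← Complex.mul_conj', ← mul_sum, mul_div_assoc]
    congr 1
    rw [fourierCoeff, map_div₀, map_sum, Complex.conj_natCast]
    congr 1
    refine sum_congr rfl fun b _ => ?_
    rw [← MulChar.star_apply']
    exact star_star (χ b)
  have h2 : ((∑ χ : DirichletCharacter ℂ q, ‖fourierCoeff A χ‖ ^ 2 : ℝ) : ℂ) =
      ((A.card / q.totient : ℝ) : ℂ) := by
    rw [Complex.ofReal_sum, sum_congr rfl fun χ _ => h1 χ, ← sum_div, sum_comm,
      sum_congr rfl fun b hb => (sum_fourierCoeff_mul hA b).trans (if_pos hb)]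
    simp
  exact_mod_cast h2

theorem card_filter_isUnit : (univ.filter fun a : ZMod q => IsUnit a).card = q.totient := by
  rw [← ZMod.card_units_eq_totient q, ← Finset.card_univ, eq_comm]
  refine Finset.card_bij (fun u _ => (u : ZMod q)) (fun u _ => ?_) (fun u _ v _ h => Units.ext h)
    fun a ha => ?_
  · exact mem_filter.2 ⟨mem_univ _, u.isUnit⟩
  · exact ⟨(mem_filter.1 ha).2.unit, mem_univ _, rfl⟩

theorem fourierCoeff_sdiff {A : Finset (ZMod q)} (hA : ∀ a ∈ A, IsUnit a)
    {χ : DirichletCharacter ℂ q} (hχ : χ ≠ 1) :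
    fourierCoeff ((univ.filter fun a : ZMod q => IsUnit a) \ A) χ = -fourierCoeff A χ := by
  have hsub : A ⊆ univ.filter fun a : ZMod q => IsUnit a := fun a ha =>
    mem_filter.2 ⟨mem_univ _, hA a ha⟩
  have h0 : ∑ a ∈ univ.filter (fun a : ZMod q => IsUnit a), χ⁻¹ a = 0 := by
    rw [← MulChar.sum_eq_zero_of_ne_one (inv_ne_one.2 hχ)]
    exact sum_filter_of_ne fun a _ ha => by
      by_contra h
      exact ha (χ⁻¹.map_nonunit h)
  rw [fourierCoeff, fourierCoeff, ← neg_div, sum_sdiff_eq_sub hsub, h0, zero_sub]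

theorem card_le_totient {A : Finset (ZMod q)} (hA : ∀ a ∈ A, IsUnit a) :
    A.card ≤ q.totient := by
  rw [← card_filter_isUnit]
  exact card_le_card fun a ha => mem_filter.2 ⟨mem_univ _, hA a ha⟩

theorem exists_fourierCoeff_norm_eq {A : Finset (ZMod q)} (hA : ∀ a ∈ A, IsUnit a) :
    ∃ D : Finset (ZMod q), (∀ a ∈ D, IsUnit a) ∧ D.card = min A.card (q.totient - A.card) ∧
      ∀ χ : DirichletCharacter ℂ q, χ ≠ 1 → ‖fourierCoeff A χ‖ = ‖fourierCoeff D χ‖ := by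
  rcases le_total A.card (q.totient - A.card) with h | h
  · exact ⟨A, hA, (min_eq_left h).symm, fun _ _ => rfl⟩
  · refine ⟨(univ.filter fun a : ZMod q => IsUnit a) \ A, fun a ha => ?_, ?_, fun χ hχ => ?_⟩
    · exact (mem_filter.1 (mem_sdiff.1 ha).1).2
    · rw [min_eq_right h, card_sdiff_of_subset, card_filter_isUnit]
      exact fun a ha => mem_filter.2 ⟨mem_univ _, hA a ha⟩
    · rw [fourierCoeff_sdiff hA hχ, norm_neg]

theorem norm_fourierCoeff_le_min {A : Finset (ZMod q)} (hA : ∀ a ∈ A, IsUnit a)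
    {χ : DirichletCharacter ℂ q} (hχ : χ ≠ 1) :
    ‖fourierCoeff A χ‖ ≤ (min A.card (q.totient - A.card) : ℕ) / q.totient := by
  obtain ⟨D, -, hD, h⟩ := exists_fourierCoeff_norm_eq hA
  rw [h χ hχ, ← hD]
  exact norm_fourierCoeff_le D χ

theorem sum_norm_fourierCoeff_le {A : Finset (ZMod q)} (hA : ∀ a ∈ A, IsUnit a) :
    ∑ χ ∈ univ.erase (1 : DirichletCharacter ℂ q), ‖fourierCoeff A χ‖ ≤
      Real.sqrt (min A.card (q.totient - A.card) : ℕ) := by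
  obtain ⟨D, hDu, hD, h⟩ := exists_fourierCoeff_norm_eq hA
  rw [← hD, sum_congr rfl fun χ hχ => h χ (ne_of_mem_erase hχ)]
  refine (sum_le_sum_of_subset_of_nonneg (erase_subset _ _) fun _ _ _ => norm_nonneg _).trans ?_
  apply Real.le_sqrt_of_sq_le
  refine (sq_sum_le_card_mul_sum_sq).trans ?_
  rw [sum_norm_sq_fourierCoeff hDu, card_univ, ← Nat.card_eq_fintype_card,
    card_eq_totient_of_hasEnoughRootsOfUnity, mul_div_cancel₀ _ totient_pos_real.ne']

end DirichletCharacter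

end

section

open Complex

/-- The second order part of the logarithm of the Euler product with coefficients `w`. -/
noncomputable def primeRemainder (w : Nat.Primes → ℂ) (s : ℂ) : ℂ :=
  ∑' p : Nat.Primes, (-log (1 - w p * ((p : ℕ) : ℂ) ^ (-s)) - w p * ((p : ℕ) : ℂ) ^ (-s))

theorem norm_mul_prime_cpow_le {z : ℂ} (hz : ‖z‖ ≤ 1) (p : Nat.Primes) {s : ℂ}
    (hs : 3 / 4 < s.re) : ‖z * ((p : ℕ) : ℂ) ^ (-s)‖ ≤ ((p : ℕ) : ℝ) ^ (-(3 / 4) : ℝ) := by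
  rw [norm_mul, norm_natCast_cpow_of_pos p.2.pos, neg_re]
  refine (mul_le_of_le_one_left (by positivity) hz).trans ?_
  exact Real.rpow_le_rpow_of_exponent_le (by exact_mod_cast p.2.one_lt.le) (by linarith)

theorem prime_rpow_neg_le (p : Nat.Primes) : ((p : ℕ) : ℝ) ^ (-(3 / 4) : ℝ) ≤ 3 / 4 := by
  have h2 : (2 : ℝ) ≤ ((p : ℕ) : ℝ) := by exact_mod_cast p.2.two_le
  have h1 : ((p : ℕ) : ℝ) ^ (-(3 / 4) : ℝ) ≤ (2 : ℝ) ^ (-(3 / 4) : ℝ) :=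
    Real.rpow_le_rpow_of_nonpos (by norm_num) h2 (by norm_num)
  refine h1.trans ?_
  rw [← pow_le_pow_iff_left₀ (by positivity) (by norm_num) (n := 4) (by norm_num),
    ← Real.rpow_natCast, ← Real.rpow_mul (by norm_num)]
  norm_num

theorem norm_mul_prime_cpow_lt_one {z : ℂ} (hz : ‖z‖ ≤ 1) (p : Nat.Primes) {s : ℂ}
    (hs : 3 / 4 < s.re) : ‖z * ((p : ℕ) : ℂ) ^ (-s)‖ < 1 :=
  ((norm_mul_prime_cpow_le hz p hs).trans (prime_rpow_neg_le p)).trans_lt (by norm_num)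

theorem norm_neg_log_one_sub_sub_le {z : ℂ} (hz : ‖z‖ ≤ 3 / 4) :
    ‖-log (1 - z) - z‖ ≤ 2 * ‖z‖ ^ 2 := by
  have h := norm_log_one_add_sub_self_le (z := -z) (by rw [norm_neg]; linarith)
  rw [norm_neg, ← sub_eq_add_neg, sub_neg_eq_add, ← norm_neg,
    neg_add, ← sub_eq_add_neg] at h
  refine h.trans ?_
  have h2 : (1 - ‖z‖)⁻¹ ≤ 4 := by
    rw [inv_le_comm₀ (by linarith) (by norm_num)]
    linarith
  nlinarith [sq_nonneg ‖z‖]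

theorem norm_primeRemainder_term_le {z : ℂ} (hz : ‖z‖ ≤ 1) (p : Nat.Primes) {s : ℂ}
    (hs : 3 / 4 < s.re) :
    ‖-log (1 - z * ((p : ℕ) : ℂ) ^ (-s)) - z * ((p : ℕ) : ℂ) ^ (-s)‖ ≤
      2 * ((p : ℕ) : ℝ) ^ (-(3 / 2) : ℝ) := by
  have h := norm_mul_prime_cpow_le hz p hs
  refine (norm_neg_log_one_sub_sub_le (h.trans (prime_rpow_neg_le p))).trans ?_
  have h3 : ((p : ℕ) : ℝ) ^ (-(3 / 2) : ℝ) = (((p : ℕ) : ℝ) ^ (-(3 / 4) : ℝ)) ^ 2 := by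
    rw [← Real.rpow_natCast, ← Real.rpow_mul (by positivity)]
    norm_num
  rw [h3]
  gcongr

theorem summable_prime_rpow_neg {x : ℝ} (hx : 1 < x) :
    Summable fun p : Nat.Primes => ((p : ℕ) : ℝ) ^ (-x) :=
  Nat.Primes.summable_rpow.2 (by linarith)

/-- A bound for `primeRemainder` in the half plane `3 / 4 < Re s`. -/
noncomputable def primeRemainderBound : ℝ :=
  ∑' p : Nat.Primes, 2 * ((p : ℕ) : ℝ) ^ (-(3 / 2) : ℝ)

theorem primeRemainderBound_nonneg : 0 ≤ primeRemainderBound :=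
  tsum_nonneg fun p => by positivity

variable {w : Nat.Primes → ℂ}

theorem differentiableOn_primeRemainder (hw : ∀ p, ‖w p‖ ≤ 1) :
    DifferentiableOn ℂ (primeRemainder w) {s | 3 / 4 < s.re} := by
  refine differentiableOn_tsum_of_summable_norm
    ((summable_prime_rpow_neg (x := 3 / 2) (by norm_num)).mul_left 2) (fun p => ?_)
    (isOpen_lt continuous_const continuous_re) fun p s hs => norm_primeRemainder_term_le (hw p) p hs
  intro s hs
  have hp : ((p : ℕ) : ℂ) ≠ 0 := by exact_mod_cast p.2.ne_zero
  have hd : DifferentiableAt ℂ (fun s : ℂ => w p * ((p : ℕ) : ℂ) ^ (-s)) s :=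
    (DifferentiableAt.const_cpow (by fun_prop) (Or.inl hp)).const_mul _
  refine DifferentiableAt.differentiableWithinAt
    (((DifferentiableAt.clog ((differentiableAt_const 1).sub hd) ?_).neg).sub hd)
  have h := norm_mul_prime_cpow_lt_one (hw p) p hs
  show 1 - w p * ((p : ℕ) : ℂ) ^ (-s) ∈ slitPlane
  rw [sub_eq_add_neg]
  exact mem_slitPlane_of_norm_lt_one (by rwa [norm_neg])

theorem norm_primeRemainder_le (hw : ∀ p, ‖w p‖ ≤ 1) {s : ℂ} (hs : 3 / 4 < s.re) :
    ‖primeRemainder w s‖ ≤ primeRemainderBound :=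
  tsum_of_norm_bounded
    ((summable_prime_rpow_neg (x := 3 / 2) (by norm_num)).mul_left 2).hasSum
    fun p => norm_primeRemainder_term_le (hw p) p hs

theorem summable_mul_prime_cpow (hw : ∀ p, ‖w p‖ ≤ 1) {s : ℂ} (hs : 1 < s.re) :
    Summable fun p : Nat.Primes => w p * ((p : ℕ) : ℂ) ^ (-s) := by
  refine Summable.of_norm_bounded (summable_prime_rpow_neg hs) fun p => ?_
  rw [norm_mul, norm_natCast_cpow_of_pos p.2.pos, neg_re]
  exact mul_le_of_le_one_left (by positivity) (hw p)

theorem hasSum_neg_log_prime (hw : ∀ p, ‖w p‖ ≤ 1) {s : ℂ} (hs : 1 < s.re) :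
    HasSum (fun p : Nat.Primes => -log (1 - w p * ((p : ℕ) : ℂ) ^ (-s)))
      (primeRemainder w s + ∑' p : Nat.Primes, w p * ((p : ℕ) : ℂ) ^ (-s)) := by
  have h1 : HasSum
      (fun p : Nat.Primes => -log (1 - w p * ((p : ℕ) : ℂ) ^ (-s)) - w p * ((p : ℕ) : ℂ) ^ (-s))
      (primeRemainder w s) := Summable.hasSum <|
    Summable.of_norm_bounded ((summable_prime_rpow_neg (x := 3 / 2) (by norm_num)).mul_left 2)
      fun p => norm_primeRemainder_term_le (hw p) p (by linarith)
  exact (h1.add (summable_mul_prime_cpow hw hs).hasSum).congr_fun fun p => by simp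

theorem tprod_inv_one_sub_eq (hw : ∀ p, ‖w p‖ ≤ 1) {s : ℂ} (hs : 1 < s.re) :
    ∏' p : Nat.Primes, (1 - w p * ((p : ℕ) : ℂ) ^ (-s))⁻¹ =
      exp (primeRemainder w s + ∑' p : Nat.Primes, w p * ((p : ℕ) : ℂ) ^ (-s)) := by
  refine HasProd.tprod_eq ((hasSum_neg_log_prime hw hs).cexp.congr_fun fun p => ?_)
  have h := norm_mul_prime_cpow_lt_one (hw p) p (s := s) (by linarith)
  have h0 : 1 - w p * ((p : ℕ) : ℂ) ^ (-s) ≠ 0 := fun h0 => by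
    rw [← sub_eq_zero.1 h0] at h
    simp at h
  rw [Function.comp_apply, exp_neg, exp_log h0]

end

section

open Complex

namespace DirichletCharacter

variable {q : ℕ}

theorem logZeta_eq {s : ℂ} (hs : 1 < s.re) :
    logZeta s = primeRemainder 1 s + ∑' p : Nat.Primes, ((p : ℕ) : ℂ) ^ (-s) := by
  have hw : ∀ p : Nat.Primes, ‖(1 : Nat.Primes → ℂ) p‖ ≤ 1 := by simp
  have h1 := (hasSum_neg_log_prime hw hs).tsum_eq
  have h2 := eulerProduct_log_eq_LSeries (1 : DirichletCharacter ℂ 1) hs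
  have hone : ∀ n : ZMod 1, (1 : DirichletCharacter ℂ 1) n = 1 := fun n =>
    MulChar.one_apply (isUnit_of_subsingleton n)
  simp only [Pi.one_apply, one_mul, hone] at h1 h2
  rw [← h1, h2, logZeta]
  refine tsum_congr fun n => ?_
  rcases eq_or_ne n 0 with rfl | hn
  · simp
  · rw [LSeries.term_of_ne_zero hn, div_div, mul_comm]

theorem tsum_one_mul_prime_cpow (hq : q ≠ 0) {s : ℂ} (hs : 1 < s.re) :
    ∑' p : Nat.Primes, (1 : DirichletCharacter ℂ q) (p : ℕ) * ((p : ℕ) : ℂ) ^ (-s) =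
      (∑' p : Nat.Primes, ((p : ℕ) : ℂ) ^ (-s)) - ∑ p ∈ q.primeFactors, (p : ℂ) ^ (-s) := by
  have h1 := summable_mul_prime_cpow (w := fun _ => 1) (by simp) hs
  have h2 := summable_mul_prime_cpow
    (w := fun p => (1 : DirichletCharacter ℂ q) (p : ℕ)) (fun p => norm_le_one _ _) hs
  simp only [one_mul] at h1
  rw [eq_sub_iff_add_eq, ← eq_sub_iff_add_eq', ← h1.tsum_sub h2]
  have hterm : ∀ p : Nat.Primes, ((p : ℕ) : ℂ) ^ (-s) -
      (1 : DirichletCharacter ℂ q) (p : ℕ) * ((p : ℕ) : ℂ) ^ (-s) =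
      if (p : ℕ) ∣ q then ((p : ℕ) : ℂ) ^ (-s) else 0 := by
    intro p
    split_ifs with hp
    · rw [MulChar.map_nonunit, zero_mul, sub_zero]
      rw [ZMod.isUnit_iff_coprime]
      exact fun h => (p.2.coprime_iff_not_dvd.1 h) hp
    · rw [MulChar.one_apply, one_mul, sub_self]
      rw [ZMod.isUnit_iff_coprime]
      exact p.2.coprime_iff_not_dvd.2 hp
  let S : Finset Nat.Primes := q.primeFactors.subtype Nat.Prime
  have hS : ∀ p : Nat.Primes, p ∈ S ↔ (p : ℕ) ∣ q := fun p =>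
    Finset.mem_subtype.trans ⟨Nat.dvd_of_mem_primeFactors,
      fun h => Nat.mem_primeFactors.2 ⟨p.2, h, hq⟩⟩
  rw [tsum_congr hterm, tsum_eq_sum (s := S) fun p hp => if_neg fun h => hp ((hS p).2 h),
    Finset.sum_congr rfl fun p hp => if_pos ((hS p).1 hp), eq_comm]
  exact Finset.sum_subtype_of_mem (fun p : ℕ => (p : ℂ) ^ (-s))
    fun p hp => Nat.prime_of_mem_primeFactors hp

variable [NeZero q]

/-- The exponent of the analytic continuation of `GB q A`, in terms of logarithms `ℓ χ` of the
Dirichlet `L`-functions. -/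
noncomputable def exponentGB (A : Finset (ZMod q)) (ℓ : DirichletCharacter ℂ q → ℂ → ℂ) (s : ℂ) :
    ℂ :=
  ∑ χ ∈ Finset.univ.erase (1 : DirichletCharacter ℂ q),
      fourierCoeff A χ * (ℓ χ s - primeRemainder (fun p => χ (p : ℕ)) s) +
    primeRemainder (fun p => if ((p : ℕ) : ZMod q) ∈ A then 1 else 0) s -
    A.card / q.totient * (primeRemainder 1 s + ∑ p ∈ q.primeFactors, (p : ℂ) ^ (-s))

theorem tsum_indicator_mul_prime_cpow {A : Finset (ZMod q)} (hA : ∀ a ∈ A, IsUnit a) {s : ℂ}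
    (hs : 1 < s.re) :
    ∑' p : Nat.Primes, (if ((p : ℕ) : ZMod q) ∈ A then 1 else 0) * ((p : ℕ) : ℂ) ^ (-s) =
      ∑ χ : DirichletCharacter ℂ q, fourierCoeff A χ *
        ∑' p : Nat.Primes, χ (p : ℕ) * ((p : ℕ) : ℂ) ^ (-s) := by
  have h (χ : DirichletCharacter ℂ q) := summable_mul_prime_cpow
    (w := fun p => χ (p : ℕ)) (fun p => norm_le_one _ _) hs
  simp only [← tsum_mul_left]
  rw [← Summable.tsum_finsetSum fun χ _ => (h χ).mul_left _]
  refine tsum_congr fun p => ?_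
  rw [← sum_fourierCoeff_mul hA, Finset.sum_mul]
  exact Finset.sum_congr rfl fun χ _ => mul_assoc _ _ _

theorem exp_exponentGB {A : Finset (ZMod q)} (hA : ∀ a ∈ A, IsUnit a)
    {ℓ : DirichletCharacter ℂ q → ℂ → ℂ} {s : ℂ} (hs : 1 < s.re)
    (hℓ : ∀ χ ≠ 1, ℓ χ s = χ.eulerLog s) : exp (exponentGB A ℓ s) = GB q A s := by
  have hprod : ∏' p : Nat.Primes,
      (if ((p : ℕ) : ZMod q) ∈ A then (1 - ((p : ℕ) : ℂ) ^ (-s))⁻¹ else 1) =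
      exp (primeRemainder (fun p => if ((p : ℕ) : ZMod q) ∈ A then 1 else 0) s +
        ∑' p : Nat.Primes, (if ((p : ℕ) : ZMod q) ∈ A then 1 else 0) * ((p : ℕ) : ℂ) ^ (-s)) := by
    rw [← tprod_inv_one_sub_eq (fun p => by split_ifs <;> simp) hs]
    exact tprod_congr fun p => by split_ifs <;> simp
  rw [GB, hprod, ← exp_add, logZeta_eq hs, tsum_indicator_mul_prime_cpow hA hs,
    ← Finset.add_sum_erase _ _ (Finset.mem_univ 1), fourierCoeff_one hA,
    tsum_one_mul_prime_cpow (NeZero.ne q) hs, exponentGB]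
  have hχ : ∀ χ ∈ Finset.univ.erase (1 : DirichletCharacter ℂ q),
      fourierCoeff A χ * (ℓ χ s - primeRemainder (fun p => χ (p : ℕ)) s) =
      fourierCoeff A χ * ∑' p : Nat.Primes, χ (p : ℕ) * ((p : ℕ) : ℂ) ^ (-s) := by
    intro χ hχ
    rw [hℓ χ (Finset.ne_of_mem_erase hχ), eulerLog,
      (hasSum_neg_log_prime (w := fun p => χ (p : ℕ)) (fun p => norm_le_one _ _) hs).tsum_eq,
      add_sub_cancel_left]
  rw [Finset.sum_congr rfl hχ]
  congr 1
  ring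

theorem differentiableOn_exponentGB {A : Finset (ZMod q)} {ℓ : DirichletCharacter ℂ q → ℂ → ℂ}
    {U : Set ℂ} (hU : ∀ s ∈ U, 3 / 4 < s.re) (hℓ : ∀ χ ≠ 1, DifferentiableOn ℂ (ℓ χ) U) :
    DifferentiableOn ℂ (exponentGB A ℓ) U := by
  have hrem {w : Nat.Primes → ℂ} (hw : ∀ p, ‖w p‖ ≤ 1) :
      DifferentiableOn ℂ (primeRemainder w) U := (differentiableOn_primeRemainder hw).mono hU
  refine ((DifferentiableOn.fun_sum fun χ hχ => ?_).add (hrem fun p => ?_)).sub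
    (((hrem (by simp)).add (DifferentiableOn.fun_sum fun p hp => ?_)).const_mul _)
  · exact ((hℓ χ (Finset.ne_of_mem_erase hχ)).sub (hrem fun p => norm_le_one _ _)).const_mul _
  · split_ifs <;> simp
  · have hp0 : (p : ℂ) ≠ 0 := by exact_mod_cast (Nat.prime_of_mem_primeFactors hp).ne_zero
    exact DifferentiableOn.const_cpow (by fun_prop) (Or.inl hp0)

end DirichletCharacter

end

section

open Complex

namespace DirichletCharacter

variable {q : ℕ}

theorem log_ten_pow_twelve_le : Real.log (10 ^ 12) ≤ 28 := by
  rw [Real.log_le_iff_le_exp (by norm_num), ← mul_one (28 : ℝ),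
    show (28 : ℝ) = ((28 : ℕ) : ℝ) by norm_num, Real.exp_nat_mul]
  exact (by norm_num : (10 : ℝ) ^ 12 ≤ 2.7 ^ 28).trans
    (pow_le_pow_left₀ (by norm_num) (by linarith [Real.exp_one_gt_d9]) _)

theorem log_le_sqrt_mul_log_sq (hq : 3 ≤ q) : Real.log q ≤ Real.sqrt q * Real.log q ^ 2 := by
  have h1 := one_le_log hq
  have h2 : 1 ≤ Real.sqrt q := Real.one_le_sqrt.2 (by exact_mod_cast (by lia : 1 ≤ q))
  nlinarith [mul_le_mul h2 (le_self_pow₀ h1 two_ne_zero) (by linarith) (by linarith)]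

/-- The width of the region in which logarithms of Dirichlet `L`-functions are considered. -/
noncomputable def logWidth (q : ℕ) : ℝ := 1 / (10 ^ 10 * (Real.sqrt q * Real.log q ^ 2))

theorem logWidth_pos (hq : 3 ≤ q) : 0 < logWidth q := by
  have h1 := one_le_log hq
  have h2 := log_le_sqrt_mul_log_sq hq
  rw [logWidth]
  positivity

theorem logWidth_le (hq : 3 ≤ q) : logWidth q ≤ 1 / (2 * 10 ^ 9 * Real.log q) := by
  have h1 := one_le_log hq
  have h2 := log_le_sqrt_mul_log_sq hq
  rw [logWidth]
  gcongr 1 / ?_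
  nlinarith

variable [NeZero q]

theorem exists_log_LFunction_bound (hq : 3 ≤ q) {χ : DirichletCharacter ℂ q} (hχ : χ ≠ 1) :
    ∃ ℓ : ℂ → ℂ, DifferentiableOn ℂ ℓ (logRegion (logWidth q)) ∧
      (∀ s : ℂ, 1 < s.re → ℓ s = χ.eulerLog s) ∧
      ∀ s : ℂ, 1 - logWidth q / (8 * Real.log (|s.im| + 3)) ≤ s.re →
        ‖ℓ s‖ ≤ 13 * (28 + Real.log (Real.log q) + Real.log (Real.log (|s.im| + 3))) +
          if χ ^ 2 = 1 then 39 * Real.log q else 0 := by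
  have hL := one_le_log hq
  have hQ := log_le_sqrt_mul_log_sq hq
  have hw0 := logWidth_pos hq
  have hwle := logWidth_le hq
  have hle : 1 / (2 * 10 ^ 9 * Real.log q) ≤ 1 / (10 * Real.log q) := by
    gcongr 1 / ?_
    nlinarith
  have h28 := log_ten_pow_twelve_le
  by_cases h2 : χ ^ 2 = 1
  · obtain ⟨ℓ, hd, hexp, heu⟩ := exists_log_LFunction hχ hw0.le fun s hs =>
      LFunction_ne_zero_of_sq_eq_one' hq hχ h2 (le_of_lt hs)
    refine ⟨ℓ, hd, heu, fun s hs => ?_⟩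
    refine (norm_log_LFunction_le hq hχ hw0 (hwle.trans hle) hd hexp heu hs).trans ?_
    have hT := one_le_log_abs_add_three s.im
    set T := Real.log (|s.im| + 3)
    have hq0 : (0 : ℝ) < q := by exact_mod_cast (by lia : 0 < q)
    have e1 : 100 * (T / logWidth q) = 10 ^ 12 * (Real.sqrt q * Real.log q ^ 2) * T := by
      rw [logWidth]
      field_simp
      norm_num
    have hs0 : 0 < Real.sqrt q := Real.sqrt_pos.2 hq0
    rw [if_pos h2, e1, Real.log_mul (by positivity) (by positivity),
      Real.log_mul (by positivity) (by positivity), Real.log_mul (by positivity) (by positivity),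
      Real.log_pow (Real.log q) 2, Real.log_sqrt hq0.le]
    have := Real.log_le_sub_one_of_pos (by linarith : 0 < Real.log q)
    push_cast
    generalize Real.log (10 ^ 12) = c at h28 ⊢
    linarith
  · have hw1 : 0 < 1 / (2 * 10 ^ 9 * Real.log q) := by positivity
    obtain ⟨ℓ, hd, hexp, heu⟩ := exists_log_LFunction hχ hw1.le fun s hs =>
      LFunction_ne_zero_of_sq_ne_one' hq h2 (le_of_lt hs)
    refine ⟨ℓ, hd.mono fun s hs => ?_, heu, fun s hs => ?_⟩
    · have hT := one_le_log_abs_add_three s.im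
      refine lt_of_le_of_lt ?_ (show 1 - logWidth q / Real.log (|s.im| + 3) < s.re from hs)
      gcongr
    · have hT := one_le_log_abs_add_three s.im
      have hs' : 1 - 1 / (2 * 10 ^ 9 * Real.log q) / (8 * Real.log (|s.im| + 3)) ≤ s.re := by
        refine le_trans ?_ hs
        gcongr
      refine (norm_log_LFunction_le hq hχ hw1 hle hd hexp heu hs').trans ?_
      set T := Real.log (|s.im| + 3)
      have e1 : 100 * (T / (1 / (2 * 10 ^ 9 * Real.log q))) =
          2 * 10 ^ 11 * Real.log q * T := by
        field_simp
        norm_num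
      have h11 : Real.log (2 * 10 ^ 11) ≤ Real.log (10 ^ 12) :=
        Real.log_le_log (by norm_num) (by norm_num)
      rw [if_neg h2, e1, Real.log_mul (by positivity) (by positivity),
        Real.log_mul (by positivity) (by positivity)]
      linarith

theorem sum_norm_fourierCoeff_mul_ite_le {A : Finset (ZMod q)} (hA : ∀ a ∈ A, IsUnit a) :
    ∑ χ ∈ Finset.univ.erase (1 : DirichletCharacter ℂ q),
      ‖fourierCoeff A χ‖ * (if χ ^ 2 = 1 then 39 * Real.log q else 0) ≤
      5616 * (min A.card (q.totient - A.card) : ℕ) := by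
  have hφ := totient_pos_real (q := q)
  have hlog := Real.log_natCast_nonneg q
  set b : ℝ := ((min A.card (q.totient - A.card) : ℕ) : ℝ)
  have hb : 0 ≤ b := Nat.cast_nonneg _
  calc _ ≤ ∑ χ ∈ Finset.univ.erase (1 : DirichletCharacter ℂ q),
        b / q.totient * (if χ ^ 2 = 1 then 39 * Real.log q else 0) := by
        refine Finset.sum_le_sum fun χ hχ => mul_le_mul_of_nonneg_right
          (norm_fourierCoeff_le_min hA (Finset.ne_of_mem_erase hχ)) ?_
        split_ifs <;> positivity
    _ ≤ ∑ χ : DirichletCharacter ℂ q,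
        b / q.totient * (if χ ^ 2 = 1 then 39 * Real.log q else 0) := by
        refine Finset.sum_le_sum_of_subset_of_nonneg (Finset.erase_subset _ _) fun χ _ _ => ?_
        split_ifs <;> positivity
    _ = b / q.totient * 39 * (Real.log q *
        (Finset.univ.filter fun χ : DirichletCharacter ℂ q => χ ^ 2 = 1).card) := by
        rw [← Finset.mul_sum, ← Finset.sum_filter, Finset.sum_const, nsmul_eq_mul]
        ring
    _ ≤ b / q.totient * 39 * (144 * q.totient) := by
        exact mul_le_mul_of_nonneg_left log_mul_card_sq_eq_one_le (by positivity)
    _ = 5616 * b := by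
        field_simp
        ring

theorem norm_exponentGB_le {A : Finset (ZMod q)} (hA : ∀ a ∈ A, IsUnit a)
    {ℓ : DirichletCharacter ℂ q → ℂ → ℂ} {s : ℂ} (hs : 3 / 4 < s.re) {M : ℝ} (hM : 0 ≤ M)
    (hℓ : ∀ χ ≠ 1, ‖ℓ χ s‖ ≤ M + if χ ^ 2 = 1 then 39 * Real.log q else 0) :
    ‖exponentGB A ℓ s‖ ≤
      Real.sqrt (min A.card (q.totient - A.card) : ℕ) * (M + primeRemainderBound) +
        5616 * (min A.card (q.totient - A.card) : ℕ) + 2 * primeRemainderBound + 2 +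
        Real.log q / 4 := by
  have hφ := totient_pos_real (q := q)
  have hR := primeRemainderBound_nonneg
  have hsum : ‖∑ χ ∈ Finset.univ.erase (1 : DirichletCharacter ℂ q),
      fourierCoeff A χ * (ℓ χ s - primeRemainder (fun p => χ (p : ℕ)) s)‖ ≤
      Real.sqrt (min A.card (q.totient - A.card) : ℕ) * (M + primeRemainderBound) +
        5616 * (min A.card (q.totient - A.card) : ℕ) := by
    calc _ ≤ ∑ χ ∈ Finset.univ.erase (1 : DirichletCharacter ℂ q),
          (‖fourierCoeff A χ‖ * (M + primeRemainderBound) +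
            ‖fourierCoeff A χ‖ * (if χ ^ 2 = 1 then 39 * Real.log q else 0)) := by
          refine norm_sum_le_of_le _ fun χ hχ => ?_
          rw [norm_mul, ← mul_add]
          gcongr
          refine (norm_sub_le _ _).trans ?_
          have h1 := hℓ χ (Finset.ne_of_mem_erase hχ)
          have h2 := norm_primeRemainder_le (w := fun p => χ (p : ℕ))
            (fun p => norm_le_one _ _) hs
          linarith
      _ ≤ _ := by
          rw [Finset.sum_add_distrib, ← Finset.sum_mul]
          exact add_le_add (mul_le_mul_of_nonneg_right (sum_norm_fourierCoeff_le hA) (by positivity))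
            (sum_norm_fourierCoeff_mul_ite_le hA)
  have hind := norm_primeRemainder_le
    (w := fun p => if ((p : ℕ) : ZMod q) ∈ A then 1 else 0) (fun p => by split_ifs <;> simp) hs
  have hone := norm_primeRemainder_le (w := 1) (by simp) hs
  have hfac : ‖∑ p ∈ q.primeFactors, (p : ℂ) ^ (-s)‖ ≤ 2 + Real.log q / 4 := by
    refine le_trans (norm_sum_le_of_le _ fun p hp => ?_) (sum_primeFactors_rpow_le (NeZero.ne q))
    have := norm_mul_prime_cpow_le (z := 1) (by simp)
      ⟨p, Nat.prime_of_mem_primeFactors hp⟩ hs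
    rwa [one_mul] at this
  have hβ : ‖(A.card : ℂ) / q.totient‖ ≤ 1 := by
    rw [norm_div, norm_natCast, norm_natCast]
    exact div_le_one_of_le₀ (by exact_mod_cast card_le_totient hA) hφ.le
  have hlast : ‖(A.card : ℂ) / q.totient *
      (primeRemainder 1 s + ∑ p ∈ q.primeFactors, (p : ℂ) ^ (-s))‖ ≤
      primeRemainderBound + (2 + Real.log q / 4) := by
    rw [norm_mul]
    exact (mul_le_of_le_one_left (norm_nonneg _) hβ).trans
      ((norm_add_le _ _).trans (add_le_add hone hfac))
  rw [exponentGB]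
  refine (norm_sub_le _ _).trans ?_
  have := norm_add_le (∑ χ ∈ Finset.univ.erase (1 : DirichletCharacter ℂ q),
    fourierCoeff A χ * (ℓ χ s - primeRemainder (fun p => χ (p : ℕ)) s))
    (primeRemainder (fun p => if ((p : ℕ) : ZMod q) ∈ A then 1 else 0) s)
  linarith

end DirichletCharacter

theorem Real.sq_log_le {x : ℝ} (hx : 1 ≤ x) : Real.log x ^ 2 ≤ 4 * x := by
  have h0 : 0 ≤ Real.log x := Real.log_nonneg hx
  have h1 := Real.log_le_sub_one_of_pos (Real.sqrt_pos.2 (by linarith : 0 < x))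
  rw [Real.log_sqrt (by linarith)] at h1
  nlinarith [Real.sq_sqrt (by linarith : 0 ≤ x), Real.sqrt_nonneg x]

theorem sqrt_mul_log_le {b x : ℝ} (hb : 0 ≤ b) (hx : 1 ≤ x) :
    13 * (Real.sqrt b * Real.log x) ≤ 676 * b + x / 4 := by
  nlinarith [Real.sq_log_le hx, Real.sq_sqrt hb, sq_nonneg (26 * Real.sqrt b - Real.log x / 4)]

theorem Nat.sqrt_cast_le (b : ℕ) : Real.sqrt b ≤ b := by
  rw [Real.sqrt_le_left (Nat.cast_nonneg b)]
  exact_mod_cast Nat.le_self_pow two_ne_zero b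

theorem log_abs_add_three_le (t : ℝ) : Real.log (|t| + 3) ≤ 2 * (1 + logPlus |t|) := by
  have hle : |t| + 3 ≤ 4 * max 1 |t| := by
    rcases le_total 1 |t| with h | h
    · rw [max_eq_right h]; linarith
    · rw [max_eq_left h]; linarith
  have h1 := Real.log_le_log (by positivity) hle
  have h4 : Real.log 4 ≤ 2 := by
    rw [show (4 : ℝ) = 2 ^ 2 by norm_num, Real.log_pow]
    push_cast
    linarith [Real.log_two_lt_d9]
  have hm : Real.log (max 1 |t|) ≤ logPlus |t| := by
    rw [logPlus]
    rcases le_total 1 |t| with h | h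
    · rw [max_eq_right h]; exact le_max_right _ _
    · rw [max_eq_left h, Real.log_one]; exact le_max_left _ _
  have h0 : 0 ≤ logPlus |t| := le_max_left _ _
  rw [Real.log_mul (by norm_num) (by positivity)] at h1
  linarith

theorem pow_le_mul_self_pow {C : ℝ} (hC : 0 ≤ C) (b : ℕ) : C ^ b ≤ (C * b) ^ b := by
  rcases Nat.eq_zero_or_pos b with rfl | hb
  · simp
  · exact pow_le_pow_left₀ hC (le_mul_of_one_le_right hC (by exact_mod_cast hb)) b

end

open DirichletCharacter in
theorem exists_analytic_continuation_GB {q : ℕ} (hq : 3 ≤ q) {A : Finset (ZMod q)}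
    (hA : ∀ a ∈ A, IsUnit a) :
    ∃ g : ℂ → ℂ, AnalyticOnNhd ℂ g (logRegion (logWidth q)) ∧
      (∀ s : ℂ, 1 < s.re → g s = GB q A s) ∧
      ∀ s : ℂ, 1 - logWidth q / (8 * Real.log (|s.im| + 3)) ≤ s.re →
        ‖g s‖ ≤ Real.exp ((7332 + primeRemainderBound) * (min A.card (q.totient - A.card) : ℕ) +
          (2 * primeRemainderBound + 2) + Real.log q / 2 + Real.log (|s.im| + 3) / 4) := by
  have : NeZero q := ⟨by lia⟩
  have hL := one_le_log hq
  have hw := logWidth_pos hq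
  have hw4 : logWidth q ≤ 1 / 8 := (logWidth_le hq).trans
    (one_div_le_one_div_of_le (by norm_num) (by nlinarith))
  have hre : ∀ s ∈ logRegion (logWidth q), 3 / 4 < s.re := by
    intro s hs
    have hs' : 1 - logWidth q / Real.log (|s.im| + 3) < s.re := hs
    have := div_le_self hw.le (one_le_log_abs_add_three s.im)
    linarith
  have hex : ∀ χ : DirichletCharacter ℂ q, ∃ ℓ : ℂ → ℂ, χ ≠ 1 →
      DifferentiableOn ℂ ℓ (logRegion (logWidth q)) ∧
      (∀ s : ℂ, 1 < s.re → ℓ s = χ.eulerLog s) ∧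
      ∀ s : ℂ, 1 - logWidth q / (8 * Real.log (|s.im| + 3)) ≤ s.re →
        ‖ℓ s‖ ≤ 13 * (28 + Real.log (Real.log q) + Real.log (Real.log (|s.im| + 3))) +
          if χ ^ 2 = 1 then 39 * Real.log q else 0 := by
    intro χ
    by_cases hχ : χ = 1
    · exact ⟨0, fun h => absurd hχ h⟩
    · obtain ⟨ℓ, hℓ⟩ := exists_log_LFunction_bound hq hχ
      exact ⟨ℓ, fun _ => hℓ⟩
  choose ℓ hℓ using hex
  refine ⟨fun s => Complex.exp (exponentGB A ℓ s), ?_, fun s hs => ?_, fun s hs => ?_⟩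
  · exact (differentiableOn_exponentGB hre fun χ hχ => (hℓ χ hχ).1).cexp.analyticOnNhd
      (isOpen_logRegion _)
  · exact exp_exponentGB hA hs fun χ hχ => (hℓ χ hχ).2.1 s hs
  · have hT := one_le_log_abs_add_three s.im
    have hre' : 3 / 4 < s.re := by
      have : logWidth q / (8 * Real.log (|s.im| + 3)) ≤ logWidth q :=
        div_le_self hw.le (by linarith)
      linarith
    have hR := primeRemainderBound_nonneg
    have hM : 0 ≤ 13 * (28 + Real.log (Real.log q) + Real.log (Real.log (|s.im| + 3))) := by
      have := Real.log_nonneg hL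
      have := Real.log_nonneg hT
      positivity
    have hE := norm_exponentGB_le hA hre' hM fun χ hχ => (hℓ χ hχ).2.2 s hs
    show ‖Complex.exp (exponentGB A ℓ s)‖ ≤ _
    rw [Complex.norm_exp]
    refine Real.exp_le_exp.2 ((Complex.re_le_norm _).trans (hE.trans ?_))
    set b : ℕ := min A.card (q.totient - A.card)
    have hsb := Nat.sqrt_cast_le b
    have h1 := sqrt_mul_log_le (Nat.cast_nonneg b) hL
    have h2 := sqrt_mul_log_le (Nat.cast_nonneg b) hT
    have h3 := mul_le_mul_of_nonneg_right hsb hR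
    linarith

theorem stmt4 : ∃ η C K : ℝ, 0 < η ∧ η < 1 / 81 ∧ 0 < C ∧ 0 < K ∧
    ∀ (q : ℕ), 3 ≤ q → ∀ A : Finset (ZMod q), (∀ a ∈ A, IsUnit a) → 1 ≤ A.card →
      ∃ (U : Set ℂ) (g : ℂ → ℂ), IsOpen U ∧
        sdRegion (η / (Real.sqrt q * Real.log q ^ 2)) ⊆ U ∧
        AnalyticOnNhd ℂ g U ∧
        (∀ s : ℂ, 1 < s.re → g s = GB q A s) ∧
        ∀ s ∈ sdRegion (η / (Real.sqrt q * Real.log q ^ 2)),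
          ‖g s‖ ≤ K * Real.sqrt q * Real.log q ^ 2 *
            (C * (min A.card (q.totient - A.card) : ℝ)) ^ (min A.card (q.totient - A.card)) *
            (1 + |s.im|) ^ ((1 : ℝ) / 2) := by
  
  have hR := primeRemainderBound_nonneg
  refine ⟨1 / 10 ^ 12, Real.exp (7332 + primeRemainderBound),
    Real.exp (2 * primeRemainderBound + 3), by norm_num, by norm_num, Real.exp_pos _,
    Real.exp_pos _, fun q hq A hA _ => ?_⟩
  obtain ⟨g, hg, hGB, hbound⟩ := exists_analytic_continuation_GB hq hA
  have : NeZero q := ⟨by lia⟩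
  have hL := DirichletCharacter.one_le_log hq
  have hQ := DirichletCharacter.log_le_sqrt_mul_log_sq hq
  have hw := DirichletCharacter.logWidth_pos hq
  have hregion : ∀ s ∈ sdRegion (1 / 10 ^ 12 / (Real.sqrt q * Real.log q ^ 2)),
      1 - DirichletCharacter.logWidth q / (8 * Real.log (|s.im| + 3)) ≤ s.re := by
    intro s hs
    refine le_trans (sub_le_sub_left ?_ 1) (show _ ≤ s.re from hs)
    have hT := DirichletCharacter.one_le_log_abs_add_three s.im
    have hT2 := log_abs_add_three_le s.im
    rw [DirichletCharacter.logWidth, div_div, div_div, div_div]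
    refine one_div_le_one_div_of_le (by positivity) ?_
    have : 0 < Real.sqrt q * Real.log q ^ 2 := by linarith
    nlinarith [mul_le_mul_of_nonneg_left hT2 this.le]
  refine ⟨logRegion (DirichletCharacter.logWidth q), g, isOpen_logRegion _, fun s hs => ?_, hg,
    hGB, fun s hs => ?_⟩
  · refine lt_of_lt_of_le ?_ (hregion s hs)
    have hT := DirichletCharacter.one_le_log_abs_add_three s.im
    gcongr
    linarith
  · refine (hbound s (hregion s hs)).trans ?_
    have hq0 : (0 : ℝ) < q := by exact_mod_cast (by lia : 0 < q)
    have hb : (min (A.card : ℝ) (q.totient - A.card)) =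
        ((min A.card (q.totient - A.card) : ℕ) : ℝ) := by
      rw [Nat.cast_min, Nat.cast_sub (DirichletCharacter.card_le_totient hA)]
    rw [hb]
    set b : ℕ := min A.card (q.totient - A.card)
    have hT : Real.log (|s.im| + 3) / 4 ≤ 1 + Real.log (1 + |s.im|) * (1 / 2) := by
      have h3 : Real.log 3 ≤ 2 := by
        linarith [Real.log_le_sub_one_of_pos (by norm_num : (0 : ℝ) < 3)]
      have h1 := Real.log_le_log (by positivity)
        (by linarith [abs_nonneg s.im] : |s.im| + 3 ≤ 3 * (1 + |s.im|))
      rw [Real.log_mul (by norm_num) (by positivity)] at h1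
      have := Real.log_nonneg (by linarith [abs_nonneg s.im] : 1 ≤ 1 + |s.im|)
      linarith
    calc _ ≤ Real.exp ((2 * primeRemainderBound + 3) + Real.log q / 2 +
          b * (7332 + primeRemainderBound) + Real.log (1 + |s.im|) * (1 / 2)) :=
          Real.exp_le_exp.2 (by linarith)
      _ = Real.exp (2 * primeRemainderBound + 3) * Real.sqrt q *
          Real.exp (7332 + primeRemainderBound) ^ b * (1 + |s.im|) ^ ((1 : ℝ) / 2) := by
          rw [Real.exp_add, Real.exp_add, Real.exp_add, Real.exp_nat_mul, Real.exp_half,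
            Real.exp_log hq0, Real.rpow_def_of_pos (by positivity)]
      _ ≤ _ := by
          refine mul_le_mul_of_nonneg_right (mul_le_mul
            (le_mul_of_one_le_right (by positivity) (one_le_pow₀ hL))
            (pow_le_mul_self_pow (Real.exp_pos _).le b) (by positivity) (by positivity))
            (by positivity)
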